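/- Let Q satisfy Assumption (A). Then: (i) for any nonzero φ = φ_f ∈ Φ_rad and nonzero φ̃ = φ_{f̃} ∈ Φ_rad, the function λ ↦ J(φ + λ(φ̃ − φ)) is twice differentiable on [0,1]; (ii) φ_Q is a critical point of J: for every f ∈ E_rad with φ_f ≠ 0, the derivative of λ ↦ J(φ_Q + λ(φ_f − φ_Q)) vanishes at λ = 0. -/

import Mathlib

noncomputable section

open MeasureTheory Real Filter Set Topology
open scoped ENNReal NNReal

abbrev E3 : Type := EuclideanSpace ℝ (Fin 3)
abbrev Phase : Type := E3 × E3

/-- Spherical symmetry: invariance under all rotations of `ℝ³` acting jointly on `x` and `v`. -/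
def SphSym (f : Phase → ℝ) : Prop :=
  ∀ R : E3 ≃ₗᵢ[ℝ] E3, LinearMap.det (R.toLinearEquiv : E3 →ₗ[ℝ] E3) = 1 →
    ∀ z : Phase, f (R z.1, R z.2) = f z

/-- `|x × v|²`, via the Lagrange identity. -/
def ellOf (z : Phase) : ℝ := ‖z.1‖ ^ 2 * ‖z.2‖ ^ 2 - (inner ℝ z.1 z.2 : ℝ) ^ 2

/-- Spatial density. -/
def rhoF (f : Phase → ℝ) (x : E3) : ℝ := ∫ v : E3, f (x, v)

/-- Poisson field. -/
def phiF (f : Phase → ℝ) (x : E3) : ℝ := - ∫ y : E3, rhoF f y / (4 * π * ‖x - y‖)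

/-- Radial representation of the Poisson field. -/
def phiRad (f : Phase → ℝ) (r : ℝ) : ℝ :=
  phiF f (r • (EuclideanSpace.single (0 : Fin 3) (1:ℝ)))

def mass (f : Phase → ℝ) : ℝ := ∫ z : Phase, f z

def kineticE (f : Phase → ℝ) : ℝ := ∫ z : Phase, ‖z.2‖ ^ 2 * f z

def gradPhi (f : Phase → ℝ) (x : E3) : E3 := gradient (phiF f) x

def fieldSq (f : Phase → ℝ) : ℝ := ∫ x : E3, ‖gradPhi f x‖ ^ 2

/-- `L²` distance between the force fields of `f` and `g`. -/
def fieldDist (f g : Phase → ℝ) : ℝ :=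
  Real.sqrt (∫ x : E3, ‖gradPhi f x - gradPhi g x‖ ^ 2)

/-- The Hamiltonian. -/
def Ham (f : Phase → ℝ) : ℝ := kineticE f / 2 - fieldSq f / 2

/-- The norm of the energy space. -/
def eNormE (f : Phase → ℝ) : ℝ≥0∞ :=
  eLpNorm f 1 volume + eLpNorm f ⊤ volume +
    ∫⁻ z : Phase, (‖z.2‖₊ : ℝ≥0∞) ^ 2 * (‖f z‖₊ : ℝ≥0∞)

def memE (f : Phase → ℝ) : Prop := Measurable f ∧ (∀ z, 0 ≤ f z) ∧ eNormE f < ⊤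

def memErad (f : Phase → ℝ) : Prop := memE f ∧ SphSym f

/-- Density of the measure `ν_ℓ`. -/
def nuDens (ℓ : ℝ) (p : ℝ × ℝ) : ℝ≥0∞ :=
  if 0 < p.1 ∧ ℓ < p.1 ^ 2 * p.2 ^ 2 then
    ENNReal.ofReal (4 * π ^ 2 * p.1 * |p.2| / Real.sqrt (p.1 ^ 2 * p.2 ^ 2 - ℓ))
  else 0

def nuMeas (ℓ : ℝ) : Measure (ℝ × ℝ) := volume.withDensity (nuDens ℓ)

/-- Representative phase point with `|x| = r`, `|v| = |u|`, `|x×v|² = ℓ` and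
`x·v = sign u · √(r²u²-ℓ)`. -/
def radPoint (r u ℓ : ℝ) : Phase :=
  (r • (EuclideanSpace.single (0 : Fin 3) (1:ℝ)),
   (Real.sign u * Real.sqrt (r ^ 2 * u ^ 2 - ℓ) / r) • (EuclideanSpace.single (0 : Fin 3) (1:ℝ))
     + (Real.sqrt ℓ / r) • (EuclideanSpace.single (1 : Fin 3) (1:ℝ)))

/-- Distribution function of `f` at kinetic momentum `ℓ`. -/
def muDist (f : Phase → ℝ) (s ℓ : ℝ) : ℝ≥0∞ :=
  nuMeas ℓ {p : ℝ × ℝ | s < f (radPoint p.1 p.2 ℓ)}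

/-- `g ∈ Eq(f)` : `g` is nonnegative, spherically symmetric and equimeasurable to `f`
at (almost) every kinetic momentum `ℓ`. -/
def EqMeas (f g : Phase → ℝ) : Prop :=
  (∀ z, 0 ≤ g z) ∧ SphSym g ∧
    ∀ s : ℝ, 0 < s →
      ∀ᵐ ℓ ∂(volume.restrict (Ioi (0:ℝ))), muDist g s ℓ = muDist f s ℓ

/-- Schwarz symmetrization of `f` at fixed `ℓ`. -/
def schwarz (f : Phase → ℝ) (t ℓ : ℝ) : ℝ :=
  if ENNReal.ofReal t < muDist f 0 ℓ then
    sSup {s : ℝ | 0 ≤ s ∧ ENNReal.ofReal t < muDist f s ℓ}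
  else 0

/-- Effective potential. -/
def psiPot (φ : ℝ → ℝ) (ℓ r : ℝ) : ℝ := φ r + ℓ / (2 * r ^ 2)

def eMinPot (φ : ℝ → ℝ) (ℓ : ℝ) : ℝ := sInf (psiPot φ ℓ '' Ioi 0)

def r1Pot (φ : ℝ → ℝ) (e ℓ : ℝ) : ℝ := sInf {r : ℝ | 0 < r ∧ psiPot φ ℓ r < e}

def r2Pot (φ : ℝ → ℝ) (e ℓ : ℝ) : ℝ := sSup {r : ℝ | 0 < r ∧ psiPot φ ℓ r < e}

/-- The Jacobian `a_φ(e, ℓ)` (meaningful for `e < 0`). -/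
def aPot (φ : ℝ → ℝ) (e ℓ : ℝ) : ℝ :=
  8 * π ^ 2 * Real.sqrt 2 * ∫ r in Ioi (0:ℝ), Real.sqrt (max (e - psiPot φ ℓ r) 0)

/-- Inverse of the bijection `e ↦ a_φ(e,ℓ)` from `(e_{φ,ℓ},0)` onto `(0,∞)`. -/
def aPotInv (φ : ℝ → ℝ) (s ℓ : ℝ) : ℝ :=
  sSup {e : ℝ | eMinPot φ ℓ < e ∧ e < 0 ∧ aPot φ e ℓ < s}

/-- Microscopic energy w.r.t. the Poisson field of `g`. -/
def microE (g : Phase → ℝ) (z : Phase) : ℝ := ‖z.2‖ ^ 2 / 2 + phiF g z.1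

/-- Rearrangement of `f` with respect to the microscopic energy of the field of `g`. -/
def rearr (f g : Phase → ℝ) (z : Phase) : ℝ :=
  if microE g z < 0 then
    schwarz f (aPot (phiRad g) (microE g z) (ellOf z)) (ellOf z)
  else 0

/-- Assumption (A). -/
structure AssumptionA (Q : Phase → ℝ) (F : ℝ → ℝ → ℝ) (e₀ : ℝ) : Prop where
  contQ : Continuous Q
  nonneg : ∀ z, 0 ≤ Q z
  nonzero : Q ≠ 0
  cpt : HasCompactSupport Q
  sph : SphSym Q
  eqF : ∀ z : Phase, Q z = F (microE Q z) (ellOf z)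
  Fnonneg : ∀ e ℓ, 0 ≤ ℓ → 0 ≤ F e ℓ
  Fcont : ContinuousOn (fun p : ℝ × ℝ => F p.1 p.2) {p : ℝ × ℝ | 0 ≤ p.2}
  e₀neg : e₀ < 0
  Fsupp : ∀ e ℓ, 0 ≤ ℓ → 0 < F e ℓ → e < e₀
  FC1 : ContDiffOn ℝ 1 (fun p : ℝ × ℝ => F p.1 p.2) {p : ℝ × ℝ | 0 ≤ p.2 ∧ 0 < F p.1 p.2}
  FeNeg : ∀ e ℓ, 0 ≤ ℓ → 0 < F e ℓ → deriv (fun e' => F e' ℓ) e < 0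

/-- The reduced functional `J_{f^*}(φ_g) = H(f^{*φ_g}) + ½|∇φ_g − ∇φ_{f^{*φ_g}}|²`. -/
def Jred (f g : Phase → ℝ) : ℝ :=
  Ham (rearr f g) + (∫ x : E3, ‖gradPhi g x - gradPhi (rearr f g) x‖ ^ 2) / 2

def distL1 (f g : Phase → ℝ) : ℝ := ∫ z : Phase, |f z - g z|

def distL1v (f g : Phase → ℝ) : ℝ := ∫ z : Phase, ‖z.2‖ ^ 2 * |f z - g z|



noncomputable section
open MeasureTheory Real Filter Set Topology
open scoped ENNReal NNReal

structure Pot (C c : ℝ) (u : ℝ → ℝ) : Prop where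
  hC : 0 < C
  hc : 0 < c
  cvx : ConvexOn ℝ univ u
  lip : ∀ a b, |u a - u b| ≤ C * |a - b|
  zero : u 0 = 0
  negq : ∀ q, q ≤ 0 → 0 ≤ u q
  nonpos : ∀ q, 0 ≤ q → u q ≤ 0
  lb : ∀ q, -C ≤ u q
  small : ∀ q, 0 ≤ q → q ≤ 1 → u q ≤ -c * q

def xF (ℓ E : ℝ) (u : ℝ → ℝ) (q : ℝ) : ℝ := E - u q - ℓ * q ^ 2 / 2

lemma Pot.cont {C c : ℝ} {u : ℝ → ℝ} (h : Pot C c u) : Continuous u := by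
  have : LipschitzWith ⟨C, h.hC.le⟩ u := by
    apply LipschitzWith.of_dist_le_mul
    intro a b
    rw [Real.dist_eq, Real.dist_eq]; exact h.lip a b
  exact this.continuous

lemma Pot.xcont {C c : ℝ} {u : ℝ → ℝ} (h : Pot C c u) (ℓ E : ℝ) : Continuous (xF ℓ E u) := by
  have := h.cont
  unfold xF; fun_prop

lemma Pot.lbq {C c : ℝ} {u : ℝ → ℝ} (h : Pot C c u) (q : ℝ) : -(C * |q|) ≤ u q := by
  have := h.lip q 0
  rw [h.zero, sub_zero, sub_zero] at this
  exact (abs_le.1 this).1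

lemma Pot.xpos {C c : ℝ} {u : ℝ → ℝ} (h : Pot C c u) {ℓ E q : ℝ} (hℓ : 0 < ℓ) (hE : E < 0)
    (hx : 0 < xF ℓ E u q) : 0 < q ∧ -E / C < q ∧ q < 2 * C / ℓ := by
  have hC := h.hC
  unfold xF at hx
  have h2 : 0 ≤ ℓ * q ^ 2 / 2 := by positivity
  have hq : 0 < q := by
    by_contra hq
    have := h.negq q (not_lt.1 hq)
    linarith
  have h1 := h.lbq q
  rw [abs_of_pos hq] at h1
  refine ⟨hq, ?_, ?_⟩
  · rw [div_lt_iff₀ hC]; nlinarith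
  · rw [lt_div_iff₀ hℓ]
    have : q * (q * ℓ) < q * (2 * C) := by nlinarith
    exact lt_of_mul_lt_mul_left this hq.le

lemma Pot.xle {C c : ℝ} {u : ℝ → ℝ} (h : Pot C c u) {ℓ E q : ℝ} (hℓ : 0 < ℓ) (hE : E < 0) :
    xF ℓ E u q ≤ C := by
  have h2 : 0 ≤ ℓ * q ^ 2 / 2 := by positivity
  have := h.lb q
  unfold xF; linarith

lemma Pot.xconc {C c : ℝ} {u : ℝ → ℝ} (h : Pot C c u) (ℓ E a b τ : ℝ) (h0 : 0 ≤ τ) (h1 : τ ≤ 1) :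
    (1 - τ) * xF ℓ E u a + τ * xF ℓ E u b + ℓ / 2 * (τ * (1 - τ)) * (b - a) ^ 2
      ≤ xF ℓ E u (a + (b - a) * τ) := by
  have := h.cvx.2 (mem_univ a) (mem_univ b) (sub_nonneg.2 h1) h0 (by ring)
  simp only [smul_eq_mul] at this
  have e : (1 - τ) * a + τ * b = a + (b - a) * τ := by ring
  rw [e] at this
  unfold xF
  nlinarith

def qS (ℓ E : ℝ) (u : ℝ → ℝ) : ℝ := sSup {q | 0 < xF ℓ E u q}
def qI (ℓ E : ℝ) (u : ℝ → ℝ) : ℝ := sInf {q | 0 < xF ℓ E u q}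

lemma Pot.interval {C c : ℝ} {u : ℝ → ℝ} (h : Pot C c u) {ℓ E : ℝ} (hℓ : 0 < ℓ) (hE : E < 0)
    (hne : ∃ q, 0 < xF ℓ E u q) :
    (∀ q, 0 < xF ℓ E u q ↔ qI ℓ E u < q ∧ q < qS ℓ E u) ∧ xF ℓ E u (qI ℓ E u) = 0 ∧
      xF ℓ E u (qS ℓ E u) = 0 ∧ qI ℓ E u < qS ℓ E u ∧ 0 < qI ℓ E u := by
  set S : Set ℝ := {q | 0 < xF ℓ E u q} with hS
  have hSo : IsOpen S := isOpen_lt continuous_const (h.xcont ℓ E)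
  have hSn : S.Nonempty := hne
  have hb : BddBelow S := ⟨0, fun q hq => (h.xpos hℓ hE hq).1.le⟩
  have ha : BddAbove S := ⟨2 * C / ℓ, fun q hq => (h.xpos hℓ hE hq).2.2.le⟩
  have hconv : Convex ℝ S := by
    intro a ha b hb s t hs ht hst
    have := h.xconc ℓ E a b t ht (by linarith)
    have e : s • a + t • b = a + (b - a) * t := by
      simp only [smul_eq_mul]; rw [show s = 1 - t by linarith]; ring
    rw [e]
    have ha' : 0 < xF ℓ E u a := ha
    have hb' : 0 < xF ℓ E u b := hb
    have hs1 : s = 1 - t := by linarith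
    rw [hs1] at hs
    have h3 : 0 ≤ ℓ / 2 * (t * (1 - t)) * (b - a) ^ 2 := by positivity
    show 0 < xF ℓ E u (a + (b - a) * t)
    rcases eq_or_lt_of_le ht with h0 | h0
    · rw [← h0] at this ⊢; simp at this ⊢; exact ha'
    · nlinarith [mul_pos h0 hb', mul_nonneg hs ha'.le]
  have hconn : IsConnected S := ⟨hSn, hconv.isPreconnected⟩
  have hsub := hconn.Ioo_csInf_csSup_subset hb ha
  have hmemC : ∀ q ∈ closure S, 0 ≤ xF ℓ E u q := by
    intro q hq
    exact closure_minimal (s := S) (t := {q | 0 ≤ xF ℓ E u q}) (fun q hq => show 0 ≤ xF ℓ E u q from le_of_lt hq)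
      (isClosed_le continuous_const (h.xcont ℓ E)) hq
  have hI : sInf S ∉ S := by
    intro hmem
    obtain ⟨ε, hε, hb'⟩ := Metric.isOpen_iff.1 hSo _ hmem
    have : sInf S - ε / 2 ∈ S := hb' (by simp [abs_of_pos hε]; linarith)
    have := csInf_le hb this
    linarith
  have hSu : sSup S ∉ S := by
    intro hmem
    obtain ⟨ε, hε, hb'⟩ := Metric.isOpen_iff.1 hSo _ hmem
    have : sSup S + ε / 2 ∈ S := hb' (by simp [abs_of_pos hε]; linarith)
    have := le_csSup ha this
    linarith
  have key : ∀ q, 0 < xF ℓ E u q ↔ sInf S < q ∧ q < sSup S := by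
    intro q
    refine ⟨fun hq => ⟨lt_of_le_of_ne (csInf_le hb hq) ?_, lt_of_le_of_ne (le_csSup ha hq) ?_⟩,
      fun hq => hsub hq⟩
    · rintro rfl; exact hI hq
    · rintro rfl; exact hSu hq
  have hlt : sInf S < sSup S := by
    obtain ⟨q, hq⟩ := hne
    exact ((key q).1 hq).1.trans ((key q).1 hq).2
  have z1 : xF ℓ E u (sInf S) = 0 :=
    le_antisymm (not_lt.1 hI) (hmemC _ (csInf_mem_closure hSn hb))
  have z2 : xF ℓ E u (sSup S) = 0 :=
    le_antisymm (not_lt.1 hSu) (hmemC _ (csSup_mem_closure hSn ha))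
  refine ⟨key, z1, z2, hlt, ?_⟩
  have h1 : 0 ≤ sInf S := le_csInf hSn (fun q hq => (h.xpos hℓ hE hq).1.le)
  rcases eq_or_lt_of_le h1 with h0 | h0
  · rw [← h0] at z1
    simp [xF, h.zero] at z1
    linarith
  · exact h0

lemma Pot.xneg {C c : ℝ} {u : ℝ → ℝ} (h : Pot C c u) {ℓ E : ℝ} (hℓ : 0 < ℓ) {q a b : ℝ}
    (hq : 0 < xF ℓ E u q) (ha : xF ℓ E u a = 0)
    (hb : (q < a ∧ a < b) ∨ (b < a ∧ a < q)) : xF ℓ E u b < 0 := by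
  by_contra hcon
  push Not at hcon
  have hne : b - q ≠ 0 := by rcases hb with hb | hb <;> intro h0 <;> linarith [hb.1, hb.2]
  have h01 : 0 < (a - q) / (b - q) ∧ (a - q) / (b - q) < 1 := by
    rcases hb with hb | hb
    · have : 0 < b - q := by linarith
      exact ⟨div_pos (by linarith) this, by rw [div_lt_one this]; linarith⟩
    · have : b - q < 0 := by linarith
      exact ⟨div_pos_of_neg_of_neg (by linarith) this, by rw [div_lt_one_of_neg this]; linarith⟩
  have := h.xconc ℓ E q b _ h01.1.le h01.2.le
  rw [mul_div_cancel₀ _ hne, add_sub_cancel, ha] at this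
  have h3 : 0 ≤ ℓ / 2 * ((a - q) / (b - q) * (1 - (a - q) / (b - q))) * (b - q) ^ 2 := by
    have := h01.1.le; have := sub_nonneg.2 h01.2.le; positivity
  nlinarith [mul_pos (sub_pos.2 h01.2) hq, mul_nonneg h01.1.le hcon]

/-- convergence set up -/
structure Conv {ι : Type*} (l : Filter ι) (C c : ℝ) (En : ι → ℝ) (un : ι → ℝ → ℝ) (E : ℝ)
    (u : ℝ → ℝ) : Prop where
  pn : ∀ᶠ n in l, Pot C c (un n)
  p : Pot C c u
  hE : Tendsto En l (𝓝 E)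
  hu : ∀ q, Tendsto (fun n => un n q) l (𝓝 (u q))
  neg : E < 0

section conv
variable {ι : Type*} {l : Filter ι} {C c : ℝ} {En : ι → ℝ} {un : ι → ℝ → ℝ} {E : ℝ} {u : ℝ → ℝ}

lemma Conv.negn (h : Conv l C c En un E u) : ∀ᶠ n in l, En n < E / 2 :=
  h.hE.eventually_lt_const (by linarith [h.neg])

lemma Conv.tx (h : Conv l C c En un E u) (ℓ : ℝ) {qn : ι → ℝ} {q : ℝ}
    (hq : Tendsto qn l (𝓝 q)) :
    Tendsto (fun n => xF ℓ (En n) (un n) (qn n)) l (𝓝 (xF ℓ E u q)) := by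
  unfold xF
  refine (h.hE.sub ?_).sub (((hq.pow 2).const_mul ℓ).div_const 2)
  have h1 : Tendsto (fun n => un n (qn n) - un n q) l (𝓝 0) := by
    have h2 : Tendsto (fun n => C * |qn n - q|) l (𝓝 0) := by
      have := ((hq.sub_const q).abs).const_mul C
      simpa using this
    refine squeeze_zero_norm' ?_ h2
    filter_upwards [h.pn] with n hn
    exact hn.lip _ _
  have := h1.add (h.hu q)
  simpa using this

lemma Conv.tx' (h : Conv l C c En un E u) (ℓ : ℝ) (q : ℝ) :
    Tendsto (fun n => xF ℓ (En n) (un n) q) l (𝓝 (xF ℓ E u q)) := h.tx ℓ tendsto_const_nhds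

lemma Conv.nen (h : Conv l C c En un E u) {ℓ : ℝ} 
    (hne : ∃ q, 0 < xF ℓ E u q) : ∀ᶠ n in l, ∃ q, 0 < xF ℓ (En n) (un n) q := by
  obtain ⟨q, hq⟩ := hne
  filter_upwards [(h.tx' ℓ q).eventually_const_lt hq] with n hn using ⟨q, hn⟩

lemma Conv.tS (h : Conv l C c En un E u) {ℓ : ℝ} (hℓ : 0 < ℓ)
    (hne : ∃ q, 0 < xF ℓ E u q) :
    Tendsto (fun n => qS ℓ (En n) (un n)) l (𝓝 (qS ℓ E u)) := by
  obtain ⟨q, hq⟩ := hne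
  obtain ⟨k1, k2, k3, k4, k5⟩ := h.p.interval hℓ h.neg ⟨q, hq⟩
  have hqq := (k1 q).1 hq
  rw [tendsto_order]
  constructor
  · intro b hb
    obtain ⟨b', hb1, hb2⟩ := exists_between (max_lt hb k4)
    have : 0 < xF ℓ E u b' := (k1 b').2 ⟨(le_max_right _ _).trans_lt hb1, hb2⟩
    filter_upwards [(h.tx' ℓ b').eventually_const_lt this, h.pn, h.negn] with n hn hp hE
    have := (hp.interval hℓ (by linarith [h.neg]) ⟨b', hn⟩).1 b'
    exact ((le_max_left _ _).trans_lt hb1).trans (this.1 hn).2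
  · intro b hb
    have hneg : xF ℓ E u b < 0 := h.p.xneg hℓ hq k3 (Or.inl ⟨hqq.2, hb⟩)
    filter_upwards [(h.tx' ℓ b).eventually_lt_const hneg, (h.tx' ℓ q).eventually_const_lt hq,
      h.pn, h.negn] with n hn hn' hp hE
    obtain ⟨j1, j2, j3, j4, j5⟩ := hp.interval hℓ (by linarith [h.neg]) ⟨q, hn'⟩
    by_contra hcon
    push Not at hcon
    rcases eq_or_lt_of_le hcon with h0 | h0
    · rw [h0] at hn; linarith
    · have := (j1 b).2 ⟨((j1 q).1 hn').1.trans (hqq.2.trans hb), h0⟩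
      linarith

lemma Conv.tI (h : Conv l C c En un E u) {ℓ : ℝ} (hℓ : 0 < ℓ)
    (hne : ∃ q, 0 < xF ℓ E u q) :
    Tendsto (fun n => qI ℓ (En n) (un n)) l (𝓝 (qI ℓ E u)) := by
  obtain ⟨q, hq⟩ := hne
  obtain ⟨k1, k2, k3, k4, k5⟩ := h.p.interval hℓ h.neg ⟨q, hq⟩
  have hqq := (k1 q).1 hq
  rw [tendsto_order]
  constructor
  · intro b hb
    have hneg : xF ℓ E u b < 0 := h.p.xneg hℓ hq k2 (Or.inr ⟨hb, hqq.1⟩)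
    filter_upwards [(h.tx' ℓ b).eventually_lt_const hneg, (h.tx' ℓ q).eventually_const_lt hq,
      h.pn, h.negn] with n hn hn' hp hE
    obtain ⟨j1, j2, j3, j4, j5⟩ := hp.interval hℓ (by linarith [h.neg]) ⟨q, hn'⟩
    by_contra hcon
    push Not at hcon
    rcases eq_or_lt_of_le hcon with h0 | h0
    · rw [← h0] at hn; linarith
    · have := (j1 b).2 ⟨h0, (hb.trans hqq.1).trans ((j1 q).1 hn').2⟩
      linarith
  · intro b hb
    obtain ⟨b', hb1, hb2⟩ := exists_between (lt_min hb k4)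
    have : 0 < xF ℓ E u b' := (k1 b').2 ⟨hb1, hb2.trans_le (min_le_right _ _)⟩
    filter_upwards [(h.tx' ℓ b').eventually_const_lt this, h.pn, h.negn] with n hn hp hE
    have := (hp.interval hℓ (by linarith [h.neg]) ⟨b', hn⟩).1 b'
    exact ((this.1 hn).1).trans (hb2.trans_le (min_le_left _ _))

end conv

end

noncomputable section
open MeasureTheory Real Filter Set Topology
open scoped ENNReal NNReal

def Wt (τ : ℝ) : ℝ := (√(τ * (1 - τ)))⁻¹

lemma Wt_nonneg (τ : ℝ) : 0 ≤ Wt τ := by unfold Wt; positivity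

lemma Wt_zero {τ : ℝ} (h : ¬ (0 < τ ∧ τ < 1)) : Wt τ = 0 := by
  unfold Wt
  rw [Real.sqrt_eq_zero_of_nonpos, inv_zero]
  by_cases h0 : 0 < τ
  · have : 1 ≤ τ := not_lt.1 (fun h1 => h ⟨h0, h1⟩)
    nlinarith
  · nlinarith

lemma Wt_int : Integrable Wt := by
  have hI : IntervalIntegrable (fun x : ℝ => x ^ (-(1/2) : ℝ)) volume 0 1 :=
    intervalIntegral.intervalIntegrable_rpow' (by norm_num)
  have hI2 : IntervalIntegrable (fun x : ℝ => (1 - x) ^ (-(1/2) : ℝ)) volume 0 1 := by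
    have := (hI.comp_sub_left 1).symm
    simpa using this
  have h1 : IntegrableOn (fun x : ℝ => 2 * (x ^ (-(1/2) : ℝ) + (1 - x) ^ (-(1/2) : ℝ)))
      (Ioc 0 1) := by
    rw [← intervalIntegrable_iff_integrableOn_Ioc_of_le zero_le_one]
    exact (hI.add hI2).const_mul 2
  have hm : Measurable Wt := by unfold Wt; fun_prop
  have h2 : IntegrableOn Wt (Ioc 0 1) := by
    refine h1.mono' hm.aestronglyMeasurable ?_
    refine (ae_restrict_iff' measurableSet_Ioc).2 (ae_of_all _ fun τ hτ => ?_)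
    rw [Real.norm_of_nonneg (Wt_nonneg τ)]
    rcases eq_or_lt_of_le hτ.2 with h | h
    · rw [h]; simp [Wt]
    have h0 := hτ.1
    have h1' : 0 < 1 - τ := by linarith
    unfold Wt
    rw [Real.sqrt_mul h0.le, mul_inv]
    have e1 : τ ^ (-(1/2) : ℝ) = (√τ)⁻¹ := by rw [Real.rpow_neg h0.le, Real.sqrt_eq_rpow]
    have e2 : (1 - τ) ^ (-(1/2) : ℝ) = (√(1 - τ))⁻¹ := by
      rw [Real.rpow_neg h1'.le, Real.sqrt_eq_rpow]
    rw [e1, e2]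
    have p1 : 0 < (√τ)⁻¹ := by positivity
    have p2 : 0 < (√(1-τ))⁻¹ := by positivity
    rcases le_total τ (1/2) with hh | hh
    · have : (√(1-τ))⁻¹ ≤ 2 := by
        rw [inv_le_comm₀ (by positivity) (by norm_num)]
        apply Real.le_sqrt_of_sq_le; nlinarith
      nlinarith
    · have : (√τ)⁻¹ ≤ 2 := by
        rw [inv_le_comm₀ (by positivity) (by norm_num)]
        apply Real.le_sqrt_of_sq_le; nlinarith
      nlinarith
  rw [← integrableOn_univ]
  refine h2.of_forall_sdiff_eq_zero MeasurableSet.univ ?_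
  intro x hx
  apply Wt_zero
  rintro ⟨h0, h1⟩
  exact hx.2 ⟨h0, h1.le⟩

section
variable {C c : ℝ} {u : ℝ → ℝ}

lemma isqrt_zero {x : ℝ} (h : x ≤ 0) : (√x)⁻¹ = 0 := by
  rw [Real.sqrt_eq_zero_of_nonpos h, inv_zero]

lemma Pot.Wbd (h : Pot C c u) {ℓ E : ℝ} (hℓ : 0 < ℓ) (hE : E < 0)
    (hne : ∃ q, 0 < xF ℓ E u q) (τ : ℝ) :
    (qS ℓ E u - qI ℓ E u) * (√(xF ℓ E u (qI ℓ E u + (qS ℓ E u - qI ℓ E u) * τ)))⁻¹ ≤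
      (√(ℓ / 2))⁻¹ * Wt τ := by
  obtain ⟨k1, k2, k3, k4, k5⟩ := h.interval hℓ hE hne
  set d := qS ℓ E u - qI ℓ E u with hd
  have hd0 : 0 < d := sub_pos.2 k4
  by_cases hτ : 0 < τ ∧ τ < 1
  · have hx := h.xconc ℓ E (qI ℓ E u) (qS ℓ E u) τ hτ.1.le hτ.2.le
    rw [k2, k3, ← hd] at hx
    simp only [mul_zero, zero_add] at hx
    have h1 : 0 < 1 - τ := by linarith [hτ.2]
    have h2 := hτ.1
    have e : √(ℓ / 2 * (τ * (1 - τ)) * d ^ 2) = √(ℓ/2) * √(τ * (1 - τ)) * d := by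
      rw [Real.sqrt_mul (by positivity), Real.sqrt_mul (by positivity), Real.sqrt_sq hd0.le]
    have h3 := Real.sqrt_le_sqrt hx
    rw [e] at h3
    have h4 : (√(xF ℓ E u (qI ℓ E u + d * τ)))⁻¹ ≤ (√(ℓ/2) * √(τ * (1 - τ)) * d)⁻¹ := by
      apply inv_anti₀ (by positivity) h3
    calc _ ≤ d * (√(ℓ/2) * √(τ * (1 - τ)) * d)⁻¹ := by gcongr
      _ = _ := by unfold Wt; field_simp
  · rw [isqrt_zero, mul_zero]
    · have := Wt_nonneg τ; positivity
    · by_contra hcon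
      push Not at hcon
      have := (k1 _).1 hcon
      apply hτ
      constructor
      · have := this.1; nlinarith
      · have := this.2; nlinarith

lemma Pot.Dsub (ℓ E : ℝ) (hlt : qI ℓ E u < qS ℓ E u) (k : ℝ → ℝ) :
    ∫ q, k q * (√(xF ℓ E u q))⁻¹ = ∫ τ, k (qI ℓ E u + (qS ℓ E u - qI ℓ E u) * τ) *
      ((qS ℓ E u - qI ℓ E u) * (√(xF ℓ E u (qI ℓ E u + (qS ℓ E u - qI ℓ E u) * τ)))⁻¹) := by
  set d := qS ℓ E u - qI ℓ E u with hd
  have hd0 : 0 < d := sub_pos.2 hlt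
  have h1 := Measure.integral_comp_mul_left
    (fun y => k (qI ℓ E u + y) * (√(xF ℓ E u (qI ℓ E u + y)))⁻¹) d
  have h2 := integral_add_left_eq_self (μ := volume)
    (fun y => k y * (√(xF ℓ E u y))⁻¹) (qI ℓ E u)
  rw [← h2]
  simp only [smul_eq_mul] at h1
  rw [abs_of_pos (inv_pos.2 hd0)] at h1
  rw [show (fun τ => k (qI ℓ E u + d * τ) * (d * (√(xF ℓ E u (qI ℓ E u + d * τ)))⁻¹)) =
    fun τ => d * (k (qI ℓ E u + d * τ) * (√(xF ℓ E u (qI ℓ E u + d * τ)))⁻¹) by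
      funext τ; ring, integral_const_mul, h1]
  field_simp

lemma Pot.xmeas (h : Pot C c u) (ℓ E : ℝ) : Measurable (xF ℓ E u) := (h.xcont ℓ E).measurable

lemma Pot.Dint (h : Pot C c u) {ℓ E : ℝ} (hℓ : 0 < ℓ) (hE : E < 0) {k : ℝ → ℝ}
    (hk : Measurable k) {K : ℝ} (hK : ∀ q, 0 < xF ℓ E u q → |k q| ≤ K) :
    Integrable (fun q => k q * (√(xF ℓ E u q))⁻¹) := by
  have hxm := h.xmeas ℓ E
  by_cases hne : ∃ q, 0 < xF ℓ E u q
  swap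
  · push Not at hne
    have : (fun q => k q * (√(xF ℓ E u q))⁻¹) = fun _ => 0 := by
      funext q; rw [isqrt_zero (hne q), mul_zero]
    rw [this]; exact integrable_zero _ _ _
  obtain ⟨k1, k2, k3, k4, k5⟩ := h.interval hℓ hE hne
  set d := qS ℓ E u - qI ℓ E u with hd
  have hd0 : 0 < d := sub_pos.2 k4
  have hK0 : 0 ≤ K := by obtain ⟨q, hq⟩ := hne; exact (abs_nonneg _).trans (hK q hq)
  have h3 : Integrable (fun τ => k (qI ℓ E u + d * τ) * (√(xF ℓ E u (qI ℓ E u + d * τ)))⁻¹) := by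
    refine (Wt_int.const_mul (K * d⁻¹ * (√(ℓ/2))⁻¹)).mono' ?_ (ae_of_all _ fun τ => ?_)
    · apply Measurable.aestronglyMeasurable; fun_prop
    · have := h.Wbd hℓ hE hne τ
      rw [← hd] at this
      rw [Real.norm_eq_abs, abs_mul, abs_of_nonneg (a := (√_)⁻¹) (by positivity)]
      by_cases hx : 0 < xF ℓ E u (qI ℓ E u + d * τ)
      · calc _ ≤ K * (√(xF ℓ E u (qI ℓ E u + d * τ)))⁻¹ := by gcongr; exact hK _ hx
          _ = K * d⁻¹ * (d * (√(xF ℓ E u (qI ℓ E u + d * τ)))⁻¹) := by field_simp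
          _ ≤ K * d⁻¹ * ((√(ℓ/2))⁻¹ * Wt τ) := by gcongr
          _ = _ := by ring
      · rw [isqrt_zero (not_lt.1 hx), mul_zero]
        have := Wt_nonneg τ; positivity
  have h4 := (integrable_comp_mul_left_iff
    (fun y => k (qI ℓ E u + y) * (√(xF ℓ E u (qI ℓ E u + y)))⁻¹) hd0.ne').1 h3
  have := h4.comp_sub_right (qI ℓ E u)
  simpa using this

lemma Pot.Dle (h : Pot C c u) {ℓ E : ℝ} (hℓ : 0 < ℓ) (hE : E < 0) :
    ∫ q, (√(xF ℓ E u q))⁻¹ ≤ (√(ℓ / 2))⁻¹ * ∫ τ, Wt τ := by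
  by_cases hne : ∃ q, 0 < xF ℓ E u q
  swap
  · push Not at hne
    have : (fun q => (√(xF ℓ E u q))⁻¹) = fun _ => 0 := by
      funext q; rw [isqrt_zero (hne q)]
    rw [this, integral_zero]
    have : 0 ≤ ∫ τ, Wt τ := integral_nonneg (fun τ => Wt_nonneg τ)
    positivity
  have h1 := Pot.Dsub (u := u) ℓ E (h.interval hℓ hE hne).2.2.2.1 (fun _ => 1)
  simp only [one_mul] at h1
  rw [h1, ← integral_const_mul]
  refine integral_mono_of_nonneg (ae_of_all _ fun τ => ?_) (Wt_int.const_mul _)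
    (ae_of_all _ fun τ => h.Wbd hℓ hE hne τ)
  have := sub_pos.2 (h.interval hℓ hE hne).2.2.2.1
  simp only [Pi.zero_apply]; positivity

structure Wgt (K : ℝ) (k : ℝ → ℝ) : Prop where
  hK : 0 ≤ K
  m : Measurable k
  ct : ContinuousOn k (Ioi 0)
  bd : ∀ q, 0 < q → |k q| ≤ K * (q ^ 2)⁻¹

lemma Wgt.bdx {K : ℝ} {k : ℝ → ℝ} (hk : Wgt K k) (h : Pot C c u) {ℓ E δ : ℝ} (hℓ : 0 < ℓ)
    (hδ : δ < 0) (hE : E ≤ δ) (q : ℝ) (hx : 0 < xF ℓ E u q) : |k q| ≤ K * ((-δ / C) ^ 2)⁻¹ := by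
  have hC := h.hC
  obtain ⟨h1, h2, h3⟩ := h.xpos hℓ (lt_of_le_of_lt hE hδ) hx
  have h4 : -δ / C ≤ q := le_trans (by gcongr) h2.le
  have h5 : 0 < -δ / C := div_pos (by linarith) hC
  refine (hk.bd q h1).trans ?_
  have := hk.hK
  gcongr

lemma Wgt.Dint {K : ℝ} {k : ℝ → ℝ} (hk : Wgt K k) (h : Pot C c u) {ℓ E : ℝ} (hℓ : 0 < ℓ)
    (hE : E < 0) : Integrable (fun q => k q * (√(xF ℓ E u q))⁻¹) :=
  h.Dint hℓ hE hk.m (hk.bdx h hℓ hE le_rfl)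

variable {ι : Type*} {l : Filter ι} {En : ι → ℝ} {un : ι → ℝ → ℝ} {E : ℝ}

lemma Conv.tD [l.IsCountablyGenerated] (h : Conv l C c En un E u) {ℓ : ℝ} (hℓ : 0 < ℓ)
    (hne : ∃ q, 0 < xF ℓ E u q) {K : ℝ} {k : ℝ → ℝ} (hk : Wgt K k) :
    Tendsto (fun n => ∫ q, k q * (√(xF ℓ (En n) (un n) q))⁻¹) l
      (𝓝 (∫ q, k q * (√(xF ℓ E u q))⁻¹)) := by
  obtain ⟨k1, k2, k3, k4, k5⟩ := h.p.interval hℓ h.neg hne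
  have hC := h.p.hC
  have hE2 : E / 2 < 0 := by linarith [h.neg]
  rw [Pot.Dsub (u := u) ℓ E k4]
  have hev : ∀ᶠ n in l, Pot C c (un n) ∧ En n < E / 2 ∧ ∃ q, 0 < xF ℓ (En n) (un n) q := by
    filter_upwards [h.pn, h.negn, h.nen hne] with n h1 h2 h3 using ⟨h1, h2, h3⟩
  have hcong : ∀ᶠ n in l, (∫ τ, k (qI ℓ (En n) (un n) + (qS ℓ (En n) (un n) - qI ℓ (En n) (un n)) * τ) *
      ((qS ℓ (En n) (un n) - qI ℓ (En n) (un n)) * (√(xF ℓ (En n) (un n)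
        (qI ℓ (En n) (un n) + (qS ℓ (En n) (un n) - qI ℓ (En n) (un n)) * τ)))⁻¹)) =
      ∫ q, k q * (√(xF ℓ (En n) (un n) q))⁻¹ := by
    filter_upwards [hev] with n hn
    rw [Pot.Dsub (u := un n) ℓ (En n) (hn.1.interval hℓ (hn.2.1.trans hE2) hn.2.2).2.2.2.1]
  refine Tendsto.congr' hcong ?_
  refine tendsto_integral_filter_of_dominated_convergence
    (fun τ => (K * ((-(E / 2) / C) ^ 2)⁻¹) * ((√(ℓ / 2))⁻¹ * Wt τ)) ?_ ?_
    ((Wt_int.const_mul _).const_mul _) ?_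
  · filter_upwards [hev] with n hn
    have := hn.1.xmeas ℓ (En n)
    have := hk.m
    apply Measurable.aestronglyMeasurable; fun_prop
  · filter_upwards [hev] with n hn
    refine ae_of_all _ fun τ => ?_
    have hb := hn.1.Wbd hℓ (hn.2.1.trans hE2) hn.2.2 τ
    have hd := sub_pos.2 (hn.1.interval hℓ (hn.2.1.trans hE2) hn.2.2).2.2.2.1
    rw [Real.norm_eq_abs, abs_mul, abs_of_nonneg (a := _ * (√_)⁻¹) (by positivity)]
    have hK := hk.hK
    by_cases hx : 0 < xF ℓ (En n) (un n) (qI ℓ (En n) (un n) +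
        (qS ℓ (En n) (un n) - qI ℓ (En n) (un n)) * τ)
    · have := hk.bdx hn.1 hℓ hE2 hn.2.1.le _ hx
      gcongr
    · rw [isqrt_zero (not_lt.1 hx), mul_zero, mul_zero]
      have := Wt_nonneg τ
      positivity
  · refine ae_of_all _ fun τ => ?_
    have tS := h.tS hℓ hne
    have tI := h.tI hℓ hne
    have tq := tI.add ((tS.sub tI).mul_const τ)
    by_cases hτ : 0 < τ ∧ τ < 1
    · have hd : 0 < qS ℓ E u - qI ℓ E u := sub_pos.2 k4
      have hq0 : 0 < qI ℓ E u + (qS ℓ E u - qI ℓ E u) * τ := by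
        have := hτ.1; positivity
      have hxp : 0 < xF ℓ E u (qI ℓ E u + (qS ℓ E u - qI ℓ E u) * τ) := by
        refine (k1 _).2 ⟨?_, ?_⟩
        · have := mul_pos hd hτ.1; linarith
        · nlinarith [hτ.2]
      refine Tendsto.mul ?_ ((tS.sub tI).mul ?_)
      · exact ((hk.ct.continuousAt (Ioi_mem_nhds hq0)).tendsto).comp tq
      · refine Tendsto.inv₀ ?_ (by positivity)
        exact (Real.continuous_sqrt.tendsto _).comp (h.tx ℓ tq)
    · have hz : ∀ (E' : ℝ) (u' : ℝ → ℝ), Pot C c u' → E' < 0 → (∃ q, 0 < xF ℓ E' u' q) →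
          (√(xF ℓ E' u' (qI ℓ E' u' + (qS ℓ E' u' - qI ℓ E' u') * τ)))⁻¹ = 0 := by
        intro E' u' hp hE' hne'
        obtain ⟨j1, j2, j3, j4, j5⟩ := hp.interval hℓ hE' hne'
        apply isqrt_zero
        by_contra hcon
        have := (j1 _).1 (not_le.1 hcon)
        have hd := sub_pos.2 j4
        apply hτ
        constructor
        · have := this.1; nlinarith
        · have := this.2; nlinarith
      rw [hz E u h.p h.neg hne, mul_zero, mul_zero]
      refine tendsto_const_nhds.congr' ?_
      filter_upwards [hev] with n hn
      rw [hz _ _ hn.1 (hn.2.1.trans hE2) hn.2.2, mul_zero, mul_zero]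
end

end

noncomputable section
open MeasureTheory Real Filter Set Topology
open scoped ENNReal NNReal

def Af (ℓ E : ℝ) (u k : ℝ → ℝ) : ℝ := ∫ q, k q * √(xF ℓ E u q)

def kap (q : ℝ) : ℝ := (q ^ 2)⁻¹

def Rq (x y : ℝ) : ℝ := (√x + √y) / (|x| + |y| + 2 * (√x * √y))

lemma Rq_nonneg (x y : ℝ) : 0 ≤ Rq x y := by unfold Rq; positivity

lemma Rq_comm (x y : ℝ) : Rq x y = Rq y x := by unfold Rq; congr 1 <;> ring

lemma Rq_mul (x y : ℝ) : √y - √x = (y - x) * Rq x y := by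
  unfold Rq
  rcases le_or_gt x 0 with hx | hx <;> rcases le_or_gt y 0 with hy | hy
  · simp [Real.sqrt_eq_zero_of_nonpos hx, Real.sqrt_eq_zero_of_nonpos hy]
  · rw [Real.sqrt_eq_zero_of_nonpos hx, abs_of_nonpos hx, abs_of_pos hy]
    have hne : y - x ≠ 0 := by linarith
    rw [show -x + y + 2 * (0 * √y) = y - x by ring]
    field_simp; ring
  · rw [Real.sqrt_eq_zero_of_nonpos hy, abs_of_nonpos hy, abs_of_pos hx]
    have hne : x - y ≠ 0 := by linarith
    rw [show x + -y + 2 * (√x * 0) = x - y by ring, show y - x = -(x - y) by ring]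
    field_simp; ring
  · rw [abs_of_pos hx, abs_of_pos hy]
    have e : x + y + 2 * (√x * √y) = (√x + √y) ^ 2 := by
      rw [add_sq, Real.sq_sqrt hx.le, Real.sq_sqrt hy.le]; ring
    rw [e]
    have : 0 < √x + √y := by positivity
    have e2 : y - x = (√y - √x) * (√x + √y) := by
      nlinarith [Real.sq_sqrt hx.le, Real.sq_sqrt hy.le]
    rw [e2]; field_simp

lemma Rq_le {x : ℝ} (y : ℝ) (hx : 0 < x) : Rq x y ≤ (√x)⁻¹ := by
  unfold Rq
  rw [abs_of_pos hx, ← one_div, div_le_div_iff₀ (by positivity) (by positivity)]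
  have h1 := Real.sq_sqrt hx.le
  have h2 := abs_nonneg y
  have h3 : 0 ≤ √x * √y := by positivity
  nlinarith

lemma Rq_le' (x y : ℝ) : Rq x y ≤ (√x)⁻¹ + (√y)⁻¹ := by
  have h1 : 0 ≤ (√x)⁻¹ := by positivity
  have h2 : 0 ≤ (√y)⁻¹ := by positivity
  rcases le_or_gt x 0 with hx | hx
  · rcases le_or_gt y 0 with hy | hy
    · unfold Rq
      rw [Real.sqrt_eq_zero_of_nonpos hx, Real.sqrt_eq_zero_of_nonpos hy]; simp
    · rw [Rq_comm]; linarith [Rq_le x hy]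
  · linarith [Rq_le y hx]

lemma Rq_tendsto {ι : Type*} {l : Filter ι} {x : ℝ} {xn : ι → ℝ} (hx : 0 < x)
    (h : Tendsto xn l (𝓝 x)) : Tendsto (fun n => Rq x (xn n)) l (𝓝 ((√x)⁻¹ / 2)) := by
  have h1 : Tendsto (fun n => √(xn n)) l (𝓝 (√x)) := (Real.continuous_sqrt.tendsto _).comp h
  have h2 : 0 < √x := by positivity
  have := (h1.const_add (√x)).div ((h.abs.const_add |x|).add ((h1.const_mul (√x)).const_mul 2))
    (by positivity)
  have e : (√x + √x) / (|x| + |x| + 2 * (√x * √x)) = (√x)⁻¹ / 2 := by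
    rw [abs_of_pos hx, Real.mul_self_sqrt hx.le]
    nth_rewrite 3 4 5 [← Real.mul_self_sqrt hx.le]
    field_simp; norm_num
  rw [e] at this
  exact this

lemma Rq_meas : Measurable (fun p : ℝ × ℝ => Rq p.1 p.2) := by unfold Rq; fun_prop

section
variable {C c : ℝ} {u : ℝ → ℝ}

lemma Wgt.Abd {K : ℝ} {k : ℝ → ℝ} (hk : Wgt K k) (h : Pot C c u) {ℓ E δ : ℝ} (hℓ : 0 < ℓ)
    (hδ : δ < 0) (hE : E ≤ δ) (q : ℝ) : ‖k q * √(xF ℓ E u q)‖ ≤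
      indicator (Icc 0 (2 * C / ℓ)) (fun _ => K * ((-δ / C) ^ 2)⁻¹ * √C) q := by
  have hC := h.hC
  have hK := hk.hK
  by_cases hx : 0 < xF ℓ E u q
  · obtain ⟨h1, h2, h3⟩ := h.xpos hℓ (lt_of_le_of_lt hE hδ) hx
    rw [indicator_of_mem (show q ∈ Icc 0 (2 * C / ℓ) from ⟨h1.le, h3.le⟩), Real.norm_eq_abs, abs_mul,
      abs_of_nonneg (a := √_) (by positivity)]
    have := hk.bdx h hℓ hδ hE q hx
    have := h.xle (q := q) hℓ (lt_of_le_of_lt hE hδ)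
    gcongr
  · rw [Real.sqrt_eq_zero_of_nonpos (not_lt.1 hx), mul_zero, norm_zero]
    apply indicator_nonneg
    intro _ _; positivity

lemma ind_int (b K : ℝ) : Integrable (indicator (Icc 0 b) (fun _ => K)) := by
  rw [integrable_indicator_iff measurableSet_Icc]
  exact integrableOn_const (by simp)

lemma Wgt.Aint {K : ℝ} {k : ℝ → ℝ} (hk : Wgt K k) (h : Pot C c u) {ℓ E : ℝ} (hℓ : 0 < ℓ)
    (hE : E < 0) : Integrable (fun q => k q * √(xF ℓ E u q)) := by
  refine (ind_int _ _).mono' ?_ (ae_of_all _ (hk.Abd h hℓ hE le_rfl))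
  have := h.xmeas ℓ E
  have := hk.m
  apply Measurable.aestronglyMeasurable; fun_prop

variable {ι : Type*} {l : Filter ι} {En : ι → ℝ} {un : ι → ℝ → ℝ} {E : ℝ}

lemma Conv.tA [l.IsCountablyGenerated] (h : Conv l C c En un E u) {ℓ : ℝ} (hℓ : 0 < ℓ)
    {K : ℝ} {k : ℝ → ℝ} (hk : Wgt K k) :
    Tendsto (fun n => Af ℓ (En n) (un n) k) l (𝓝 (Af ℓ E u k)) := by
  have hE2 : E / 2 < 0 := by linarith [h.neg]
  refine tendsto_integral_filter_of_dominated_convergence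
    (indicator (Icc 0 (2 * C / ℓ)) (fun _ => K * ((-(E/2) / C) ^ 2)⁻¹ * √C)) ?_ ?_ (ind_int _ _) ?_
  · filter_upwards [h.pn] with n hn
    have := hn.xmeas ℓ (En n)
    have := hk.m
    apply Measurable.aestronglyMeasurable; fun_prop
  · filter_upwards [h.pn, h.negn] with n hn hE
    exact ae_of_all _ (hk.Abd hn hℓ hE2 hE.le)
  · refine ae_of_all _ fun q => ?_
    exact ((Real.continuous_sqrt.tendsto _).comp (h.tx' ℓ q)).const_mul _

lemma Wgt.abs {K : ℝ} {k : ℝ → ℝ} (hk : Wgt K k) : Wgt K (fun q => |k q|) :=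
  ⟨hk.hK, hk.m.abs, hk.ct.abs, fun q hq => by rw [abs_abs]; exact hk.bd q hq⟩

lemma Wgt.Rint {K : ℝ} {k : ℝ → ℝ} (hk : Wgt K k) (h : Pot C c u) {u' : ℝ → ℝ} (h' : Pot C c u')
    {ℓ E E' : ℝ} (hℓ : 0 < ℓ) (hE : E < 0) (hE' : E' < 0) :
    Integrable (fun q => k q * Rq (xF ℓ E u q) (xF ℓ E' u' q)) := by
  refine ((hk.abs.Dint h hℓ hE).add (hk.abs.Dint h' hℓ hE')).mono' ?_ (ae_of_all _ fun q => ?_)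
  · have := h.xmeas ℓ E
    have := h'.xmeas ℓ E'
    have := hk.m
    have h3 : Measurable (fun q => Rq (xF ℓ E u q) (xF ℓ E' u' q)) :=
      Rq_meas.comp (by fun_prop : Measurable fun q => (xF ℓ E u q, xF ℓ E' u' q))
    exact (hk.m.mul h3).aestronglyMeasurable
  · rw [Real.norm_eq_abs, abs_mul, abs_of_nonneg (Rq_nonneg _ _)]
    have := mul_le_mul_of_nonneg_left (Rq_le' (xF ℓ E u q) (xF ℓ E' u' q)) (abs_nonneg (k q))
    simp only [Pi.add_apply]
    linarith

lemma Conv.tR [l.IsCountablyGenerated] (h : Conv l C c En un E u) {ℓ : ℝ} (hℓ : 0 < ℓ)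
    (hne : ∃ q, 0 < xF ℓ E u q) {K : ℝ} {k : ℝ → ℝ} (hk : Wgt K k) :
    Tendsto (fun n => ∫ q, k q * Rq (xF ℓ E u q) (xF ℓ (En n) (un n) q)) l
      (𝓝 (∫ q, k q * ((√(xF ℓ E u q))⁻¹ / 2))) := by
  have hE2 : E / 2 < 0 := by linarith [h.neg]
  have hxm := h.p.xmeas ℓ E
  have hS : MeasurableSet {q | 0 < xF ℓ E u q} := measurableSet_lt measurable_const hxm
  have hkm := hk.m
  have hmeas : ∀ᶠ n in l, Measurable (fun q => Rq (xF ℓ E u q) (xF ℓ (En n) (un n) q)) := by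
    filter_upwards [h.pn] with n hn
    have := hn.xmeas ℓ (En n)
    exact Rq_meas.comp (by fun_prop : Measurable fun q => (xF ℓ E u q, xF ℓ (En n) (un n) q))
  -- first part
  have h1 : Tendsto (fun n => ∫ q, indicator {q | 0 < xF ℓ E u q}
      (fun q => k q * Rq (xF ℓ E u q) (xF ℓ (En n) (un n) q)) q) l
      (𝓝 (∫ q, k q * ((√(xF ℓ E u q))⁻¹ / 2))) := by
    refine tendsto_integral_filter_of_dominated_convergence
      (fun q => |k q| * (√(xF ℓ E u q))⁻¹) ?_ ?_ (hk.abs.Dint h.p hℓ h.neg) ?_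
    · filter_upwards [hmeas] with n hn
      exact ((hkm.mul hn).indicator hS).aestronglyMeasurable
    · refine Eventually.of_forall fun n => ae_of_all _ fun q => ?_
      by_cases hx : 0 < xF ℓ E u q
      · rw [indicator_of_mem (show q ∈ {q | 0 < xF ℓ E u q} from hx), Real.norm_eq_abs, abs_mul,
          abs_of_nonneg (Rq_nonneg _ _)]
        have := Rq_le (xF ℓ (En n) (un n) q) hx
        gcongr
      · rw [indicator_of_notMem (show q ∉ {q | 0 < xF ℓ E u q} from hx), norm_zero]
        positivity
    · refine ae_of_all _ fun q => ?_
      by_cases hx : 0 < xF ℓ E u q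
      · simp only [indicator_of_mem (show q ∈ {q | 0 < xF ℓ E u q} from hx)]
        exact (Rq_tendsto hx (h.tx' ℓ q)).const_mul _
      · simp only [indicator_of_notMem (show q ∉ {q | 0 < xF ℓ E u q} from hx)]
        rw [isqrt_zero (not_lt.1 hx)]; simp; exact tendsto_const_nhds
  -- second part
  have hmin : Tendsto (fun n => ∫ q, |k q| * min (√(xF ℓ (En n) (un n) q))⁻¹ (√(xF ℓ E u q))⁻¹) l
      (𝓝 (∫ q, |k q| * (√(xF ℓ E u q))⁻¹)) := by
    refine tendsto_integral_filter_of_dominated_convergence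
      (fun q => |k q| * (√(xF ℓ E u q))⁻¹) ?_ ?_ (hk.abs.Dint h.p hℓ h.neg) ?_
    · filter_upwards [h.pn] with n hn
      have := hn.xmeas ℓ (En n)
      apply Measurable.aestronglyMeasurable; fun_prop
    · refine Eventually.of_forall fun n => ae_of_all _ fun q => ?_
      rw [Real.norm_eq_abs, abs_mul, abs_abs, abs_of_nonneg (a := min _ _) (by positivity)]
      gcongr; exact min_le_right _ _
    · refine ae_of_all _ fun q => ?_
      by_cases hx : 0 < xF ℓ E u q
      · have t := ((Real.continuous_sqrt.tendsto _).comp (h.tx' ℓ q)).inv₀ (by positivity)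
        have := (t.min (tendsto_const_nhds (x := (√(xF ℓ E u q))⁻¹))).const_mul |k q|
        rw [min_self] at this
        exact this
      · rw [isqrt_zero (not_lt.1 hx)]
        have : ∀ n, min (√(xF ℓ (En n) (un n) q))⁻¹ 0 = 0 := fun n => min_eq_right (by positivity)
        simp [this]; exact tendsto_const_nhds
  have h2 : Tendsto (fun n => ∫ q, indicator {q | 0 < xF ℓ E u q}ᶜ
      (fun q => k q * Rq (xF ℓ E u q) (xF ℓ (En n) (un n) q)) q) l (𝓝 0) := by
    have h3 := (h.tD hℓ hne hk.abs).sub hmin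
    rw [sub_self] at h3
    refine squeeze_zero_norm' ?_ h3
    filter_upwards [h.pn, h.negn] with n hn hE
    have i1 := hk.abs.Dint hn hℓ (hE.trans hE2)
    have i2 : Integrable (fun q => |k q| * min (√(xF ℓ (En n) (un n) q))⁻¹ (√(xF ℓ E u q))⁻¹) := by
      refine (hk.abs.Dint h.p hℓ h.neg).mono' ?_ (ae_of_all _ fun q => ?_)
      · have := hn.xmeas ℓ (En n)
        apply Measurable.aestronglyMeasurable; fun_prop
      · rw [Real.norm_eq_abs, abs_mul, abs_abs, abs_of_nonneg (a := min _ _) (by positivity)]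
        gcongr; exact min_le_right _ _
    rw [← integral_sub i1 i2]
    refine norm_integral_le_of_norm_le (i1.sub i2) (ae_of_all _ fun q => ?_)
    by_cases hx : 0 < xF ℓ E u q
    · rw [indicator_of_notMem (by simpa using hx), norm_zero, ← mul_sub]
      exact mul_nonneg (abs_nonneg _) (sub_nonneg.2 (min_le_left _ _))
    · rw [indicator_of_mem (by simpa using hx), Real.norm_eq_abs, abs_mul,
          abs_of_nonneg (Rq_nonneg _ _), isqrt_zero (not_lt.1 hx)]
      have h5 := Rq_le' (xF ℓ E u q) (xF ℓ (En n) (un n) q)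
      rw [isqrt_zero (not_lt.1 hx), zero_add] at h5
      rw [min_eq_right (by positivity), mul_zero, sub_zero]
      gcongr
  have h4 := h1.add h2
  rw [add_zero] at h4
  refine h4.congr' ?_
  filter_upwards [h.pn, h.negn] with n hn hE
  have i := hk.Rint h.p hn hℓ h.neg (hE.trans hE2)
  rw [← integral_add (i.indicator hS) (i.indicator hS.compl)]
  congr 1; funext q
  have := indicator_self_add_compl {q | 0 < xF ℓ E u q}
    (fun q => k q * Rq (xF ℓ E u q) (xF ℓ (En n) (un n) q))
  exact congrFun this q

lemma kap_wgt : Wgt 1 kap := by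
  refine ⟨zero_le_one, by unfold kap; fun_prop, ?_, ?_⟩
  · unfold kap
    refine ContinuousOn.inv₀ (by fun_prop) ?_
    intro q hq; have : 0 < q := hq; positivity
  · intro q hq; unfold kap; rw [one_mul, abs_of_nonneg (by positivity)]

lemma kap_nonneg (q : ℝ) : 0 ≤ kap q := by unfold kap; positivity

lemma Pot.Amono (h : Pot C c u) {ℓ E E' : ℝ} (hℓ : 0 < ℓ) (hEE : E ≤ E') (hE' : E' < 0) :
    Af ℓ E u kap ≤ Af ℓ E' u kap := by
  refine integral_mono (kap_wgt.Aint h hℓ (lt_of_le_of_lt hEE hE')) (kap_wgt.Aint h hℓ hE') ?_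
  intro q
  refine mul_le_mul_of_nonneg_left (Real.sqrt_le_sqrt ?_) (kap_nonneg q)
  unfold xF; linarith

lemma Pot.Asmono (h : Pot C c u) {ℓ E E' : ℝ} (hℓ : 0 < ℓ) (hEE : E < E') (hE' : E' < 0)
    (hne : ∃ q, 0 < xF ℓ E' u q) : Af ℓ E u kap < Af ℓ E' u kap := by
  have i1 := kap_wgt.Aint h hℓ (hEE.trans hE')
  have i2 := kap_wgt.Aint h hℓ hE'
  rw [← sub_pos]
  unfold Af
  rw [← integral_sub i2 i1]
  have hnn : ∀ q, 0 ≤ kap q * √(xF ℓ E' u q) - kap q * √(xF ℓ E u q) := by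
    intro q
    rw [← mul_sub]
    refine mul_nonneg (kap_nonneg q) (sub_nonneg.2 (Real.sqrt_le_sqrt ?_))
    unfold xF; linarith
  refine (integral_pos_iff_support_of_nonneg hnn (i2.sub i1)).2 ?_
  have hsub : {q | 0 < xF ℓ E' u q} ⊆ Function.support
      (fun q => kap q * √(xF ℓ E' u q) - kap q * √(xF ℓ E u q)) := by
    intro q hq
    have hq0 := (h.xpos hℓ hE' hq).1
    have : √(xF ℓ E u q) < √(xF ℓ E' u q) :=
      (Real.sqrt_lt_sqrt_iff_of_pos hq).2 (by unfold xF; linarith)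
    have hk : 0 < kap q := by unfold kap; positivity
    rw [Function.mem_support, ← mul_sub]
    exact (mul_pos hk (sub_pos.2 this)).ne'
  refine lt_of_lt_of_le ?_ (measure_mono hsub)
  exact (isOpen_lt continuous_const (h.xcont ℓ E')).measure_pos volume hne

lemma Pot.Ane (h : Pot C c u) {ℓ E : ℝ} (hA : 0 < Af ℓ E u kap) : ∃ q, 0 < xF ℓ E u q := by
  by_contra hcon
  push Not at hcon
  have : Af ℓ E u kap = 0 := by
    unfold Af
    simp [Real.sqrt_eq_zero_of_nonpos (hcon _)]
  linarith
end

end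

noncomputable section
open MeasureTheory Real Filter Set Topology
open scoped ENNReal NNReal

section
variable {C c : ℝ} {u : ℝ → ℝ}

lemma Alarge {C c : ℝ} (hc : 0 < c) {T L : ℝ} (hT : 0 ≤ T) (hL : 0 < L) :
    ∃ δ, 0 < δ ∧ ∀ u, Pot C c u → ∀ ℓ, 0 < ℓ → ℓ ≤ L → T < Af ℓ (-δ) u kap := by
  set x : ℝ := min (1/2) (min (c / (2 * L)) (c / (64 * (T + 1) ^ 2))) with hxdef
  have hx0 : 0 < x := by rw [hxdef]; positivity
  have hx1 : x ≤ 1 / 2 := min_le_left _ _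
  have hx2 : x ≤ c / (2 * L) := (min_le_right _ _).trans (min_le_left _ _)
  have hx3 : x ≤ c / (64 * (T + 1) ^ 2) := (min_le_right _ _).trans (min_le_right _ _)
  refine ⟨c * x / 4, by positivity, fun u hu ℓ hℓ hℓL => ?_⟩
  have hE : -(c * x / 4) < 0 := by have : 0 < c * x := by positivity
                                   linarith
  have hlow : ∀ q ∈ Icc x (2 * x), c * x / 4 ≤ xF ℓ (-(c * x / 4)) u q := by
    intro q hq
    have hq0 : 0 < q := hx0.trans_le hq.1
    have h1 := hu.small q hq0.le (by linarith [hq.2])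
    have h2 : L * x ≤ c / 2 := by
      rw [le_div_iff₀ (by positivity)] at hx2; linarith
    have h3 : ℓ * q / 2 ≤ c / 2 := by
      have : ℓ * q ≤ L * (2 * x) := by gcongr; exact hq.2
      linarith
    have h4 : ℓ * q ^ 2 / 2 ≤ c / 2 * q := by nlinarith
    have h5 : c * x ≤ c * q := by gcongr; exact hq.1
    unfold xF; linarith
  have hint := kap_wgt.Aint hu hℓ hE
  have key : ∫ q in Icc x (2 * x), ((2 * x) ^ 2)⁻¹ * √(c * x / 4) ≤ Af ℓ (-(c * x / 4)) u kap := by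
    unfold Af
    refine le_trans ?_ (setIntegral_le_integral (s := Icc x (2 * x)) hint (ae_of_all _ fun q =>
      mul_nonneg (kap_nonneg q) (Real.sqrt_nonneg _)))
    refine setIntegral_mono_on (integrableOn_const (by simp)) hint.integrableOn measurableSet_Icc ?_
    intro q hq
    have hq0 : 0 < q := hx0.trans_le hq.1
    refine mul_le_mul ?_ (Real.sqrt_le_sqrt (hlow q hq)) (Real.sqrt_nonneg _) (kap_nonneg q)
    unfold kap
    gcongr; exact hq.2
  refine lt_of_lt_of_le ?_ key
  rw [setIntegral_const]
  have hs : √(c * x / 4) = x * √(c / (4 * x)) := by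
    rw [show c * x / 4 = x ^ 2 * (c / (4 * x)) by field_simp, Real.sqrt_mul (by positivity),
      Real.sqrt_sq hx0.le]
  have h4 : 4 * (T + 1) ≤ √(c / (4 * x)) := by
    apply Real.le_sqrt_of_sq_le
    rw [le_div_iff₀ (by positivity)] at hx3 ⊢
    nlinarith
  rw [hs]
  simp only [Measure.real, Real.volume_Icc, smul_eq_mul]
  rw [ENNReal.toReal_ofReal (by linarith)]
  have : (2 * x - x) * (((2 * x) ^ 2)⁻¹ * (x * √(c / (4 * x)))) = √(c / (4 * x)) / 4 := by
    field_simp; ring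
  rw [this]; linarith

/-- `E` is the energy level with mass `m`. -/
structure Lev (ℓ : ℝ) (u : ℝ → ℝ) (m E : ℝ) : Prop where
  neg : E < 0
  eq : Af ℓ E u kap = m

lemma Pot.Abot (h : Pot C c u) {ℓ : ℝ} (hℓ : 0 < ℓ) {E : ℝ} (hE : E ≤ -C) : Af ℓ E u kap = 0 := by
  unfold Af
  have : ∀ q, √(xF ℓ E u q) = 0 := fun q => by
    apply Real.sqrt_eq_zero_of_nonpos
    have := h.lb q
    unfold xF
    have : 0 ≤ ℓ * q ^ 2 / 2 := by positivity
    linarith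
  simp [this]

lemma Pot.Acont (h : Pot C c u) {ℓ : ℝ} (hℓ : 0 < ℓ) : ContinuousOn (fun E => Af ℓ E u kap) (Iio 0) := by
  intro E hE
  refine Tendsto.mono_left ?_ nhdsWithin_le_nhds
  have : Conv (𝓝 E) C c id (fun _ => u) E u :=
    ⟨Eventually.of_forall fun _ => h, h, tendsto_id, fun q => tendsto_const_nhds, hE⟩
  exact this.tA hℓ kap_wgt

lemma Pot.lev_exists (h : Pot C c u) {ℓ m E1 : ℝ} (hℓ : 0 < ℓ) (hm : 0 < m) (hE1 : E1 < 0)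
    (h1 : m < Af ℓ E1 u kap) : ∃ E, Lev ℓ u m E ∧ E < E1 := by
  have hlt : -C < E1 := by
    by_contra hcon
    rw [h.Abot hℓ (not_lt.1 hcon)] at h1; linarith
  have hc := (h.Acont hℓ).mono (show Icc (-C) E1 ⊆ Iio 0 from fun e he => lt_of_le_of_lt he.2 hE1)
  have := intermediate_value_Icc hlt.le hc
  obtain ⟨E, hE, hEq⟩ := this (show m ∈ Icc _ _ from ⟨by rw [h.Abot hℓ le_rfl]; exact hm.le, h1.le⟩)
  refine ⟨E, ⟨lt_of_le_of_lt hE.2 hE1, hEq⟩, lt_of_le_of_ne hE.2 ?_⟩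
  rintro rfl
  simp only at hEq; linarith

lemma Lev.ne {ℓ m E : ℝ} (hl : Lev ℓ u m E) (h : Pot C c u) (hm : 0 < m) : ∃ q, 0 < xF ℓ E u q :=
  h.Ane (by rw [hl.eq]; exact hm)

lemma Lev.lt_iff {ℓ m E : ℝ} (hl : Lev ℓ u m E) (h : Pot C c u) (hℓ : 0 < ℓ) (hm : 0 < m) (e : ℝ) :
    (e < 0 ∧ Af ℓ e u kap < m) ↔ e < E := by
  constructor
  · rintro ⟨he, h1⟩
    by_contra hcon
    have := h.Amono hℓ (not_lt.1 hcon) he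
    rw [hl.eq] at this; linarith
  · intro he
    refine ⟨he.trans hl.neg, ?_⟩
    have := h.Asmono hℓ he hl.neg (hl.ne h hm)
    rwa [hl.eq] at this

lemma Lev.gt {ℓ m E : ℝ} (hl : Lev ℓ u m E) (h : Pot C c u) (hℓ : 0 < ℓ) (hm : 0 < m) {e : ℝ}
    (he : E < e) (he0 : e < 0) : m < Af ℓ e u kap := by
  obtain ⟨q, hq⟩ := hl.ne h hm
  have := h.Asmono hℓ he he0 ⟨q, by unfold xF at *; linarith⟩
  rwa [hl.eq] at this

lemma Lev.tendsto {ι : Type*} {l : Filter ι} [l.IsCountablyGenerated] {En : ι → ℝ} {un : ι → ℝ → ℝ}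
    {E ℓ m : ℝ} (hℓ : 0 < ℓ) (hm : 0 < m) (hpn : ∀ᶠ n in l, Pot C c (un n)) (h : Pot C c u)
    (hu : ∀ q, Tendsto (fun n => un n q) l (𝓝 (u q)))
    (hln : ∀ᶠ n in l, Lev ℓ (un n) m (En n)) (hl : Lev ℓ u m E) :
    Tendsto En l (𝓝 E) := by
  rw [tendsto_order]
  constructor
  · intro e he
    have hcv : Conv l C c (fun _ => e) un e u := ⟨hpn, h, tendsto_const_nhds, hu, he.trans hl.neg⟩
    have := (hcv.tA hℓ kap_wgt).eventually_lt_const ((hl.lt_iff h hℓ hm e).2 he).2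
    filter_upwards [this, hpn, hln] with n h1 h2 h3
    exact (h3.lt_iff h2 hℓ hm e).1 ⟨he.trans hl.neg, h1⟩
  · intro e he
    rcases le_or_gt 0 e with he0 | he0
    · filter_upwards [hln] with n h3 using h3.neg.trans_le he0
    have hcv : Conv l C c (fun _ => e) un e u := ⟨hpn, h, tendsto_const_nhds, hu, he0⟩
    have := (hcv.tA hℓ kap_wgt).eventually_const_lt (hl.gt h hℓ hm he he0)
    filter_upwards [this, hpn, hln] with n h1 h2 h3
    by_contra hcon
    have := h2.Amono hℓ (not_lt.1 hcon) h3.neg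
    rw [h3.eq] at this; linarith

end

def ul (u0 u1 : ℝ → ℝ) (μ q : ℝ) : ℝ := (1 - μ) * u0 q + μ * u1 q

section
variable {C c : ℝ} {u0 u1 : ℝ → ℝ}

lemma Pot.seg (h0 : Pot C c u0) (h1 : Pot C c u1) {μ : ℝ} (hμ : μ ∈ Icc (0:ℝ) 1) :
    Pot C c (ul u0 u1 μ) := by
  have a0 : 0 ≤ 1 - μ := by linarith [hμ.2]
  have a1 := hμ.1
  refine ⟨h0.hC, h0.hc, ?_, ?_, ?_, ?_, ?_, ?_, ?_⟩
  · exact (h0.cvx.smul a0).add (h1.cvx.smul a1)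
  · intro a b
    have e : ul u0 u1 μ a - ul u0 u1 μ b = (1 - μ) * (u0 a - u0 b) + μ * (u1 a - u1 b) := by
      unfold ul; ring
    rw [e]
    refine (abs_add_le _ _).trans ?_
    rw [abs_mul, abs_mul, abs_of_nonneg a0, abs_of_nonneg a1]
    have := mul_le_mul_of_nonneg_left (h0.lip a b) a0
    have := mul_le_mul_of_nonneg_left (h1.lip a b) a1
    linarith
  · unfold ul; rw [h0.zero, h1.zero]; ring
  · intro q hq; unfold ul
    have := h0.negq q hq; have := h1.negq q hq; positivity
  · intro q hq; unfold ul
    have := h0.nonpos q hq; have := h1.nonpos q hq; nlinarith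
  · intro q; unfold ul
    have := mul_le_mul_of_nonneg_left (h0.lb q) a0
    have := mul_le_mul_of_nonneg_left (h1.lb q) a1
    linarith
  · intro q hq hq1; unfold ul
    have := mul_le_mul_of_nonneg_left (h0.small q hq hq1) a0
    have := mul_le_mul_of_nonneg_left (h1.small q hq hq1) a1
    linarith

def hd (u0 u1 : ℝ → ℝ) (q : ℝ) : ℝ := u1 q - u0 q

lemma hd_bd (h0 : Pot C c u0) (h1 : Pot C c u1) {q : ℝ} (hq : 0 < q) :
    |hd u0 u1 q| ≤ C ∧ |hd u0 u1 q| ≤ C * q := by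
  have a := h0.nonpos q hq.le
  have b := h1.nonpos q hq.le
  have a1 := h0.lb q
  have b1 := h1.lb q
  have a2 := h0.lbq q
  have b2 := h1.lbq q
  rw [abs_of_pos hq] at a2 b2
  unfold hd
  constructor <;> rw [abs_le] <;> constructor <;> linarith

lemma hk_wgt (h0 : Pot C c u0) (h1 : Pot C c u1) : Wgt C (fun q => hd u0 u1 q * kap q) := by
  have c0 := h0.cont
  have c1 := h1.cont
  have hcont : Continuous (hd u0 u1) := c1.sub c0
  refine ⟨h0.hC.le, hcont.measurable.mul kap_wgt.m, hcont.continuousOn.mul kap_wgt.ct, ?_⟩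
  intro q hq
  rw [abs_mul]
  have h2 := kap_wgt.bd q hq
  rw [one_mul] at h2
  have := h0.hC
  gcongr
  exact (hd_bd h0 h1 hq).1

lemma hhk_wgt (h0 : Pot C c u0) (h1 : Pot C c u1) :
    Wgt (C ^ 2) (fun q => hd u0 u1 q ^ 2 * kap q) := by
  have c0 := h0.cont
  have c1 := h1.cont
  have hcont : Continuous (fun q => hd u0 u1 q ^ 2) := (c1.sub c0).pow 2
  refine ⟨by positivity, hcont.measurable.mul kap_wgt.m, hcont.continuousOn.mul kap_wgt.ct, ?_⟩
  intro q hq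
  rw [abs_mul, abs_pow]
  have h2 := kap_wgt.bd q hq
  rw [one_mul] at h2
  have := h0.hC
  gcongr
  exact (hd_bd h0 h1 hq).1

variable {ℓ m : ℝ} {a b Ea Eb : ℝ}

lemma xF_diff (q : ℝ) : xF ℓ Eb (ul u0 u1 b) q - xF ℓ Ea (ul u0 u1 a) q =
    (Eb - Ea) - (b - a) * hd u0 u1 q := by
  unfold xF ul hd; ring

/-- the three R-integrals -/
def Rw (ℓ : ℝ) (u0 u1 : ℝ → ℝ) (a Ea b Eb : ℝ) (k : ℝ → ℝ) : ℝ :=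
  ∫ q, k q * Rq (xF ℓ Ea (ul u0 u1 a) q) (xF ℓ Eb (ul u0 u1 b) q)

lemma R_rel1 (h0 : Pot C c u0) (h1 : Pot C c u1) (hℓ : 0 < ℓ) (ha : a ∈ Icc (0:ℝ) 1)
    (hb : b ∈ Icc (0:ℝ) 1) (la : Lev ℓ (ul u0 u1 a) m Ea) (lb : Lev ℓ (ul u0 u1 b) m Eb) :
    (Eb - Ea) * Rw ℓ u0 u1 a Ea b Eb kap =
      (b - a) * Rw ℓ u0 u1 a Ea b Eb (fun q => hd u0 u1 q * kap q) := by
  have pa := h0.seg h1 ha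
  have pb := h0.seg h1 hb
  have e : Af ℓ Eb (ul u0 u1 b) kap - Af ℓ Ea (ul u0 u1 a) kap = 0 := by rw [la.eq, lb.eq, sub_self]
  unfold Af at e
  rw [← integral_sub (kap_wgt.Aint pb hℓ lb.neg) (kap_wgt.Aint pa hℓ la.neg)] at e
  unfold Rw
  rw [← sub_eq_zero, ← integral_const_mul, ← integral_const_mul, ← integral_sub, ← e]
  · congr 1; ext q
    rw [← mul_sub, Rq_mul, xF_diff]; ring
  · exact (kap_wgt.Rint pa pb hℓ la.neg lb.neg).const_mul _
  · exact ((hk_wgt h0 h1).Rint pa pb hℓ la.neg lb.neg).const_mul _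

lemma R_rel2 (h0 : Pot C c u0) (h1 : Pot C c u1) (hℓ : 0 < ℓ) (ha : a ∈ Icc (0:ℝ) 1)
    (hb : b ∈ Icc (0:ℝ) 1) (la : Lev ℓ (ul u0 u1 a) m Ea) (lb : Lev ℓ (ul u0 u1 b) m Eb) :
    Af ℓ Eb (ul u0 u1 b) (fun q => hd u0 u1 q * kap q)
      - Af ℓ Ea (ul u0 u1 a) (fun q => hd u0 u1 q * kap q) =
    (Eb - Ea) * Rw ℓ u0 u1 a Ea b Eb (fun q => hd u0 u1 q * kap q) -
      (b - a) * Rw ℓ u0 u1 a Ea b Eb (fun q => hd u0 u1 q ^ 2 * kap q) := by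
  have pa := h0.seg h1 ha
  have pb := h0.seg h1 hb
  unfold Af
  rw [← integral_sub ((hk_wgt h0 h1).Aint pb hℓ lb.neg) ((hk_wgt h0 h1).Aint pa hℓ la.neg)]
  unfold Rw
  rw [← integral_const_mul, ← integral_const_mul, ← integral_sub]
  · congr 1; ext q
    rw [← mul_sub, Rq_mul, xF_diff]; ring
  · exact ((hk_wgt h0 h1).Rint pa pb hℓ la.neg lb.neg).const_mul _
  · exact ((hhk_wgt h0 h1).Rint pa pb hℓ la.neg lb.neg).const_mul _

lemma Rq_pos {x : ℝ} (y : ℝ) (hx : 0 < x) : 0 < Rq x y := by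
  unfold Rq
  have := Real.sqrt_pos.2 hx
  have := abs_pos.2 hx.ne'
  positivity

lemma R_pos (h0 : Pot C c u0) (h1 : Pot C c u1) (hℓ : 0 < ℓ) (hm : 0 < m) (ha : a ∈ Icc (0:ℝ) 1)
    (hb : b ∈ Icc (0:ℝ) 1) (la : Lev ℓ (ul u0 u1 a) m Ea) (lb : Lev ℓ (ul u0 u1 b) m Eb) :
    0 < Rw ℓ u0 u1 a Ea b Eb kap := by
  have pa := h0.seg h1 ha
  have pb := h0.seg h1 hb
  unfold Rw
  refine (integral_pos_iff_support_of_nonneg (fun q => mul_nonneg (kap_nonneg q) (Rq_nonneg _ _))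
    (kap_wgt.Rint pa pb hℓ la.neg lb.neg)).2 ?_
  refine lt_of_lt_of_le ((isOpen_lt continuous_const (pa.xcont ℓ Ea)).measure_pos volume
    (la.ne pa hm)) (measure_mono ?_)
  intro q hq
  have hq0 := (pa.xpos hℓ la.neg hq).1
  have hk : 0 < kap q := by unfold kap; positivity
  exact (mul_pos hk (Rq_pos _ hq)).ne'

lemma R_cs (h0 : Pot C c u0) (h1 : Pot C c u1) (hℓ : 0 < ℓ) (ha : a ∈ Icc (0:ℝ) 1)
    (hb : b ∈ Icc (0:ℝ) 1) (la : Lev ℓ (ul u0 u1 a) m Ea) (lb : Lev ℓ (ul u0 u1 b) m Eb) (t : ℝ) :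
    0 ≤ Rw ℓ u0 u1 a Ea b Eb (fun q => hd u0 u1 q ^ 2 * kap q)
      - 2 * t * Rw ℓ u0 u1 a Ea b Eb (fun q => hd u0 u1 q * kap q)
      + t ^ 2 * Rw ℓ u0 u1 a Ea b Eb kap := by
  have pa := h0.seg h1 ha
  have pb := h0.seg h1 hb
  have i1 := ((hhk_wgt h0 h1).Rint pa pb hℓ la.neg lb.neg)
  have i2 := ((hk_wgt h0 h1).Rint pa pb hℓ la.neg lb.neg).const_mul (2 * t)
  have i3 := (kap_wgt.Rint pa pb hℓ la.neg lb.neg).const_mul (t ^ 2)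
  unfold Rw
  rw [← integral_const_mul, ← integral_const_mul, ← integral_sub i1 i2]
  have i4 : Integrable (fun q => hd u0 u1 q ^ 2 * kap q * Rq (xF ℓ Ea (ul u0 u1 a) q)
      (xF ℓ Eb (ul u0 u1 b) q) - 2 * t * (hd u0 u1 q * kap q * Rq (xF ℓ Ea (ul u0 u1 a) q)
      (xF ℓ Eb (ul u0 u1 b) q))) := i1.sub i2
  rw [← integral_add i4 i3]
  refine integral_nonneg fun q => ?_
  have : (hd u0 u1 q ^ 2 * kap q * Rq (xF ℓ Ea (ul u0 u1 a) q) (xF ℓ Eb (ul u0 u1 b) q) -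
      2 * t * (hd u0 u1 q * kap q * Rq (xF ℓ Ea (ul u0 u1 a) q) (xF ℓ Eb (ul u0 u1 b) q))) +
      t ^ 2 * (kap q * Rq (xF ℓ Ea (ul u0 u1 a) q) (xF ℓ Eb (ul u0 u1 b) q)) =
      (hd u0 u1 q - t) ^ 2 * (kap q * Rq (xF ℓ Ea (ul u0 u1 a) q) (xF ℓ Eb (ul u0 u1 b) q)) := by ring
  simp only [Pi.zero_apply]
  rw [this]
  exact mul_nonneg (sq_nonneg _) (mul_nonneg (kap_nonneg q) (Rq_nonneg _ _))

lemma R_gam (h0 : Pot C c u0) (h1 : Pot C c u1) (hℓ : 0 < ℓ) (ha : a ∈ Icc (0:ℝ) 1)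
    (hb : b ∈ Icc (0:ℝ) 1) (la : Lev ℓ (ul u0 u1 a) m Ea) (lb : Lev ℓ (ul u0 u1 b) m Eb) :
    Rw ℓ u0 u1 a Ea b Eb (fun q => hd u0 u1 q ^ 2 * kap q) ≤
      2 * C ^ 2 * ((√(ℓ / 2))⁻¹ * ∫ τ, Wt τ) := by
  have pa := h0.seg h1 ha
  have pb := h0.seg h1 hb
  have ia : Integrable (fun q => (√(xF ℓ Ea (ul u0 u1 a) q))⁻¹) := by
    have := pa.Dint hℓ la.neg (k := fun _ => 1) (K := 1) (by fun_prop) (by intros; simp)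
    simpa using this
  have ib : Integrable (fun q => (√(xF ℓ Eb (ul u0 u1 b) q))⁻¹) := by
    have := pb.Dint hℓ lb.neg (k := fun _ => 1) (K := 1) (by fun_prop) (by intros; simp)
    simpa using this
  have : Rw ℓ u0 u1 a Ea b Eb (fun q => hd u0 u1 q ^ 2 * kap q) ≤
      ∫ q, C ^ 2 * ((√(xF ℓ Ea (ul u0 u1 a) q))⁻¹ + (√(xF ℓ Eb (ul u0 u1 b) q))⁻¹) := by
    refine integral_mono ((hhk_wgt h0 h1).Rint pa pb hℓ la.neg lb.neg) ((ia.add ib).const_mul _) ?_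
    intro q
    simp only
    rcases le_or_gt q 0 with hq | hq
    · have z1 : xF ℓ Ea (ul u0 u1 a) q ≤ 0 := by
        by_contra hcon
        exact absurd (pa.xpos hℓ la.neg (not_le.1 hcon)).1 (not_lt.2 hq)
      have z2 : xF ℓ Eb (ul u0 u1 b) q ≤ 0 := by
        by_contra hcon
        exact absurd (pb.xpos hℓ lb.neg (not_le.1 hcon)).1 (not_lt.2 hq)
      have : Rq (xF ℓ Ea (ul u0 u1 a) q) (xF ℓ Eb (ul u0 u1 b) q) = 0 := by
        unfold Rq; simp [Real.sqrt_eq_zero_of_nonpos z1, Real.sqrt_eq_zero_of_nonpos z2]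
      rw [this, mul_zero]; positivity
    · refine mul_le_mul ?_ (Rq_le' _ _) (Rq_nonneg _ _) (by positivity)
      have := (hd_bd h0 h1 hq).2
      unfold kap
      rw [← div_eq_mul_inv, div_le_iff₀ (by positivity), ← mul_pow, ← sq_abs]
      gcongr
  refine this.trans ?_
  rw [integral_const_mul, integral_add ia ib]
  have := pa.Dle hℓ la.neg
  have := pb.Dle hℓ lb.neg
  nlinarith [sq_nonneg C]

lemma B_lip (h0 : Pot C c u0) (h1 : Pot C c u1) (hℓ : 0 < ℓ) (hm : 0 < m) (ha : a ∈ Icc (0:ℝ) 1)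
    (hb : b ∈ Icc (0:ℝ) 1) (la : Lev ℓ (ul u0 u1 a) m Ea) (lb : Lev ℓ (ul u0 u1 b) m Eb) :
    |Af ℓ Eb (ul u0 u1 b) (fun q => hd u0 u1 q * kap q)
      - Af ℓ Ea (ul u0 u1 a) (fun q => hd u0 u1 q * kap q)| ≤
      2 * C ^ 2 * ((√(ℓ / 2))⁻¹ * ∫ τ, Wt τ) * |b - a| := by
  have hpos := R_pos h0 h1 hℓ hm ha hb la lb
  have r1 := R_rel1 h0 h1 hℓ ha hb la lb
  have r2 := R_rel2 h0 h1 hℓ ha hb la lb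
  have g := R_gam h0 h1 hℓ ha hb la lb
  have cs := R_cs h0 h1 hℓ ha hb la lb (Rw ℓ u0 u1 a Ea b Eb (fun q => hd u0 u1 q * kap q) /
    Rw ℓ u0 u1 a Ea b Eb kap)
  set α := Rw ℓ u0 u1 a Ea b Eb kap
  set β := Rw ℓ u0 u1 a Ea b Eb (fun q => hd u0 u1 q * kap q)
  set γ := Rw ℓ u0 u1 a Ea b Eb (fun q => hd u0 u1 q ^ 2 * kap q)
  have e1 : Eb - Ea = (b - a) * (β / α) := by field_simp; linarith
  have e2 : (Eb - Ea) * β - (b - a) * γ = -(b - a) * (γ - β ^ 2 / α) := by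
    rw [e1]; field_simp; ring
  have e3 : γ - 2 * (β / α) * β + (β / α) ^ 2 * α = γ - β ^ 2 / α := by field_simp; ring
  rw [e3] at cs
  have e4 : 0 ≤ β ^ 2 / α := by positivity
  rw [r2, e2, abs_mul, abs_neg, mul_comm, abs_of_nonneg cs]
  gcongr
  linarith

/-- derivative of the level quantity -/
lemma B_deriv (h0 : Pot C c u0) (h1 : Pot C c u1) (hℓ : 0 < ℓ) (hm : 0 < m) {En : ℝ → ℝ}
    (hl : ∀ b ∈ Icc (0:ℝ) 1, Lev ℓ (ul u0 u1 b) m (En b)) {a : ℝ} (ha : a ∈ Icc (0:ℝ) 1) :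
    ∃ D, HasDerivWithinAt (fun b => Af ℓ (En b) (ul u0 u1 b) (fun q => hd u0 u1 q * kap q)) D
      (Icc 0 1) a := by
  have pa := h0.seg h1 ha
  have hmem : ∀ᶠ b in 𝓝[Icc (0:ℝ) 1 \ {a}] a, b ∈ Icc (0:ℝ) 1 \ {a} := self_mem_nhdsWithin
  have hpn : ∀ᶠ b in 𝓝[Icc (0:ℝ) 1 \ {a}] a, Pot C c (ul u0 u1 b) := by
    filter_upwards [hmem] with b hb using h0.seg h1 hb.1
  have hu : ∀ q, Tendsto (fun b => ul u0 u1 b q) (𝓝[Icc (0:ℝ) 1 \ {a}] a) (𝓝 (ul u0 u1 a q)) := by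
    intro q
    have : Continuous (fun b => ul u0 u1 b q) := by unfold ul; fun_prop
    exact (this.tendsto a).mono_left nhdsWithin_le_nhds
  have hEt : Tendsto En (𝓝[Icc (0:ℝ) 1 \ {a}] a) (𝓝 (En a)) := by
    refine Lev.tendsto hℓ hm hpn pa hu ?_ (hl a ha)
    filter_upwards [hmem] with b hb using hl b hb.1
  have cv : Conv (𝓝[Icc (0:ℝ) 1 \ {a}] a) C c En (ul u0 u1) (En a) (ul u0 u1 a) :=
    ⟨hpn, pa, hEt, hu, (hl a ha).neg⟩
  have hne := (hl a ha).ne pa hm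
  have tα := cv.tR hℓ hne kap_wgt
  have tβ := cv.tR hℓ hne (hk_wgt h0 h1)
  have tγ := cv.tR hℓ hne (hhk_wgt h0 h1)
  have hα : (∫ q, kap q * ((√(xF ℓ (En a) (ul u0 u1 a) q))⁻¹ / 2)) ≠ 0 := by
    refine ne_of_gt ?_
    refine (integral_pos_iff_support_of_nonneg (fun q => mul_nonneg (kap_nonneg q) (by positivity))
      ?_).2 ?_
    · have := (kap_wgt.Dint pa hℓ (hl a ha).neg).div_const 2
      refine this.congr (ae_of_all _ fun q => ?_); simp only; ring
    · refine lt_of_lt_of_le ((isOpen_lt continuous_const (pa.xcont ℓ (En a))).measure_pos volume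
        hne) (measure_mono ?_)
      intro q hq
      have hq0 := (pa.xpos hℓ (hl a ha).neg hq).1
      have hk : 0 < kap q := by unfold kap; positivity
      have hq' : 0 < √(xF ℓ (En a) (ul u0 u1 a) q) := Real.sqrt_pos.2 hq
      exact (mul_pos hk (by positivity)).ne'
  have tt := ((tβ.pow 2).div tα hα).sub tγ
  refine ⟨_, hasDerivWithinAt_iff_tendsto_slope.2 (tt.congr' ?_)⟩
  filter_upwards [hmem] with b hb
  have hpos := R_pos h0 h1 hℓ hm ha hb.1 (hl a ha) (hl b hb.1)
  have r1 := R_rel1 h0 h1 hℓ ha hb.1 (hl a ha) (hl b hb.1)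
  have r2 := R_rel2 h0 h1 hℓ ha hb.1 (hl a ha) (hl b hb.1)
  have hba : b - a ≠ 0 := sub_ne_zero.2 hb.2
  rw [slope_def_field]
  change Rw ℓ u0 u1 a (En a) b (En b) (fun q => hd u0 u1 q * kap q) ^ 2 /
    Rw ℓ u0 u1 a (En a) b (En b) kap - Rw ℓ u0 u1 a (En a) b (En b) (fun q => hd u0 u1 q ^ 2 * kap q) = _
  rw [r2]
  set α := Rw ℓ u0 u1 a (En a) b (En b) kap
  set β := Rw ℓ u0 u1 a (En a) b (En b) (fun q => hd u0 u1 q * kap q)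
  set γ := Rw ℓ u0 u1 a (En a) b (En b) (fun q => hd u0 u1 q ^ 2 * kap q)
  have e1 : En b - En a = (b - a) * (β / α) := by field_simp; linarith
  rw [e1]
  field_simp

end

end

noncomputable section
open MeasureTheory Real Filter Set Topology
open scoped ENNReal NNReal

lemma lint_sq (K : ℝ → ℝ≥0∞) :
    ∫⁻ σ in Ioi (0:ℝ), K σ = ∫⁻ r in Ioi (0:ℝ), ENNReal.ofReal (2 * r) * K (r ^ 2) := by
  have himg : (fun r : ℝ => r ^ 2) '' Ioi 0 = Ioi 0 := by
    ext s; constructor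
    · rintro ⟨r, hr, rfl⟩; have : 0 < r := hr; exact (by positivity : (0:ℝ) < r ^ 2)
    · intro hs; exact ⟨√s, Real.sqrt_pos.2 hs, Real.sq_sqrt (le_of_lt hs)⟩
  have := lintegral_image_eq_lintegral_abs_deriv_mul (s := Ioi (0:ℝ)) (f := fun r => r ^ 2)
    (f' := fun r => 2 * r) measurableSet_Ioi
    (fun x _ => by simpa using (hasDerivAt_pow 2 x).hasDerivWithinAt)
    (fun a ha b hb hab => by
      have h1 : 0 < a := ha
      have h2 : 0 < b := hb
      exact (pow_left_inj₀ h1.le h2.le two_ne_zero).1 hab) K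
  rw [himg] at this
  rw [this]
  refine setLIntegral_congr_fun measurableSet_Ioi fun r hr => ?_
  have : 0 < r := hr
  rw [abs_of_pos (by positivity)]

lemma lint_plane (K : ℝ → ℝ≥0∞) (hK : Measurable K) :
    ∫⁻ p : ℝ × ℝ, K (p.1 ^ 2 + p.2 ^ 2) = ENNReal.ofReal π * ∫⁻ σ in Ioi (0:ℝ), K σ := by
  rw [← lintegral_comp_polarCoord_symm, polarCoord_target]
  have e : ∀ p : ℝ × ℝ, (polarCoord.symm p).1 ^ 2 + (polarCoord.symm p).2 ^ 2 = p.1 ^ 2 := by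
    intro p
    simp only [polarCoord_symm_apply]
    nlinarith [Real.cos_sq_add_sin_sq p.2]
  simp only [e]
  rw [Measure.volume_eq_prod, ← Measure.prod_restrict, lintegral_prod]
  · simp only [lintegral_const, Measure.restrict_apply MeasurableSet.univ, univ_inter,
      Real.volume_Ioo]
    rw [lintegral_mul_const', lint_sq K]
    · rw [mul_comm, show π - -π = π * 2 by ring, ENNReal.ofReal_mul Real.pi_pos.le, mul_assoc,
        ← lintegral_const_mul' _ _ (by simp)]
      congr 1
      refine setLIntegral_congr_fun measurableSet_Ioi fun r hr => ?_
      simp only [smul_eq_mul]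
      rw [ENNReal.ofReal_mul (by norm_num)]; ring
    · exact ENNReal.ofReal_ne_top
  · apply Measurable.aemeasurable
    simp only [smul_eq_mul]
    fun_prop

def e3m (y : E3) : ℝ × (ℝ × ℝ) := (y 0, (y 1, y 2))

lemma e3m_mp : MeasurePreserving e3m := by
  have h1 := PiLp.volume_preserving_ofLp (Fin 3)
  have h2 := volume_preserving_piFinSuccAbove (fun _ : Fin 3 => ℝ) 0
  have h3 := (MeasurePreserving.id (volume : Measure ℝ)).prod (volume_preserving_finTwoArrow ℝ)
  exact (h3.comp h2).comp h1

lemma cyl (K : ℝ × ℝ → ℝ≥0∞) (hK : Measurable K) :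
    ∫⁻ y : E3, K (y 0, y 1 ^ 2 + y 2 ^ 2) =
      ENNReal.ofReal π * ∫⁻ w : ℝ, ∫⁻ σ in Ioi (0:ℝ), K (w, σ) := by
  have h1 := e3m_mp.lintegral_comp (f := fun p => K (p.1, p.2.1 ^ 2 + p.2.2 ^ 2)) (by fun_prop)
  unfold e3m at h1
  simp only at h1
  rw [h1, Measure.volume_eq_prod, lintegral_prod _ (by fun_prop)]
  simp only
  rw [← lintegral_const_mul' _ _ (by simp)]
  congr 1; ext w
  exact lint_plane (fun s => K (w, s)) (by fun_prop)

lemma norm_e3 (y : E3) : ‖y‖ ^ 2 = y 0 ^ 2 + (y 1 ^ 2 + y 2 ^ 2) := by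
  rw [EuclideanSpace.norm_sq_eq, Fin.sum_univ_three]
  simp [add_assoc]

lemma lint_shift (w : ℝ) (K : ℝ → ℝ≥0∞) :
    ∫⁻ σ in Ioi (0:ℝ), K (√(w ^ 2 + σ)) = ∫⁻ s in Ioi |w|, ENNReal.ofReal (2 * s) * K s := by
  have himg : (fun r : ℝ => r ^ 2 - w ^ 2) '' Ioi |w| = Ioi 0 := by
    ext s; constructor
    · rintro ⟨r, hr, rfl⟩
      have h1 : |w| < r := hr
      have : w ^ 2 < r ^ 2 := sq_lt_sq' (by linarith [neg_abs_le w]) (lt_of_le_of_lt (le_abs_self w) h1)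
      exact sub_pos.2 this
    · intro hs
      have hs' : 0 < s := hs
      refine ⟨√(w ^ 2 + s), ?_, ?_⟩
      · show |w| < √(w ^ 2 + s)
        rw [← Real.sqrt_sq_eq_abs]
        exact Real.sqrt_lt_sqrt (by positivity) (by linarith)
      · simp only; rw [Real.sq_sqrt (by positivity)]; ring
  have := lintegral_image_eq_lintegral_abs_deriv_mul (s := Ioi |w|) (f := fun r => r ^ 2 - w ^ 2)
    (f' := fun r => 2 * r) measurableSet_Ioi
    (fun x _ => by simpa using ((hasDerivAt_pow 2 x).sub_const (w ^ 2)).hasDerivWithinAt)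
    (fun a ha b hb hab => by
      have h1 : 0 < a := lt_of_le_of_lt (abs_nonneg w) ha
      have h2 : 0 < b := lt_of_le_of_lt (abs_nonneg w) hb
      simp only at hab
      exact (pow_left_inj₀ h1.le h2.le two_ne_zero).1 (by linarith)) (fun σ => K (√(w ^ 2 + σ)))
  rw [himg] at this
  rw [this]
  refine setLIntegral_congr_fun measurableSet_Ioi fun r hr => ?_
  have : 0 < r := lt_of_le_of_lt (abs_nonneg w) hr
  rw [abs_of_pos (by positivity), show w ^ 2 + (r ^ 2 - w ^ 2) = r ^ 2 by ring, Real.sqrt_sq this.le]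

lemma sph (K : ℝ × ℝ → ℝ≥0∞) (hK : Measurable K) :
    ∫⁻ y : E3, K (‖y‖, y 0) =
      ENNReal.ofReal (2 * π) * ∫⁻ s in Ioi (0:ℝ), ENNReal.ofReal s * ∫⁻ w in Ioo (-s) s, K (s, w) := by
  have h1 := cyl (fun p => K (√(p.1 ^ 2 + p.2), p.1)) (by fun_prop)
  simp only at h1
  have h2 : ∀ y : E3, √(y 0 ^ 2 + (y 1 ^ 2 + y 2 ^ 2)) = ‖y‖ := fun y => by
    rw [← norm_e3, Real.sqrt_sq (norm_nonneg _)]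
  simp only [h2] at h1
  rw [h1]
  have h3 : ∀ w : ℝ, ∫⁻ σ in Ioi (0:ℝ), K (√(w ^ 2 + σ), w) =
      ∫⁻ s, (if |w| < s then ENNReal.ofReal (2 * s) * K (s, w) else 0) := by
    intro w
    rw [lint_shift w (fun s => K (s, w)), ← lintegral_indicator measurableSet_Ioi]
    congr 1
  simp only [h3]
  have hm : Measurable (fun p : ℝ × ℝ => if |p.1| < p.2 then ENNReal.ofReal (2 * p.2) * K (p.2, p.1) else 0) :=
    Measurable.ite (measurableSet_lt (by fun_prop) (by fun_prop)) (by fun_prop) (by fun_prop)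
  rw [lintegral_lintegral_swap hm.aemeasurable]
  have h4 : ∀ s : ℝ, ∫⁻ w, (if |w| < s then ENNReal.ofReal (2 * s) * K (s, w) else 0) =
      indicator (Ioi 0) (fun s => ENNReal.ofReal (2 * s) * ∫⁻ w in Ioo (-s) s, K (s, w)) s := by
    intro s
    by_cases hs : 0 < s
    · rw [indicator_of_mem (show s ∈ Ioi (0:ℝ) from hs), ← lintegral_const_mul' _ _ ENNReal.ofReal_ne_top,
        ← lintegral_indicator measurableSet_Ioo]
      congr 1; ext w
      simp only [indicator_apply, mem_Ioo, abs_lt]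
    · rw [indicator_of_notMem (show s ∉ Ioi (0:ℝ) from hs)]
      rw [lintegral_eq_zero_of_ae_eq_zero]
      refine ae_of_all _ fun w => ?_
      have : ¬ |w| < s := fun h => hs (lt_of_le_of_lt (abs_nonneg w) h)
      simp [this]
  simp only [h4]
  rw [lintegral_indicator measurableSet_Ioi, mul_comm 2 π, ENNReal.ofReal_mul Real.pi_pos.le, mul_assoc,
    ← lintegral_const_mul' (ENNReal.ofReal 2) _ (by simp)]
  congr 1
  refine setLIntegral_congr_fun measurableSet_Ioi fun r hr => ?_
  rw [ENNReal.ofReal_mul (by norm_num)]; ring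

lemma sph0 (K : ℝ → ℝ≥0∞) (hK : Measurable K) :
    ∫⁻ y : E3, K ‖y‖ = ENNReal.ofReal (4 * π) * ∫⁻ s in Ioi (0:ℝ), ENNReal.ofReal (s ^ 2) * K s := by
  rw [sph (fun p => K p.1) (by fun_prop), show 4 * π = (2 * π) * 2 by ring,
    ENNReal.ofReal_mul (p := 2 * π) (by positivity), mul_assoc,
    ← lintegral_const_mul' (ENNReal.ofReal 2) _ (by simp)]
  congr 1
  refine setLIntegral_congr_fun measurableSet_Ioi fun s hs => ?_
  have hs' : 0 < s := hs
  simp only [lintegral_const, Measure.restrict_apply MeasurableSet.univ, univ_inter, Real.volume_Ioo]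
  rw [show s - -s = 2 * s by ring, mul_comm (K s), ← mul_assoc, ← mul_assoc, ← ENNReal.ofReal_mul hs'.le,
    ← ENNReal.ofReal_mul (by norm_num)]
  congr 2; ring

/-- a rotation taking x to y -/
lemma rot_exists (x y : E3) (h : ‖x‖ = ‖y‖) :
    ∃ R : E3 ≃ₗᵢ[ℝ] E3, LinearMap.det (R.toLinearEquiv : E3 →ₗ[ℝ] E3) = 1 ∧ R x = y := by
  have hfin : Module.finrank ℝ E3 = 3 := by simp [E3]
  have hdet : ∀ K : Submodule ℝ E3, LinearMap.det (K.reflection.toLinearEquiv : E3 →ₗ[ℝ] E3) =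
      (-1) ^ Module.finrank ℝ Kᗮ := fun K => by
    have := Submodule.det_reflection K
    exact this
  have hspan : ∀ w : E3, w ≠ 0 → LinearMap.det ((ℝ ∙ w)ᗮ.reflection.toLinearEquiv : E3 →ₗ[ℝ] E3) = -1 := by
    intro w hw
    rw [hdet, Submodule.orthogonal_orthogonal, finrank_span_singleton hw]; simp
  by_cases hxy : x = y
  · refine ⟨LinearIsometryEquiv.refl ℝ E3, ?_, hxy⟩
    exact LinearMap.det_id
  -- a vector orthogonal to y
  obtain ⟨w, hw, hwy⟩ : ∃ w : E3, w ≠ 0 ∧ w ∈ (ℝ ∙ y)ᗮ := by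
    have : (ℝ ∙ y)ᗮ ≠ ⊥ := by
      intro hb
      have h2 := Submodule.finrank_add_finrank_orthogonal (ℝ ∙ y)
      rw [hb, finrank_bot, hfin] at h2
      have := finrank_span_le_card (R := ℝ) ({y} : Set E3)
      simp at this
      omega
    obtain ⟨w, hw, hw0⟩ := Submodule.exists_mem_ne_zero_of_ne_bot this
    exact ⟨w, hw0, hw⟩
  refine ⟨((ℝ ∙ (x - y))ᗮ.reflection).trans ((ℝ ∙ w)ᗮ.reflection), ?_, ?_⟩
  · have : (((ℝ ∙ (x - y))ᗮ.reflection).trans ((ℝ ∙ w)ᗮ.reflection)).toLinearEquiv =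
      ((ℝ ∙ (x - y))ᗮ.reflection).toLinearEquiv.trans ((ℝ ∙ w)ᗮ.reflection).toLinearEquiv := rfl
    rw [this, LinearEquiv.coe_trans, LinearMap.det_comp, hspan w hw, hspan _ (sub_ne_zero.2 hxy)]
    norm_num
  · rw [LinearIsometryEquiv.trans_apply, Submodule.reflection_sub h]
    apply Submodule.reflection_mem_subspace_eq_self
    rw [Submodule.mem_orthogonal_singleton_iff_inner_right] at hwy ⊢
    rw [real_inner_comm]; exact hwy

/-- first unit vector -/
def e0 : E3 := EuclideanSpace.single (0 : Fin 3) (1:ℝ)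

lemma norm_e0 : ‖e0‖ = 1 := by simp [e0]
lemma inner_e0 (v : E3) : inner ℝ e0 v = v 0 := by simp [e0, EuclideanSpace.inner_single_left]

lemma rot_e0 (x : E3) : ∃ R : E3 ≃ₗᵢ[ℝ] E3, LinearMap.det (R.toLinearEquiv : E3 →ₗ[ℝ] E3) = 1 ∧
    R (‖x‖ • e0) = x := rot_exists _ _ (by simp [norm_smul, norm_e0])

def Pi3 (z : Phase) : ℝ × ℝ × ℝ := (‖z.1‖, inner ℝ z.1 z.2 / ‖z.1‖, ellOf z)

lemma Pi3_meas : Measurable Pi3 := by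
  unfold Pi3 ellOf; fun_prop

lemma lint_scale {b : ℝ} (hb : 0 < b) (K : ℝ → ℝ≥0∞) :
    ∫⁻ σ in Ioi (0:ℝ), K (b * σ) = ENNReal.ofReal b⁻¹ * ∫⁻ s in Ioi (0:ℝ), K s := by
  have himg : (fun r : ℝ => b * r) '' Ioi 0 = Ioi 0 := by
    ext s; constructor
    · rintro ⟨r, hr, rfl⟩; have : 0 < r := hr; exact (by positivity : (0:ℝ) < b * r)
    · intro hs
      have hs' : 0 < s := hs
      exact ⟨b⁻¹ * s, (by positivity : (0:ℝ) < b⁻¹ * s), by simp; field_simp⟩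
  have := lintegral_image_eq_lintegral_abs_deriv_mul (s := Ioi (0:ℝ)) (f := fun r => b * r)
    (f' := fun _ => b) measurableSet_Ioi
    (fun x _ => by simpa using ((hasDerivAt_id x).const_mul b).hasDerivWithinAt)
    (fun a ha c hc hab => mul_left_cancel₀ hb.ne' hab) K
  rw [himg, abs_of_pos hb, lintegral_const_mul' _ _ (by simp)] at this
  rw [this, ← mul_assoc, ← ENNReal.ofReal_mul (by positivity), inv_mul_cancel₀ hb.ne']
  simp

def mu3 : Measure (ℝ × ℝ × ℝ) :=
  (volume.restrict (Ioi (0:ℝ))).prod ((volume : Measure ℝ).prod (volume.restrict (Ioi (0:ℝ))))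

lemma Pi3_lint (G : ℝ × ℝ × ℝ → ℝ≥0∞) (hG : Measurable G) :
    ∫⁻ z, G (Pi3 z) = ENNReal.ofReal (4 * π ^ 2) * ∫⁻ p, G p ∂mu3 := by
  rw [Measure.volume_eq_prod, lintegral_prod (fun z => G (Pi3 z)) (hG.comp Pi3_meas).aemeasurable]
  have hin : ∀ x : E3, x ≠ 0 → ∫⁻ v, G (Pi3 (x, v)) =
      ENNReal.ofReal π * (ENNReal.ofReal ((‖x‖ ^ 2)⁻¹) *
        ∫⁻ w : ℝ, ∫⁻ s in Ioi (0:ℝ), G (‖x‖, w, s)) := by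
    intro x hx
    have hr : 0 < ‖x‖ := norm_pos_iff.2 hx
    obtain ⟨R, -, hR⟩ := rot_e0 x
    rw [← R.measurePreserving.lintegral_comp (f := fun v => G (Pi3 (x, v)))
      (hG.comp (Pi3_meas.comp (by fun_prop)))]
    have e : ∀ v, Pi3 (x, R v) = (‖x‖, v 0, ‖x‖ ^ 2 * (v 1 ^ 2 + v 2 ^ 2)) := by
      intro v
      have h1 : inner ℝ x (R v) = ‖x‖ * v 0 := by
        conv_lhs => rw [← hR]
        rw [R.inner_map_map, inner_smul_left, inner_e0]; simp
      unfold Pi3 ellOf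
      simp only [h1, LinearIsometryEquiv.norm_map]
      rw [norm_e3 v]
      refine Prod.ext rfl (Prod.ext ?_ ?_)
      · simp only; field_simp
      · simp only; ring
    simp only [e]
    rw [cyl (fun p => G (‖x‖, p.1, ‖x‖ ^ 2 * p.2)) (by fun_prop)]
    congr 1
    rw [← lintegral_const_mul' _ _ (by simp)]
    congr 1; ext w
    exact lint_scale (by positivity) (fun s => G (‖x‖, w, s))
  have hae : ∀ᵐ x : E3, x ≠ 0 := by
    simp [ae_iff]
  rw [lintegral_congr_ae (hae.mono hin), lintegral_const_mul' _ _ (by simp)]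
  have hmm : Measurable (fun r => ∫⁻ w : ℝ, ∫⁻ s in Ioi (0:ℝ), G (r, w, s)) := by
    have h1 : Measurable (fun p : ℝ × ℝ => ∫⁻ s in Ioi (0:ℝ), G (p.1, p.2, s)) :=
      Measurable.lintegral_prod_right' (f := fun q : (ℝ × ℝ) × ℝ => G (q.1.1, q.1.2, q.2)) (by fun_prop)
    exact Measurable.lintegral_prod_right' h1
  rw [sph0 (fun r => ENNReal.ofReal ((r ^ 2)⁻¹) * ∫⁻ w : ℝ, ∫⁻ s in Ioi (0:ℝ), G (r, w, s)) (by fun_prop),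
    ← mul_assoc, ← ENNReal.ofReal_mul Real.pi_pos.le, show π * (4 * π) = 4 * π ^ 2 by ring]
  congr 1
  unfold mu3
  rw [lintegral_prod _ hG.aemeasurable]
  refine setLIntegral_congr_fun measurableSet_Ioi fun r hr => ?_
  have hr' : 0 < r := hr
  rw [← mul_assoc, ← ENNReal.ofReal_mul (by positivity), mul_inv_cancel₀ (by positivity), ENNReal.ofReal_one,
    one_mul, lintegral_prod _ (by fun_prop)]

lemma Pi3_map : Measure.map Pi3 volume = ENNReal.ofReal (4 * π ^ 2) • mu3 := by
  ext s hs
  rw [Measure.map_apply Pi3_meas hs, Measure.smul_apply, smul_eq_mul]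
  have := Pi3_lint (indicator s 1) (measurable_one.indicator hs)
  rw [lintegral_indicator_one hs] at this
  rw [← this, ← lintegral_indicator_one (Pi3_meas hs)]
  rfl

lemma Pi3_integral (G : ℝ × ℝ × ℝ → ℝ) (hG : Measurable G) :
    ∫ z, G (Pi3 z) = (4 * π ^ 2) * ∫ p, G p ∂mu3 := by
  rw [← integral_map (φ := Pi3) Pi3_meas.aemeasurable hG.aestronglyMeasurable, Pi3_map,
    integral_smul_measure, ENNReal.toReal_ofReal (by positivity), smul_eq_mul]

lemma Pi3_integrable {G : ℝ × ℝ × ℝ → ℝ} (hG : Measurable G) :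
    Integrable (fun z => G (Pi3 z)) ↔ Integrable G mu3 := by
  have := integrable_map_measure (μ := volume) (f := Pi3) (g := G) hG.aestronglyMeasurable
    Pi3_meas.aemeasurable
  rw [show (fun z => G (Pi3 z)) = G ∘ Pi3 from rfl, ← this, Pi3_map,
    integrable_smul_measure (ENNReal.ofReal_pos.2 (by positivity)).ne' ENNReal.ofReal_ne_top]

end

noncomputable section
open MeasureTheory Real Filter Set Topology
open scoped ENNReal NNReal

lemma lint_even {g : ℝ → ℝ≥0∞} (hg : ∀ x, g (-x) = g x) :
    ∫⁻ x, g x = 2 * ∫⁻ x in Ioi (0:ℝ), g x := by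
  have h1 : ∫⁻ x in Iio (0:ℝ), g x = ∫⁻ x in Ioi (0:ℝ), g x := by
    have := (Measure.measurePreserving_neg (volume : Measure ℝ)).setLIntegral_comp_preimage_emb
      (Homeomorph.neg ℝ).measurableEmbedding g (Iio 0)
    rw [← this]
    simp [hg]
  have h2 : ∫⁻ x in Iic (0:ℝ), g x = ∫⁻ x in Iio (0:ℝ), g x := setLIntegral_congr Iio_ae_eq_Iic.symm
  rw [← lintegral_add_compl g (measurableSet_Ioi (a := (0:ℝ))), compl_Ioi, h2, h1, two_mul]

lemma lint_u {b : ℝ} (hb : 0 < b) (K : ℝ → ℝ≥0∞) :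
    ∫⁻ u, (if b ^ 2 < u ^ 2 then ENNReal.ofReal (|u| / √(u ^ 2 - b ^ 2)) * K (u ^ 2) else 0) =
      ∫⁻ w, K (w ^ 2 + b ^ 2) := by
  rw [lint_even (by intro x; simp), lint_even (by intro x; simp)]
  congr 1
  have himg : (fun w : ℝ => √(w ^ 2 + b ^ 2)) '' Ioi 0 = Ioi b := by
    ext s; constructor
    · rintro ⟨w, hw, rfl⟩
      have : 0 < w := hw
      show b < √(w ^ 2 + b ^ 2)
      exact Real.lt_sqrt_of_sq_lt (by nlinarith [sq_pos_of_pos this])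
    · intro hs
      have hs' : b < s := hs
      have h2 : b ^ 2 < s ^ 2 := by nlinarith
      refine ⟨√(s ^ 2 - b ^ 2), Real.sqrt_pos.2 (by linarith), ?_⟩
      simp only
      rw [Real.sq_sqrt (by linarith), sub_add_cancel, Real.sqrt_sq (by linarith)]
  have hd : ∀ w ∈ Ioi (0:ℝ), HasDerivWithinAt (fun w : ℝ => √(w ^ 2 + b ^ 2))
      (w / √(w ^ 2 + b ^ 2)) (Ioi 0) w := by
    intro w hw
    have : 0 < w := hw
    have h1 := ((hasDerivAt_pow 2 w).add_const (b ^ 2)).sqrt (by positivity)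
    have e : w / √(w ^ 2 + b ^ 2) = (2:ℕ) * w ^ (2 - 1) / (2 * √(w ^ 2 + b ^ 2)) := by
      simp only [Nat.cast_ofNat, Nat.add_one_sub_one, pow_one]
      rw [mul_div_mul_left _ _ (two_ne_zero)]
    rw [e]
    exact h1.hasDerivWithinAt
  have hinj : InjOn (fun w : ℝ => √(w ^ 2 + b ^ 2)) (Ioi 0) := by
    intro x hx y hy hxy
    have h1 : 0 < x := hx
    have h2 : 0 < y := hy
    simp only at hxy
    rw [Real.sqrt_inj (by positivity) (by positivity)] at hxy
    exact (pow_left_inj₀ h1.le h2.le two_ne_zero).1 (by linarith)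
  have key := lintegral_image_eq_lintegral_abs_deriv_mul measurableSet_Ioi hd hinj
    (fun u => ENNReal.ofReal (|u| / √(u ^ 2 - b ^ 2)) * K (u ^ 2))
  rw [himg] at key
  have e1 : ∫⁻ u in Ioi (0:ℝ), (if b ^ 2 < u ^ 2 then
      ENNReal.ofReal (|u| / √(u ^ 2 - b ^ 2)) * K (u ^ 2) else 0) =
      ∫⁻ u in Ioi b, ENNReal.ofReal (|u| / √(u ^ 2 - b ^ 2)) * K (u ^ 2) := by
    rw [← lintegral_indicator measurableSet_Ioi, ← lintegral_indicator measurableSet_Ioi]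
    congr 1; ext u
    by_cases hu : b < u
    · have h0 : 0 < u := hb.trans hu
      rw [indicator_of_mem (show u ∈ Ioi (0:ℝ) from h0), indicator_of_mem (show u ∈ Ioi b from hu),
        if_pos (by nlinarith)]
    · rw [indicator_of_notMem (show u ∉ Ioi b from hu)]
      by_cases h0 : 0 < u
      · rw [indicator_of_mem (show u ∈ Ioi (0:ℝ) from h0), if_neg (by push Not at hu; nlinarith)]
      · rw [indicator_of_notMem (show u ∉ Ioi (0:ℝ) from h0)]
  rw [e1, key]
  refine setLIntegral_congr_fun measurableSet_Ioi fun w hw => ?_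
  have h0 : 0 < w := hw
  have h1 : 0 < √(w ^ 2 + b ^ 2) := Real.sqrt_pos.2 (by positivity)
  rw [Real.sq_sqrt (by positivity), add_sub_cancel_right, Real.sqrt_sq h0.le, ← mul_assoc,
    ← ENNReal.ofReal_mul (by positivity), abs_of_pos h1, abs_of_pos (by positivity),
    div_mul_div_cancel₀ h1.ne', div_self h0.ne']
  simp

lemma nuDens_meas (ℓ : ℝ) : Measurable (nuDens ℓ) := by
  unfold nuDens
  refine Measurable.ite ?_ (by fun_prop) (by fun_prop)
  have h1 : MeasurableSet {p : ℝ × ℝ | 0 < p.1} := measurableSet_lt (by fun_prop) (by fun_prop)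
  have h2 : MeasurableSet {p : ℝ × ℝ | ℓ < p.1 ^ 2 * p.2 ^ 2} :=
    measurableSet_lt (by fun_prop) (by fun_prop)
  exact h1.inter h2

lemma nu_lint {ℓ : ℝ} (hℓ : 0 < ℓ) (K : ℝ × ℝ → ℝ≥0∞) (hK : Measurable K) :
    ∫⁻ p, nuDens ℓ p * K (p.1, p.2 ^ 2) =
      ENNReal.ofReal (4 * π ^ 2) * ∫⁻ r in Ioi (0:ℝ), ∫⁻ w, K (r, w ^ 2 + ℓ / r ^ 2) := by
  have := nuDens_meas ℓ
  rw [Measure.volume_eq_prod, lintegral_prod _ (by fun_prop),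
    ← lintegral_const_mul' _ _ ENNReal.ofReal_ne_top, ← lintegral_indicator measurableSet_Ioi]
  congr 1; ext r
  by_cases hr : 0 < r
  swap
  · rw [indicator_of_notMem (show r ∉ Ioi (0:ℝ) from hr)]
    simp [nuDens, hr]
  rw [indicator_of_mem (show r ∈ Ioi (0:ℝ) from hr), ]
  have hb : 0 < √ℓ / r := by positivity
  have hb2 : (√ℓ / r) ^ 2 = ℓ / r ^ 2 := by rw [div_pow, Real.sq_sqrt hℓ.le]
  have h1 := lint_u hb (fun y => K (r, y))
  rw [hb2] at h1
  rw [← h1, ← lintegral_const_mul' _ _ ENNReal.ofReal_ne_top]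
  congr 1; ext u
  unfold nuDens
  have hiff : ℓ / r ^ 2 < u ^ 2 ↔ ℓ < r ^ 2 * u ^ 2 := by
    rw [div_lt_iff₀ (by positivity), mul_comm]
  simp only [hr, true_and, hiff]
  split_ifs with hc
  · rw [← mul_assoc, ← ENNReal.ofReal_mul (by positivity)]
    congr 2
    have : r ^ 2 * u ^ 2 - ℓ = r ^ 2 * (u ^ 2 - ℓ / r ^ 2) := by field_simp
    rw [this, Real.sqrt_mul (by positivity), Real.sqrt_sq hr.le]
    field_simp
  · simp

lemma radPoint_facts {r u ℓ : ℝ} (hr : 0 < r) (hℓ : 0 < ℓ) (h : ℓ < r ^ 2 * u ^ 2) :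
    ‖(radPoint r u ℓ).1‖ = r ∧ ‖(radPoint r u ℓ).2‖ ^ 2 = u ^ 2 ∧ ellOf (radPoint r u ℓ) = ℓ := by
  have h1 : ‖(radPoint r u ℓ).1‖ = r := by
    simp [radPoint, norm_smul, abs_of_pos hr]
  have hu : u ≠ 0 := by rintro rfl; simp at h; linarith
  have hs : Real.sign u ^ 2 = 1 := by
    rcases lt_or_gt_of_ne hu with hu | hu
    · rw [Real.sign_of_neg hu]; norm_num
    · rw [Real.sign_of_pos hu]; norm_num
  have c0 : (radPoint r u ℓ).2 0 = Real.sign u * √(r ^ 2 * u ^ 2 - ℓ) / r := by simp [radPoint]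
  have c1 : (radPoint r u ℓ).2 1 = √ℓ / r := by simp [radPoint]
  have c2 : (radPoint r u ℓ).2 2 = 0 := by simp [radPoint]
  have h2 : ‖(radPoint r u ℓ).2‖ ^ 2 = u ^ 2 := by
    rw [norm_e3, c0, c1, c2, div_pow, mul_pow, hs, Real.sq_sqrt (by linarith), div_pow,
      Real.sq_sqrt hℓ.le]
    field_simp; ring
  have h3 : inner ℝ (radPoint r u ℓ).1 (radPoint r u ℓ).2 = Real.sign u * √(r ^ 2 * u ^ 2 - ℓ) := by
    have : (radPoint r u ℓ).1 = r • e0 := rfl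
    rw [this, inner_smul_left, inner_e0, c0]; simp; field_simp
  refine ⟨h1, h2, ?_⟩
  unfold ellOf
  rw [h1, h2, h3, mul_pow, hs, Real.sq_sqrt (by linarith)]; ring

lemma sign_meas : Measurable Real.sign := by
  unfold Real.sign
  refine Measurable.ite measurableSet_Iio (by fun_prop) (Measurable.ite measurableSet_Ioi (by fun_prop) (by fun_prop))

lemma radPoint_meas (ℓ : ℝ) : Measurable (fun p : ℝ × ℝ => radPoint p.1 p.2 ℓ) := by
  have := sign_meas
  unfold radPoint
  fun_prop

/-- distribution function in (r,w) variables -/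
lemma muDist_eq {Q : Phase → ℝ} (hQ : Measurable Q) {ℓ s : ℝ} (hℓ : 0 < ℓ) (K : ℝ × ℝ → ℝ)
    (hK : Measurable K)
    (hQK : ∀ r u, 0 < r → ℓ < r ^ 2 * u ^ 2 → Q (radPoint r u ℓ) = K (r, u ^ 2)) :
    muDist Q s ℓ = ENNReal.ofReal (4 * π ^ 2) * ∫⁻ r in Ioi (0:ℝ), ∫⁻ w,
      (if s < K (r, w ^ 2 + ℓ / r ^ 2) then 1 else 0) := by
  have hm : MeasurableSet {p : ℝ × ℝ | s < Q (radPoint p.1 p.2 ℓ)} :=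
    measurableSet_lt measurable_const (hQ.comp (radPoint_meas ℓ))
  unfold muDist nuMeas
  rw [withDensity_apply _ hm, ← lintegral_indicator hm]
  have h1 := nu_lint hℓ (fun p => if s < K p then 1 else 0)
    (Measurable.ite (measurableSet_lt measurable_const hK) measurable_const measurable_const)
  rw [← h1]
  congr 1; ext p
  by_cases hp : 0 < p.1 ∧ ℓ < p.1 ^ 2 * p.2 ^ 2
  · have e := hQK p.1 p.2 hp.1 hp.2
    simp only [indicator_apply, mem_ofPred_eq, e]
    split_ifs <;> simp
  · simp [nuDens, hp, indicator_apply]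

/-- area of the energy well at fixed radius -/
lemma vol_w (x : ℝ) : volume {w : ℝ | w ^ 2 / 2 < x} = ENNReal.ofReal (2 * √2 * √x) := by
  have : {w : ℝ | w ^ 2 / 2 < x} = Ioo (-√(2 * x)) (√(2 * x)) := by
    ext w
    rw [mem_ofPred_eq, mem_Ioo, ← abs_lt, ← Real.sqrt_sq_eq_abs]
    rw [Real.sqrt_lt_sqrt_iff (by positivity)]
    constructor <;> intro h <;> linarith
  rw [this, Real.volume_Ioo, Real.sqrt_mul (by norm_num)]
  congr 1; ring

lemma int_inv (g : ℝ → ℝ) : ∫ r in Ioi (0:ℝ), g r = ∫ q in Ioi (0:ℝ), kap q * g q⁻¹ := by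
  have himg : (fun r : ℝ => r⁻¹) '' Ioi 0 = Ioi 0 := by
    ext s; constructor
    · rintro ⟨r, hr, rfl⟩; have : 0 < r := hr; exact (by positivity : (0:ℝ) < r⁻¹)
    · intro hs; have : 0 < s := hs; exact ⟨s⁻¹, (by positivity : (0:ℝ) < s⁻¹), by simp⟩
  have := integral_image_eq_integral_abs_deriv_smul (s := Ioi (0:ℝ)) (f := fun r => r⁻¹)
    (f' := fun r => -(r ^ 2)⁻¹) measurableSet_Ioi
    (fun x hx => (hasDerivAt_inv (ne_of_gt hx)).hasDerivWithinAt)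
    (fun a ha b hb hab => inv_injective hab) g
  rw [himg] at this
  rw [this]
  refine setIntegral_congr_fun measurableSet_Ioi fun q hq => ?_
  simp only [kap, smul_eq_mul, abs_neg]
  rw [abs_of_nonneg (by positivity)]

end

noncomputable section
open MeasureTheory Real Filter Set Topology
open scoped ENNReal NNReal

structure ME (f : Phase → ℝ) : Prop where
  m : Measurable f
  nn : ∀ z, 0 ≤ f z
  int : Integrable f
  kin : Integrable (fun z => ‖z.2‖ ^ 2 * f z)
  bd : ∃ M, 0 ≤ M ∧ ∀ᵐ z, f z ≤ M
  sph : SphSym f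

lemma kin_eq (f : Phase → ℝ) : ∫⁻ z : Phase, (‖z.2‖₊ : ℝ≥0∞) ^ 2 * (‖f z‖₊ : ℝ≥0∞) =
    ∫⁻ z : Phase, ‖‖z.2‖ ^ 2 * f z‖ₑ := by
  congr 1; ext z
  rw [enorm_mul, enorm_pow, enorm_norm]; rfl

lemma memErad_iff (f : Phase → ℝ) : memErad f ↔ ME f := by
  constructor
  · rintro ⟨⟨h1, h2, h3⟩, h4⟩
    unfold eNormE at h3
    rw [ENNReal.add_lt_top, ENNReal.add_lt_top] at h3
    obtain ⟨⟨a, b⟩, c⟩ := h3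
    refine ⟨h1, h2, ⟨h1.aestronglyMeasurable, ?_⟩, ⟨?_, ?_⟩, ?_, h4⟩
    · rwa [eLpNorm_one_eq_lintegral_enorm] at a
    · apply Measurable.aestronglyMeasurable; fun_prop
    · rw [kin_eq] at c; exact c
    · refine ⟨(eLpNorm f ⊤ volume).toReal, ENNReal.toReal_nonneg, ?_⟩
      rw [eLpNorm_exponent_top] at b ⊢
      filter_upwards [ae_le_eLpNormEssSup (f := f)] with z hz
      rw [← ENNReal.ofReal_le_iff_le_toReal b.ne]
      refine le_trans ?_ hz
      rw [Real.enorm_of_nonneg (h2 z)]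
  · rintro ⟨h1, h2, h3, h4, ⟨M, hM, h5⟩, h6⟩
    refine ⟨⟨h1, h2, ?_⟩, h6⟩
    unfold eNormE
    rw [ENNReal.add_lt_top, ENNReal.add_lt_top]
    refine ⟨⟨?_, ?_⟩, ?_⟩
    · rw [eLpNorm_one_eq_lintegral_enorm]; exact h3.2
    · refine (eLpNorm_le_of_ae_bound (C := M) ?_).trans_lt ?_
      · filter_upwards [h5] with z hz
        rw [Real.norm_eq_abs, abs_of_nonneg (h2 z)]; exact hz
      · simp
    · rw [kin_eq]; exact h4.2

/-- radial densities -/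
structure RD (ρ : E3 → ℝ) : Prop where
  m : Measurable ρ
  nn : ∀ x, 0 ≤ ρ x
  rad : ∀ x y, ‖x‖ = ‖y‖ → ρ x = ρ y
  int : Integrable ρ
  inv : Integrable (fun y => ρ y * ‖y‖⁻¹)

lemma rho_meas {f : Phase → ℝ} (h : ME f) : Measurable (rhoF f) := by
  have := (h.m.stronglyMeasurable).integral_prod_right' (ν := (volume : Measure E3))
  exact this.measurable

lemma rho_int {f : Phase → ℝ} (h : ME f) : Integrable (rhoF f) :=
  Integrable.integral_prod_left (f := f) (by have := h.int; rwa [Measure.volume_eq_prod] at this)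

lemma rho_rad {f : Phase → ℝ} (h : ME f) (x y : E3) (hxy : ‖x‖ = ‖y‖) : rhoF f x = rhoF f y := by
  obtain ⟨R, hR, hRx⟩ := rot_exists x y hxy
  unfold rhoF
  rw [← R.measurePreserving.integral_comp R.toHomeomorph.measurableEmbedding (fun v => f (y, v))]
  congr 1; ext v
  rw [← hRx]
  exact (h.sph R hR (x, v)).symm

lemma wkin_aux : ∫⁻ z : Phase, (if ‖z.1‖ < 1 ∧ ‖z.2‖ ^ 2 < ‖z.1‖⁻¹ then ENNReal.ofReal ‖z.1‖⁻¹ else 0) < ⊤ := by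
  have hm : Measurable (fun z : Phase => if ‖z.1‖ < 1 ∧ ‖z.2‖ ^ 2 < ‖z.1‖⁻¹ then
      ENNReal.ofReal ‖z.1‖⁻¹ else 0) := by
    have h1 : MeasurableSet {z : Phase | ‖z.1‖ < 1} := measurableSet_lt (by fun_prop) (by fun_prop)
    have h2 : MeasurableSet {z : Phase | ‖z.2‖ ^ 2 < ‖z.1‖⁻¹} :=
      measurableSet_lt (by fun_prop) (by fun_prop)
    exact Measurable.ite (h1.inter h2) (by fun_prop) (by fun_prop)
  rw [Measure.volume_eq_prod, lintegral_prod _ hm.aemeasurable]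
  set V : ℝ≥0∞ := volume (Metric.ball (0:E3) 1) with hV
  have hin : ∀ x : E3, ∫⁻ v : E3, (if ‖x‖ < 1 ∧ ‖v‖ ^ 2 < ‖x‖⁻¹ then ENNReal.ofReal ‖x‖⁻¹ else 0) ≤
      (if ‖x‖ < 1 then ENNReal.ofReal (‖x‖⁻¹ * (√(‖x‖⁻¹)) ^ 3) else 0) * V := by
    intro x
    by_cases hx : ‖x‖ < 1
    swap
    · simp [hx]
    simp only [hx, true_and, if_true]
    have : ∀ v : E3, (if ‖v‖ ^ 2 < ‖x‖⁻¹ then ENNReal.ofReal ‖x‖⁻¹ else 0) ≤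
        indicator (Metric.ball (0:E3) (√(‖x‖⁻¹))) (fun _ => ENNReal.ofReal ‖x‖⁻¹) v := by
      intro v
      split_ifs with hv
      · rw [indicator_of_mem]
        rw [mem_ball_zero_iff]
        exact Real.lt_sqrt_of_sq_lt hv
      · simp
    refine (lintegral_mono this).trans ?_
    rw [lintegral_indicator_const Metric.isOpen_ball.measurableSet,
      Measure.addHaar_ball _ _ (Real.sqrt_nonneg _), ENNReal.ofReal_mul (by positivity)]
    simp only [finrank_euclideanSpace, Fintype.card_fin]
    rw [mul_assoc]
  refine (lintegral_mono hin).trans_lt ?_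
  rw [lintegral_mul_const' _ _ measure_ball_lt_top.ne]
  refine ENNReal.mul_lt_top ?_ measure_ball_lt_top
  rw [sph0 (fun r => if r < 1 then ENNReal.ofReal (r⁻¹ * (√(r⁻¹)) ^ 3) else 0)
    (Measurable.ite measurableSet_Iio (by fun_prop) (by fun_prop))]
  refine ENNReal.mul_lt_top ENNReal.ofReal_lt_top ?_
  have hI : IntegrableOn (fun s : ℝ => s ^ (-(1/2):ℝ)) (Ioo 0 1) := by
    have := intervalIntegral.intervalIntegrable_rpow' (a := 0) (b := 1) (r := (-(1/2):ℝ)) (by norm_num)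
    rw [intervalIntegrable_iff_integrableOn_Ioo_of_le zero_le_one] at this
    exact this
  have h2 := hI.2
  rw [hasFiniteIntegral_iff_enorm] at h2
  refine lt_of_le_of_lt ?_ h2
  rw [← lintegral_indicator measurableSet_Ioi, ← lintegral_indicator measurableSet_Ioo]
  refine lintegral_mono fun s => ?_
  by_cases hs : 0 < s
  swap
  · rw [indicator_of_notMem (show s ∉ Ioi (0:ℝ) from hs)]; positivity
  rw [indicator_of_mem (show s ∈ Ioi (0:ℝ) from hs)]
  by_cases h1 : s < 1
  swap
  · simp [h1]
  rw [indicator_of_mem (show s ∈ Ioo (0:ℝ) 1 from ⟨hs, h1⟩), if_pos h1, ← ENNReal.ofReal_mul (by positivity),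
    Real.enorm_of_nonneg (by positivity)]
  apply ENNReal.ofReal_le_ofReal
  apply le_of_eq
  rw [Real.rpow_neg hs.le, ← Real.sqrt_eq_rpow, Real.sqrt_inv]
  have h3 : 0 < √s := Real.sqrt_pos.2 hs
  have h4 : s = √s ^ 2 := (Real.sq_sqrt hs.le).symm
  field_simp
  exact h4

lemma finv {f : Phase → ℝ} (h : ME f) : Integrable (fun z : Phase => f z * ‖z.1‖⁻¹) := by
  obtain ⟨M, hM, hb⟩ := h.bd
  have hm := h.m
  refine ⟨by apply Measurable.aestronglyMeasurable; fun_prop, ?_⟩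
  rw [hasFiniteIntegral_iff_enorm]
  have hle : ∀ᵐ z : Phase, ‖f z * ‖z.1‖⁻¹‖ₑ ≤ (‖f z‖ₑ + ‖‖z.2‖ ^ 2 * f z‖ₑ) + ENNReal.ofReal M *
      (if ‖z.1‖ < 1 ∧ ‖z.2‖ ^ 2 < ‖z.1‖⁻¹ then ENNReal.ofReal ‖z.1‖⁻¹ else 0) := by
    filter_upwards [hb] with z hz
    have h0 := h.nn z
    rw [Real.enorm_of_nonneg (by positivity), Real.enorm_of_nonneg h0, Real.enorm_of_nonneg (by positivity)]
    by_cases h1 : ‖z.1‖ < 1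
    swap
    · refine le_trans ?_ (le_add_right (le_add_right le_rfl))
      apply ENNReal.ofReal_le_ofReal
      have : ‖z.1‖⁻¹ ≤ 1 := inv_le_one_of_one_le₀ (not_lt.1 h1)
      nlinarith
    by_cases h2 : ‖z.2‖ ^ 2 < ‖z.1‖⁻¹
    · rw [if_pos ⟨h1, h2⟩, ← ENNReal.ofReal_mul hM]
      refine le_trans ?_ le_add_self
      apply ENNReal.ofReal_le_ofReal
      gcongr
    · refine le_trans ?_ (le_add_right le_add_self)
      apply ENNReal.ofReal_le_ofReal
      push Not at h2
      nlinarith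
  refine (lintegral_mono_ae hle).trans_lt ?_
  rw [lintegral_add_left (by fun_prop), lintegral_add_left (by fun_prop),
    lintegral_const_mul' _ _ ENNReal.ofReal_ne_top]
  exact ENNReal.add_lt_top.2 ⟨ENNReal.add_lt_top.2 ⟨h.int.2, h.kin.2⟩,
    ENNReal.mul_lt_top ENNReal.ofReal_lt_top wkin_aux⟩

lemma ME.rd {f : Phase → ℝ} (h : ME f) : RD (rhoF f) := by
  refine ⟨rho_meas h, fun x => integral_nonneg fun v => h.nn _, rho_rad h, rho_int h, ?_⟩
  have := finv h
  rw [Measure.volume_eq_prod] at this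
  refine (Integrable.integral_prod_left this).congr (ae_of_all _ fun x => ?_)
  simp only [integral_mul_const]; rfl

end

noncomputable section
open MeasureTheory Real Filter Set Topology
open scoped ENNReal NNReal

def uP (ρ : E3 → ℝ) (q : ℝ) : ℝ := - ∫ y : E3, ρ y * min q ‖y‖⁻¹ / (4 * π)

lemma inner_w {r s : ℝ} (hr : 0 < r) (hs : 0 < s) :
    ∫⁻ w in Ioo (-s) s, ENNReal.ofReal (√(r ^ 2 - 2 * r * w + s ^ 2))⁻¹ =
      ENNReal.ofReal (2 * s * min r⁻¹ s⁻¹) := by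
  set F : ℝ → ℝ := fun w => √(r ^ 2 - 2 * r * w + s ^ 2) with hF
  have hpos : ∀ w ∈ Ioo (-s) s, 0 < r ^ 2 - 2 * r * w + s ^ 2 := by
    intro w hw
    have h1 : r * w < r * s := by gcongr; exact hw.2
    nlinarith [sq_nonneg (r - s)]
  have hd : ∀ w ∈ Ioo (-s) s, HasDerivWithinAt F (-r / F w) (Ioo (-s) s) w := by
    intro w hw
    have h1 : HasDerivAt (fun w => r ^ 2 - 2 * r * w + s ^ 2) (-(2 * r)) w := by
      have := (((hasDerivAt_id w).const_mul (2 * r)).const_sub (r ^ 2)).add_const (s ^ 2)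
      simpa using this
    have h2 := h1.sqrt (hpos w hw).ne'
    have e : -r / F w = -(2 * r) / (2 * √(r ^ 2 - 2 * r * w + s ^ 2)) := by
      rw [hF]; simp only; rw [← mul_neg, mul_div_mul_left _ _ two_ne_zero]
    rw [e]; exact h2.hasDerivWithinAt
  have hinj : InjOn F (Ioo (-s) s) := by
    intro x hx y hy hxy
    simp only [hF] at hxy
    rw [Real.sqrt_inj (hpos x hx).le (hpos y hy).le] at hxy
    have : r * x = r * y := by linarith
    exact mul_left_cancel₀ hr.ne' this
  have himg : F '' Ioo (-s) s = Ioo |r - s| (r + s) := by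
    ext t; constructor
    · rintro ⟨w, hw, rfl⟩
      have h1 : r * w < r * s := by gcongr; exact hw.2
      have h2 : r * (-s) < r * w := by gcongr; exact hw.1
      constructor
      · rw [← Real.sqrt_sq_eq_abs]
        apply Real.sqrt_lt_sqrt (by positivity); nlinarith
      · simp only [hF]
        rw [Real.sqrt_lt' (by positivity)]; nlinarith
    · rintro ⟨h1, h2⟩
      have h0 : 0 < t := lt_of_le_of_lt (abs_nonneg _) h1
      have h3 : (r - s) ^ 2 < t ^ 2 := by
        rw [← sq_abs]; gcongr
      have h4 : t ^ 2 < (r + s) ^ 2 := by gcongr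
      refine ⟨(r ^ 2 + s ^ 2 - t ^ 2) / (2 * r), ⟨?_, ?_⟩, ?_⟩
      · rw [lt_div_iff₀ (by positivity)]; nlinarith
      · rw [div_lt_iff₀ (by positivity)]; nlinarith
      · simp only [hF]
        rw [show r ^ 2 - 2 * r * ((r ^ 2 + s ^ 2 - t ^ 2) / (2 * r)) + s ^ 2 = t ^ 2 by field_simp; ring]
        exact Real.sqrt_sq h0.le
  have key := lintegral_image_eq_lintegral_abs_deriv_mul measurableSet_Ioo hd hinj (fun _ => 1)
  rw [himg] at key
  simp only [lintegral_const, Measure.restrict_apply MeasurableSet.univ, univ_inter, Real.volume_Ioo,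
    one_mul, mul_one] at key
  have e1 : ∫⁻ w in Ioo (-s) s, ENNReal.ofReal |-r / F w| =
      ENNReal.ofReal r * ∫⁻ w in Ioo (-s) s, ENNReal.ofReal (√(r ^ 2 - 2 * r * w + s ^ 2))⁻¹ := by
    rw [← lintegral_const_mul' _ _ ENNReal.ofReal_ne_top]
    refine lintegral_congr fun w => ?_
    rw [← ENNReal.ofReal_mul hr.le, abs_div, abs_neg, abs_of_pos hr, abs_of_nonneg (Real.sqrt_nonneg _),
      div_eq_mul_inv]
  rw [e1] at key
  have hr0 : ENNReal.ofReal r ≠ 0 := (ENNReal.ofReal_pos.2 hr).ne'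
  have e2 : ENNReal.ofReal (r + s - |r - s|) = ENNReal.ofReal r * ENNReal.ofReal (2 * s * min r⁻¹ s⁻¹) := by
    rw [← ENNReal.ofReal_mul hr.le]
    congr 1
    rcases le_total r s with h | h
    · rw [abs_of_nonpos (by linarith), min_eq_right (by gcongr)]; field_simp; ring
    · rw [abs_of_nonneg (by linarith), min_eq_left (by gcongr)]; field_simp; ring
  rw [e2] at key
  exact ((ENNReal.mul_right_inj hr0 ENNReal.ofReal_ne_top).1 key).symm

lemma RD.newton_lint {ρ : E3 → ℝ} (h : RD ρ) {x : E3} (hx : x ≠ 0) :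
    ∫⁻ y, ENNReal.ofReal (ρ y * ‖x - y‖⁻¹) = ∫⁻ y, ENNReal.ofReal (ρ y * min ‖x‖⁻¹ ‖y‖⁻¹) := by
  have hr : 0 < ‖x‖ := norm_pos_iff.2 hx
  have hm := h.m
  obtain ⟨R, -, hR⟩ := rot_e0 x
  rw [← R.measurePreserving.lintegral_comp (f := fun y => ENNReal.ofReal (ρ y * ‖x - y‖⁻¹)) (by fun_prop)]
  set P : ℝ → ℝ := fun s => ρ (s • e0) with hP
  have hPm : Measurable P := by fun_prop
  have hρ : ∀ y, ρ y = P ‖y‖ := fun y => h.rad _ _ (by simp [norm_smul, norm_e0])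
  have hPn : ∀ s, 0 ≤ P s := fun s => h.nn _
  have e : ∀ y, ENNReal.ofReal (ρ (R y) * ‖x - R y‖⁻¹) =
      ENNReal.ofReal (P ‖y‖) * ENNReal.ofReal (√(‖x‖ ^ 2 - 2 * ‖x‖ * y 0 + ‖y‖ ^ 2))⁻¹ := by
    intro y
    rw [← ENNReal.ofReal_mul (hPn _), hρ, R.norm_map]
    congr 3
    rw [eq_comm]
    have h1 : ‖x - R y‖ = ‖‖x‖ • e0 - y‖ := by
      conv_lhs => rw [← hR, ← map_sub, R.norm_map]
    rw [h1, ← Real.sqrt_sq (norm_nonneg (‖x‖ • e0 - y))]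
    congr 1
    rw [norm_sub_sq_real, inner_smul_left, inner_e0]
    simp [norm_smul, norm_e0]; ring
  simp only [e]
  rw [sph (fun p => ENNReal.ofReal (P p.1) * ENNReal.ofReal (√(‖x‖ ^ 2 - 2 * ‖x‖ * p.2 + p.1 ^ 2))⁻¹)
    (by fun_prop)]
  have e2 : ∀ y, ENNReal.ofReal (ρ y * min ‖x‖⁻¹ ‖y‖⁻¹) = ENNReal.ofReal (P ‖y‖ * min ‖x‖⁻¹ ‖y‖⁻¹) :=
    fun y => by rw [hρ]
  simp only [e2]
  rw [sph0 (fun s => ENNReal.ofReal (P s * min ‖x‖⁻¹ s⁻¹)) (by fun_prop), show 4 * π = (2 * π) * 2 by ring,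
    ENNReal.ofReal_mul (p := 2 * π) (by positivity), mul_assoc,
    ← lintegral_const_mul' (ENNReal.ofReal 2) _ ENNReal.ofReal_ne_top]
  congr 1
  refine setLIntegral_congr_fun measurableSet_Ioi fun s hs => ?_
  have hs' : 0 < s := hs
  have := hPn s
  rw [lintegral_const_mul' _ _ ENNReal.ofReal_ne_top, inner_w hr hs', ← ENNReal.ofReal_mul (hPn s),
    ← ENNReal.ofReal_mul hs'.le, ← ENNReal.ofReal_mul (by positivity), ← ENNReal.ofReal_mul (by positivity)]
  congr 1; ring

section
variable {ρ : E3 → ℝ}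

lemma RD.minint (h : RD ρ) (q : ℝ) : Integrable (fun y => ρ y * min q ‖y‖⁻¹) := by
  have hm := h.m
  refine (h.int.mul_const |q|).mono' (by apply Measurable.aestronglyMeasurable; fun_prop)
    (ae_of_all _ fun y => ?_)
  rw [Real.norm_eq_abs, abs_mul, abs_of_nonneg (h.nn y)]
  refine mul_le_mul_of_nonneg_left ?_ (h.nn y)
  have h2 : 0 ≤ ‖y‖⁻¹ := by positivity
  rcases le_total q ‖y‖⁻¹ with h1 | h1
  · rw [min_eq_left h1]
  · rw [min_eq_right h1, abs_of_nonneg h2]; exact h1.trans (le_abs_self q)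

lemma RD.subint (h : RD ρ) (x : E3) : Integrable (fun y => ρ y * ‖x - y‖⁻¹) := by
  by_cases hx : x = 0
  · subst hx; simpa using h.inv
  have hm := h.m
  refine ⟨by apply Measurable.aestronglyMeasurable; fun_prop, ?_⟩
  have h1 := (h.minint ‖x‖⁻¹).2
  rw [hasFiniteIntegral_iff_ofReal (ae_of_all _ fun y => mul_nonneg (h.nn y) (by positivity))] at h1 ⊢
  rwa [h.newton_lint hx]

def potE (ρ : E3 → ℝ) (x : E3) : ℝ := - ∫ y : E3, ρ y / (4 * π * ‖x - y‖)

lemma potE_eq (ρ : E3 → ℝ) (x : E3) : potE ρ x = -((∫ y, ρ y * ‖x - y‖⁻¹) / (4 * π)) := by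
  unfold potE
  rw [← integral_div]
  congr 2; ext y
  rw [div_mul_eq_div_div_swap, div_eq_mul_inv (ρ y)]

lemma uP_eq (ρ : E3 → ℝ) (q : ℝ) : uP ρ q = -((∫ y, ρ y * min q ‖y‖⁻¹) / (4 * π)) := by
  unfold uP
  rw [← integral_div]

lemma RD.newton (h : RD ρ) {x : E3} (hx : x ≠ 0) : potE ρ x = uP ρ ‖x‖⁻¹ := by
  rw [potE_eq, uP_eq]
  congr 2
  rw [integral_eq_lintegral_of_nonneg_ae (ae_of_all _ fun y => mul_nonneg (h.nn y) (by positivity))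
    (h.subint x).1, integral_eq_lintegral_of_nonneg_ae (ae_of_all _ fun y => mul_nonneg (h.nn y)
    (by positivity)) (h.minint _).1, h.newton_lint hx]

lemma RD.uP_cvx (h : RD ρ) : ConvexOn ℝ univ (uP ρ) := by
  refine ⟨convex_univ, fun a _ b _ s t hs ht hst => ?_⟩
  simp only [uP_eq, smul_eq_mul]
  have hle : s * (∫ y, ρ y * min a ‖y‖⁻¹) + t * (∫ y, ρ y * min b ‖y‖⁻¹) ≤
      ∫ y, ρ y * min (s * a + t * b) ‖y‖⁻¹ := by
    rw [← integral_const_mul, ← integral_const_mul, ← integral_add ((h.minint a).const_mul s)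
      ((h.minint b).const_mul t)]
    refine integral_mono (((h.minint a).const_mul s).add ((h.minint b).const_mul t)) (h.minint _) ?_
    intro y
    simp only
    have h0 := h.nn y
    have : s * min a ‖y‖⁻¹ + t * min b ‖y‖⁻¹ ≤ min (s * a + t * b) ‖y‖⁻¹ := by
      refine le_min ?_ ?_
      · gcongr <;> exact min_le_left _ _
      · have e : ‖y‖⁻¹ = s * ‖y‖⁻¹ + t * ‖y‖⁻¹ := by rw [← add_mul, hst, one_mul]
        conv_rhs => rw [e]
        gcongr <;> exact min_le_right _ _
    nlinarith
  have hp : 0 < 4 * π := by positivity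
  have := div_le_div_of_nonneg_right hle hp.le
  rw [add_div, mul_div_assoc, mul_div_assoc] at this
  linarith

def Cc (ρ : E3 → ℝ) : ℝ := 1 + (∫ y, ρ y) / (4 * π) + (∫ y, ρ y * ‖y‖⁻¹) / (4 * π)

lemma RD.pot (h : RD ρ) (hne : potE ρ ≠ 0) : Pot (Cc ρ) (-uP ρ 1) (uP ρ) := by
  have hp : 0 < 4 * π := by positivity
  have hn1 : 0 ≤ ∫ y, ρ y := integral_nonneg h.nn
  have hn2 : 0 ≤ ∫ y, ρ y * ‖y‖⁻¹ := integral_nonneg fun y => mul_nonneg (h.nn y) (by positivity)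
  have hd1 : 0 ≤ (∫ y, ρ y) / (4 * π) := by positivity
  have hd2 : 0 ≤ (∫ y, ρ y * ‖y‖⁻¹) / (4 * π) := by positivity
  refine ⟨by unfold Cc; linarith, ?_, h.uP_cvx, ?_, ?_, ?_, ?_, ?_, ?_⟩
  · by_contra hcon
    have h0 : ∫ y, ρ y * min 1 ‖y‖⁻¹ = 0 := by
      rw [uP_eq, neg_neg] at hcon
      have h1 : (∫ y, ρ y * min 1 ‖y‖⁻¹) ≤ 0 := by
        by_contra h2
        exact hcon (div_pos (not_le.1 h2) hp)
      exact le_antisymm h1 (integral_nonneg fun y => mul_nonneg (h.nn y) (by positivity))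
    rw [integral_eq_zero_iff_of_nonneg (fun y => mul_nonneg (h.nn y) (by positivity)) (h.minint 1)] at h0
    have hz : ∀ᵐ y : E3, ρ y = 0 := by
      have hae : ∀ᵐ x : E3, x ≠ 0 := by simp [ae_iff]
      filter_upwards [h0, hae] with y hy hy0
      have : 0 < ‖y‖ := norm_pos_iff.2 hy0
      have h3 : 0 < min 1 ‖y‖⁻¹ := by positivity
      simp only [Pi.zero_apply, mul_eq_zero] at hy
      exact hy.resolve_right h3.ne'
    apply hne
    ext x
    unfold potE
    rw [integral_eq_zero_of_ae (by filter_upwards [hz] with y hy; simp [hy])]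
    simp
  · intro a b
    rw [uP_eq, uP_eq]
    have e : -((∫ y, ρ y * min a ‖y‖⁻¹) / (4 * π)) - -((∫ y, ρ y * min b ‖y‖⁻¹) / (4 * π)) =
        -((∫ y, (ρ y * min a ‖y‖⁻¹ - ρ y * min b ‖y‖⁻¹)) / (4 * π)) := by
      rw [integral_sub (h.minint a) (h.minint b)]; ring
    rw [e, abs_neg, abs_div, abs_of_pos hp, div_le_iff₀ hp]
    refine (abs_integral_le_integral_abs).trans ?_
    have : ∫ y, |ρ y * min a ‖y‖⁻¹ - ρ y * min b ‖y‖⁻¹| ≤ ∫ y, ρ y * |a - b| := by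
      refine integral_mono ((h.minint a).sub (h.minint b)).abs (h.int.mul_const _) ?_
      intro y
      simp only
      rw [← mul_sub, abs_mul, abs_of_nonneg (h.nn y)]
      refine mul_le_mul_of_nonneg_left ?_ (h.nn y)
      have := abs_min_sub_min_le_max a ‖y‖⁻¹ b ‖y‖⁻¹
      simpa using this
    refine this.trans ?_
    rw [integral_mul_const]
    have h5 : (∫ y, ρ y) ≤ Cc ρ * (4 * π) := by
      rw [← div_le_iff₀ hp]; unfold Cc; linarith
    have := abs_nonneg (a - b)
    nlinarith
  · rw [uP_eq]
    have : ∀ y : E3, min 0 ‖y‖⁻¹ = 0 := fun y => min_eq_left (by positivity)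
    simp [this]
  · intro q hq
    rw [uP_eq, Left.nonneg_neg_iff]
    refine div_nonpos_of_nonpos_of_nonneg (integral_nonpos fun y => ?_) hp.le
    exact mul_nonpos_of_nonneg_of_nonpos (h.nn y) ((min_le_left _ _).trans hq)
  · intro q hq
    rw [uP_eq, Left.neg_nonpos_iff]
    exact div_nonneg (integral_nonneg fun y => mul_nonneg (h.nn y) (by positivity)) hp.le
  · intro q
    rw [uP_eq]
    have : ∫ y, ρ y * min q ‖y‖⁻¹ ≤ ∫ y, ρ y * ‖y‖⁻¹ :=
      integral_mono (h.minint q) h.inv fun y => mul_le_mul_of_nonneg_left (min_le_right _ _) (h.nn y)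
    have := div_le_div_of_nonneg_right this hp.le
    unfold Cc; linarith
  · intro q hq hq1
    rw [uP_eq, uP_eq, neg_neg]
    have : q * ∫ y, ρ y * min 1 ‖y‖⁻¹ ≤ ∫ y, ρ y * min q ‖y‖⁻¹ := by
      rw [← integral_const_mul]
      refine integral_mono ((h.minint 1).const_mul q) (h.minint q) fun y => ?_
      simp only
      have h0 := h.nn y
      have : q * min 1 ‖y‖⁻¹ ≤ min q ‖y‖⁻¹ := by
        refine le_min ?_ ?_
        · have := min_le_left 1 ‖y‖⁻¹; nlinarith
        · have := min_le_right 1 ‖y‖⁻¹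
          have h6 : 0 ≤ min 1 ‖y‖⁻¹ := by positivity
          nlinarith
      nlinarith
    have := div_le_div_of_nonneg_right this hp.le
    rw [mul_div_assoc] at this
    linarith

end

end

noncomputable section
open MeasureTheory Real Filter Set Topology
open scoped ENNReal NNReal

lemma Pot.weaken {C c C' c' : ℝ} {u : ℝ → ℝ} (h : Pot C c u) (h1 : C ≤ C') (h2 : 0 < c') (h3 : c' ≤ c) :
    Pot C' c' u := by
  refine ⟨by linarith [h.hC], h2, h.cvx, fun a b => (h.lip a b).trans ?_, h.zero, h.negq, h.nonpos,
    fun q => ?_, fun q hq hq1 => ?_⟩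
  · gcongr
  · linarith [h.lb q]
  · have := h.small q hq hq1
    nlinarith

section
variable {ρ σ : E3 → ℝ}

def mP (ρ : E3 → ℝ) (q : ℝ) : ℝ := ∫ y : E3, if q < ‖y‖⁻¹ then ρ y else 0

lemma mset (q : ℝ) : MeasurableSet {y : E3 | q < ‖y‖⁻¹} := measurableSet_lt (by fun_prop) (by fun_prop)

lemma RD.mint (h : RD ρ) (q : ℝ) : Integrable (fun y => if q < ‖y‖⁻¹ then ρ y else 0) := by
  have : (fun y => if q < ‖y‖⁻¹ then ρ y else 0) = indicator {y : E3 | q < ‖y‖⁻¹} ρ := by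
    ext y; simp [indicator]
  rw [this]
  exact h.int.indicator (mset q)

lemma RD.mP_nn (h : RD ρ) (q : ℝ) : 0 ≤ mP ρ q := by
  apply integral_nonneg; intro y; simp only [Pi.zero_apply]; split_ifs
  · exact h.nn y
  · exact le_rfl

lemma RD.uP_deriv (h : RD ρ) {q : ℝ} (hq : 0 < q) : HasDerivAt (uP ρ) (-(mP ρ q / (4 * π))) q := by
  have hm := h.m
  have hnull : ∀ᵐ y : E3, ‖y‖⁻¹ ≠ q := by
    rw [ae_iff]
    refine measure_mono_null ?_ (Measure.addHaar_sphere volume (0:E3) q⁻¹)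
    intro y hy
    simp only [ne_eq, mem_ofPred_eq, not_not] at hy
    simp [← hy]
  have key := hasDerivAt_integral_of_dominated_loc_of_lip (μ := (volume : Measure E3)) (s := univ)
    (F := fun q y => ρ y * min q ‖y‖⁻¹) (F' := fun y => if q < ‖y‖⁻¹ then ρ y else 0) (x₀ := q)
    (bound := ρ) univ_mem
    (Eventually.of_forall fun a => (h.minint a).1) (h.minint q) (h.mint q).1
    (ae_of_all _ fun y => ?_) h.int ?_
  · have e : uP ρ = fun q => -((∫ y, ρ y * min q ‖y‖⁻¹) / (4 * π)) := by ext q; exact uP_eq ρ q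
    rw [e]
    exact (key.2.div_const _).neg
  · apply LipschitzOnWith.of_dist_le_mul
    intro a _ b _
    rw [Real.dist_eq, Real.dist_eq, ← mul_sub, abs_mul, abs_of_nonneg (h.nn y)]
    simp only [Real.coe_nnabs, abs_of_nonneg (h.nn y)]
    refine mul_le_mul_of_nonneg_left ?_ (h.nn y)
    have := abs_min_sub_min_le_max a ‖y‖⁻¹ b ‖y‖⁻¹
    simpa using this
  · filter_upwards [hnull] with y hy
    rcases lt_or_gt_of_ne hy with h1 | h1
    · rw [if_neg (not_lt.2 h1.le)]
      have : (fun q => ρ y * min q ‖y‖⁻¹) =ᶠ[𝓝 q] fun _ => ρ y * ‖y‖⁻¹ := by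
        filter_upwards [lt_mem_nhds h1] with t ht
        rw [min_eq_right ht.le]
      exact (hasDerivAt_const q _).congr_of_eventuallyEq this
    · rw [if_pos h1]
      have : (fun q => ρ y * min q ‖y‖⁻¹) =ᶠ[𝓝 q] fun t => ρ y * t := by
        filter_upwards [gt_mem_nhds h1] with t ht
        rw [min_eq_left ht.le]
      have h2 := (hasDerivAt_id q).const_mul (ρ y)
      rw [mul_one] at h2
      exact h2.congr_of_eventuallyEq this

lemma RD.grad (h : RD ρ) {x : E3} (hx : x ≠ 0) :
    gradient (potE ρ) x = (mP ρ ‖x‖⁻¹ / (4 * π * ‖x‖ ^ 3)) • x := by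
  have hr : 0 < ‖x‖ := norm_pos_iff.2 hx
  have hr2 : 0 < ‖x‖ ^ 2 := by positivity
  have h1 : HasFDerivAt (fun x : E3 => ‖x‖ ^ 2) (2 • innerSL ℝ x) x := (hasStrictFDerivAt_norm_sq x).hasFDerivAt
  have hs : √(‖x‖ ^ 2) = ‖x‖ := Real.sqrt_sq hr.le
  have h2 : HasDerivAt (fun t => (√t)⁻¹) (-(1 / (2 * √(‖x‖ ^ 2))) / √(‖x‖ ^ 2) ^ 2) (‖x‖ ^ 2) :=
    (Real.hasDerivAt_sqrt hr2.ne').inv (by rw [hs]; exact hr.ne')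
  have h3 : HasDerivAt (uP ρ) (-(mP ρ ‖x‖⁻¹ / (4 * π))) (√(‖x‖ ^ 2))⁻¹ := by
    rw [hs]; exact h.uP_deriv (by positivity)
  have h4 := HasDerivAt.comp (‖x‖ ^ 2) h3 h2
  have h5 := h4.comp_hasFDerivAt x h1
  have h6 : potE ρ =ᶠ[𝓝 x] ((uP ρ ∘ fun t => (√t)⁻¹) ∘ fun x : E3 => ‖x‖ ^ 2) := by
    filter_upwards [isOpen_ne.mem_nhds hx] with y hy
    rw [h.newton hy]
    simp [Real.sqrt_sq (norm_nonneg y)]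
  have h7 := h5.congr_of_eventuallyEq h6
  have h8 : HasGradientAt (potE ρ) ((mP ρ ‖x‖⁻¹ / (4 * π * ‖x‖ ^ 3)) • x) x := by
    rw [hasGradientAt_iff_hasFDerivAt]
    refine h7.congr_fderiv ?_
    ext y
    simp only [ContinuousLinearMap.smul_apply, innerSL_apply_apply, map_smul, InnerProductSpace.toDual_apply_apply, smul_eq_mul, hs, nsmul_eq_mul]
    field_simp
    try ring
  exact h8.gradient

end

end

noncomputable section
open MeasureTheory Real Filter Set Topology
open scoped ENNReal NNReal

lemma tail_int {p : ℝ} (hp : 0 < p) :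
    ∫⁻ x : E3, (if ‖x‖⁻¹ < p then ENNReal.ofReal ((16 * π ^ 2 * ‖x‖ ^ 4)⁻¹) else 0) =
      ENNReal.ofReal (p / (4 * π)) := by
  rw [sph0 (fun s => if s⁻¹ < p then ENNReal.ofReal ((16 * π ^ 2 * s ^ 4)⁻¹) else 0)
    (Measurable.ite (measurableSet_lt (by fun_prop) (by fun_prop)) (by fun_prop) (by fun_prop))]
  have e : ∫⁻ s in Ioi (0:ℝ), ENNReal.ofReal (s ^ 2) *
      (if s⁻¹ < p then ENNReal.ofReal ((16 * π ^ 2 * s ^ 4)⁻¹) else 0) =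
      ∫⁻ s in Ioi p⁻¹, ENNReal.ofReal ((16 * π ^ 2)⁻¹ * s ^ (-2:ℝ)) := by
    rw [← lintegral_indicator measurableSet_Ioi, ← lintegral_indicator measurableSet_Ioi]
    refine lintegral_congr fun s => ?_
    by_cases hs : 0 < s
    · rw [indicator_of_mem (show s ∈ Ioi (0:ℝ) from hs)]
      by_cases h1 : s⁻¹ < p
      · rw [indicator_of_mem (show s ∈ Ioi p⁻¹ from inv_lt_of_inv_lt₀ hs h1), if_pos h1,
          ← ENNReal.ofReal_mul (by positivity)]
        congr 1
        rw [Real.rpow_neg hs.le]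
        norm_cast
        field_simp
      · rw [if_neg h1, indicator_of_notMem, mul_zero]
        intro h2
        exact h1 (inv_lt_of_inv_lt₀ hp h2)
    · rw [indicator_of_notMem (show s ∉ Ioi (0:ℝ) from hs), indicator_of_notMem]
      intro h2
      exact hs (lt_trans (inv_pos.2 hp) h2)
  rw [e]
  have hi := (integrableOn_Ioi_rpow_of_lt (a := -2) (by norm_num) (inv_pos.2 hp)).const_mul ((16 * π ^ 2)⁻¹)
  rw [← ofReal_integral_eq_lintegral_ofReal hi, integral_const_mul,
    integral_Ioi_rpow_of_lt (by norm_num) (inv_pos.2 hp), ← ENNReal.ofReal_mul (by positivity)]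
  · congr 1
    norm_num
    rw [Real.rpow_neg_one, inv_inv]
    field_simp
    norm_num
  · refine (ae_restrict_iff' measurableSet_Ioi).2 (ae_of_all _ fun s hs => ?_)
    have : 0 < s := lt_trans (inv_pos.2 hp) hs
    simp only [Pi.zero_apply]; positivity

section
variable {ρ σ : E3 → ℝ}

lemma RD.ofmP (h : RD ρ) (q : ℝ) : ENNReal.ofReal (mP ρ q) =
    ∫⁻ y, if q < ‖y‖⁻¹ then ENNReal.ofReal (ρ y) else 0 := by
  unfold mP
  rw [ofReal_integral_eq_lintegral_ofReal (h.mint q)]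
  · refine lintegral_congr fun y => ?_
    split_ifs <;> simp
  · refine ae_of_all _ fun y => ?_
    simp only [Pi.zero_apply]
    split_ifs
    · exact h.nn y
    · exact le_rfl

def Ik (ρ σ : E3 → ℝ) (x : E3) : ℝ := mP ρ ‖x‖⁻¹ * mP σ ‖x‖⁻¹ / (16 * π ^ 2 * ‖x‖ ^ 4)

lemma RD.uP_of (h : RD ρ) {q : ℝ} (hq : 0 ≤ q) : ENNReal.ofReal (-uP ρ q) =
    ∫⁻ y, ENNReal.ofReal (ρ y) * ENNReal.ofReal (min q ‖y‖⁻¹ / (4 * π)) := by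
  unfold uP
  rw [neg_neg, ofReal_integral_eq_lintegral_ofReal ((h.minint q).div_const _)]
  · refine lintegral_congr fun y => ?_
    rw [← ENNReal.ofReal_mul (h.nn y), mul_div_assoc]
  · exact ae_of_all _ fun y => div_nonneg (mul_nonneg (h.nn y) (by positivity)) (by positivity)

lemma RD.I_lint (h : RD ρ) (h' : RD σ) :
    ∫⁻ x, ENNReal.ofReal (Ik ρ σ x) = ∫⁻ z, ENNReal.ofReal (σ z) * ENNReal.ofReal (-uP ρ ‖z‖⁻¹) := by
  have hm := h.m
  have hm' := h'.m
  have e : ∀ x : E3, ENNReal.ofReal (Ik ρ σ x) = ∫⁻ z, ∫⁻ y, ENNReal.ofReal (σ z) * (ENNReal.ofReal (ρ y) *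
      (if ‖x‖⁻¹ < min ‖z‖⁻¹ ‖y‖⁻¹ then ENNReal.ofReal ((16 * π ^ 2 * ‖x‖ ^ 4)⁻¹) else 0)) := by
    intro x
    unfold Ik
    rw [mul_comm (mP ρ _), div_eq_mul_inv, ENNReal.ofReal_mul (mul_nonneg (h'.mP_nn _) (h.mP_nn _)), ENNReal.ofReal_mul (h'.mP_nn _),
      h.ofmP, h'.ofmP, mul_assoc, ← lintegral_mul_const' _ _ ENNReal.ofReal_ne_top]
    rw [← lintegral_mul_const]
    · refine lintegral_congr fun z => ?_
      rw [← lintegral_const_mul' _ _ (by split_ifs; exacts [ENNReal.ofReal_ne_top, ENNReal.zero_ne_top])]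
      refine lintegral_congr fun y => ?_
      by_cases h1 : ‖x‖⁻¹ < ‖z‖⁻¹ <;> by_cases h2 : ‖x‖⁻¹ < ‖y‖⁻¹ <;> simp [h1, h2]
    · exact Measurable.ite (mset _) (by fun_prop) (by fun_prop)
  have hset : MeasurableSet {p : (E3 × E3) × E3 | ‖p.1.1‖⁻¹ < min ‖p.1.2‖⁻¹ ‖p.2‖⁻¹} :=
    measurableSet_lt (by fun_prop) (by fun_prop)
  have hM : Measurable (fun p : (E3 × E3) × E3 => ENNReal.ofReal (σ p.1.2) * (ENNReal.ofReal (ρ p.2) *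
      (if ‖p.1.1‖⁻¹ < min ‖p.1.2‖⁻¹ ‖p.2‖⁻¹ then ENNReal.ofReal ((16 * π ^ 2 * ‖p.1.1‖ ^ 4)⁻¹) else 0))) := by
    refine Measurable.mul (by fun_prop) (Measurable.mul (by fun_prop) ?_)
    exact Measurable.ite hset (by fun_prop) (by fun_prop)
  simp only [e]
  rw [lintegral_lintegral_swap (by exact (hM.lintegral_prod_right').aemeasurable)]
  have hae : ∀ᵐ x : E3, x ≠ 0 := by simp [ae_iff]
  refine lintegral_congr_ae ?_
  filter_upwards [hae] with z hz
  have hz' : 0 < ‖z‖ := norm_pos_iff.2 hz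
  rw [h.uP_of (by positivity), ← lintegral_const_mul' _ _ ENNReal.ofReal_ne_top]
  rw [lintegral_lintegral_swap]
  swap
  · refine Measurable.aemeasurable ?_
    exact hM.comp (show Measurable (fun p : E3 × E3 => ((p.1, z), p.2)) by fun_prop)
  refine lintegral_congr_ae ?_
  filter_upwards [hae] with y hy
  have hy' : 0 < ‖y‖ := norm_pos_iff.2 hy
  rw [lintegral_const_mul' _ _ ENNReal.ofReal_ne_top, lintegral_const_mul' _ _ ENNReal.ofReal_ne_top,
    tail_int (by positivity)]

lemma mP_meas (h : RD ρ) : Measurable (mP ρ) := by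
  have hm := h.m
  have : Antitone (mP ρ) := by
    intro a b hab
    refine integral_mono (h.mint b) (h.mint a) fun y => ?_
    simp only
    have := h.nn y
    split_ifs with h1 h2
    · exact le_rfl
    · exact absurd (lt_of_le_of_lt hab h1) h2
    · exact this
    · exact le_rfl
  exact this.measurable

lemma Ik_meas (h : RD ρ) (h' : RD σ) : Measurable (Ik ρ σ) := by
  have := mP_meas h
  have := mP_meas h'
  unfold Ik; fun_prop

lemma Ik_nn (h : RD ρ) (h' : RD σ) (x : E3) : 0 ≤ Ik ρ σ x :=
  div_nonneg (mul_nonneg (h.mP_nn _) (h'.mP_nn _)) (by positivity)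

lemma RD.uP_lb (h : RD ρ) (q : ℝ) : -uP ρ q ≤ (∫ y, ρ y * ‖y‖⁻¹) / (4 * π) := by
  rw [uP_eq, neg_neg]
  have : ∫ y, ρ y * min q ‖y‖⁻¹ ≤ ∫ y, ρ y * ‖y‖⁻¹ :=
    integral_mono (h.minint q) h.inv fun y => mul_le_mul_of_nonneg_left (min_le_right _ _) (h.nn y)
  exact div_le_div_of_nonneg_right this (by positivity)

lemma RD.I_int (h : RD ρ) (h' : RD σ) : Integrable (Ik ρ σ) := by
  refine ⟨(Ik_meas h h').aestronglyMeasurable, ?_⟩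
  rw [hasFiniteIntegral_iff_ofReal (ae_of_all _ (Ik_nn h h')), h.I_lint h']
  refine lt_of_le_of_lt (lintegral_mono fun z => mul_le_mul_right (ENNReal.ofReal_le_ofReal (h.uP_lb _)) _) ?_
  rw [lintegral_mul_const' _ _ ENNReal.ofReal_ne_top]
  refine ENNReal.mul_lt_top ?_ ENNReal.ofReal_lt_top
  have := h'.int.2
  rwa [hasFiniteIntegral_iff_ofReal (ae_of_all _ h'.nn)] at this

lemma uP_nonpos (h : RD ρ) {q : ℝ} (hq : 0 ≤ q) : uP ρ q ≤ 0 := by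
  rw [uP_eq, Left.neg_nonpos_iff]
  exact div_nonneg (integral_nonneg fun y => mul_nonneg (h.nn y) (by positivity)) (by positivity)

lemma RD.potE_eq' (h : RD ρ) : potE ρ = fun x => if x = 0 then potE ρ 0 else uP ρ ‖x‖⁻¹ := by
  ext x
  split_ifs with hx
  · rw [hx]
  · exact h.newton hx

lemma RD.potE_nonpos (h : RD ρ) (x : E3) : potE ρ x ≤ 0 := by
  rw [potE_eq, Left.neg_nonpos_iff]
  exact div_nonneg (integral_nonneg fun y => mul_nonneg (h.nn y) (by positivity)) (by positivity)

lemma RD.potE_lb (h : RD ρ) (x : E3) : -potE ρ x ≤ (∫ y, ρ y * ‖y‖⁻¹) / (4 * π) := by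
  by_cases hx : x = 0
  · rw [hx, potE_eq, neg_neg]; simp
  · rw [h.newton hx]; exact h.uP_lb _

lemma RD.potE_meas (h : RD ρ) (hne : potE ρ ≠ 0) : Measurable (potE ρ) := by
  have := (h.pot hne).cont.measurable
  rw [h.potE_eq']
  exact Measurable.ite (measurableSet_eq) (by fun_prop) (by fun_prop)

lemma RD.I_eq (h : RD ρ) (h' : RD σ) (hne : potE ρ ≠ 0) :
    ∫ x, Ik ρ σ x = - ∫ x, potE ρ x * σ x := by
  have hm := h.potE_meas hne
  have hm' := h'.m
  rw [← integral_neg, integral_eq_lintegral_of_nonneg_ae (ae_of_all _ (Ik_nn h h'))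
    (Ik_meas h h').aestronglyMeasurable, integral_eq_lintegral_of_nonneg_ae
    (ae_of_all _ fun x => by
      have := h.potE_nonpos x
      have := h'.nn x
      simp only [Pi.zero_apply]; nlinarith) (by apply Measurable.aestronglyMeasurable; fun_prop), h.I_lint h']
  congr 1
  have hae : ∀ᵐ x : E3, x ≠ 0 := by simp [ae_iff]
  refine lintegral_congr_ae ?_
  filter_upwards [hae] with x hx
  rw [← ENNReal.ofReal_mul (h'.nn x), h.newton hx]
  congr 1; ring

end

end

noncomputable section
open MeasureTheory Real Filter Set Topology
open scoped ENNReal NNReal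

lemma phiF_pot (f : Phase → ℝ) : phiF f = potE (rhoF f) := rfl

section
variable {ρ : E3 → ℝ} {f g k Q : Phase → ℝ}

lemma int_phi_int (h : RD ρ) (hne : potE ρ ≠ 0) (hk : ME k) :
    Integrable (fun z : Phase => potE ρ z.1 * k z) := by
  have hm := h.potE_meas hne
  have hkm := hk.m
  refine (hk.int.const_mul ((∫ y, ρ y * ‖y‖⁻¹) / (4 * π))).mono'
    (by apply Measurable.aestronglyMeasurable; fun_prop) (ae_of_all _ fun z => ?_)
  rw [Real.norm_eq_abs, abs_mul, abs_of_nonpos (h.potE_nonpos _), abs_of_nonneg (hk.nn z)]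
  exact mul_le_mul_of_nonneg_right (h.potE_lb _) (hk.nn z)

lemma int_phi (h : RD ρ) (hne : potE ρ ≠ 0) (hk : ME k) :
    ∫ z : Phase, potE ρ z.1 * k z = ∫ x, potE ρ x * rhoF k x := by
  have h1 := int_phi_int h hne hk
  rw [Measure.volume_eq_prod] at h1 ⊢
  rw [integral_prod _ h1]
  congr 1; ext x
  simp only
  rw [integral_const_mul]; rfl

lemma I_phase (h : RD ρ) (hne : potE ρ ≠ 0) (hk : ME k) :
    ∫ x, Ik ρ (rhoF k) x = - ∫ z : Phase, potE ρ z.1 * k z := by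
  rw [h.I_eq hk.rd hne, int_phi h hne hk]

lemma grad_diff (hf : ME f) (hg : ME g) :
    ∫ x : E3, ‖gradPhi f x - gradPhi g x‖ ^ 2 = (∫ x, Ik (rhoF f) (rhoF f) x) -
      2 * (∫ x, Ik (rhoF f) (rhoF g) x) + ∫ x, Ik (rhoF g) (rhoF g) x := by
  have i1 := hf.rd.I_int hf.rd
  have i2 := hf.rd.I_int hg.rd
  have i3 := hg.rd.I_int hg.rd
  have i4 : Integrable (fun x => Ik (rhoF f) (rhoF f) x - 2 * Ik (rhoF f) (rhoF g) x) := i1.sub (i2.const_mul 2)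
  rw [← integral_const_mul, ← integral_sub i1 (i2.const_mul 2), ← integral_add i4 i3]
  have hae : ∀ᵐ x : E3, x ≠ 0 := by simp [ae_iff]
  refine integral_congr_ae ?_
  filter_upwards [hae] with x hx
  have hr : 0 < ‖x‖ := norm_pos_iff.2 hx
  unfold gradPhi
  rw [phiF_pot, phiF_pot, hf.rd.grad hx, hg.rd.grad hx, ← sub_smul, norm_smul, mul_pow, Real.norm_eq_abs, sq_abs]
  unfold Ik
  field_simp
  ring

lemma grad_sq (hf : ME f) : fieldSq f = ∫ x, Ik (rhoF f) (rhoF f) x := by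
  have hae : ∀ᵐ x : E3, x ≠ 0 := by simp [ae_iff]
  unfold fieldSq
  refine integral_congr_ae ?_
  filter_upwards [hae] with x hx
  have hr : 0 < ‖x‖ := norm_pos_iff.2 hx
  unfold gradPhi
  rw [phiF_pot, hf.rd.grad hx, norm_smul, mul_pow, Real.norm_eq_abs, sq_abs]
  unfold Ik
  field_simp
  ring

lemma microE_int (hg : ME g) (hne : phiF g ≠ 0) (hk : ME k) : Integrable (fun z => microE g z * k z) := by
  have := (hk.kin.div_const 2).add (int_phi_int hg.rd hne hk)
  refine this.congr (ae_of_all _ fun z => ?_)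
  simp only [Pi.add_apply, microE, phiF_pot]; ring

lemma Jred_eq (hg : ME g) (hne : phiF g ≠ 0) (hk : ME (rearr Q g)) :
    Jred Q g = (∫ z, microE g z * rearr Q g z) + (∫ x, Ik (rhoF g) (rhoF g) x) / 2 := by
  unfold Jred Ham
  rw [grad_diff hg hk, grad_sq hk, I_phase hg.rd hne hk]
  have e : ∫ z, microE g z * rearr Q g z =
      kineticE (rearr Q g) / 2 + ∫ z : Phase, potE (rhoF g) z.1 * rearr Q g z := by
    unfold kineticE
    rw [← integral_div, ← integral_add (hk.kin.div_const 2) (int_phi_int hg.rd hne hk)]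
    congr 1; ext z
    simp only [microE, phiF_pot]; ring
  rw [e]; ring

def gl (f g : Phase → ℝ) (μ : ℝ) : Phase → ℝ := fun z => (1 - μ) * f z + μ * g z

lemma gl_ME (hf : ME f) (hg : ME g) {μ : ℝ} (hμ : μ ∈ Icc (0:ℝ) 1) : ME (gl f g μ) := by
  have h0 := hμ.1
  have h1 : 0 ≤ 1 - μ := by linarith [hμ.2]
  have := hf.m
  have := hg.m
  refine ⟨by unfold gl; fun_prop, fun z => ?_, (hf.int.const_mul _).add (hg.int.const_mul _), ?_, ?_, ?_⟩
  · exact add_nonneg (mul_nonneg h1 (hf.nn z)) (mul_nonneg h0 (hg.nn z))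
  · refine ((hf.kin.const_mul (1 - μ)).add (hg.kin.const_mul μ)).congr (ae_of_all _ fun z => ?_)
    simp only [Pi.add_apply, gl]; ring
  · obtain ⟨M, hM, hf1⟩ := hf.bd
    obtain ⟨N, hN, hg1⟩ := hg.bd
    refine ⟨(1 - μ) * M + μ * N, by positivity, ?_⟩
    filter_upwards [hf1, hg1] with z hz1 hz2
    unfold gl; gcongr
  · intro R hR z
    unfold gl
    rw [hf.sph R hR z, hg.sph R hR z]

lemma rho_gl (hf : ME f) (hg : ME g) (μ : ℝ) :
    ∀ᵐ x, rhoF (gl f g μ) x = (1 - μ) * rhoF f x + μ * rhoF g x := by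
  have i1 := hf.int
  have i2 := hg.int
  rw [Measure.volume_eq_prod] at i1 i2
  filter_upwards [i1.prod_right_ae, i2.prod_right_ae] with x h1 h2
  unfold rhoF gl
  rw [integral_add (h1.const_mul _) (h2.const_mul _), integral_const_mul, integral_const_mul]

lemma phi_gl (hf : ME f) (hg : ME g) (μ : ℝ) (x : E3) :
    phiF (gl f g μ) x = (1 - μ) * phiF f x + μ * phiF g x := by
  rw [phiF_pot, phiF_pot, phiF_pot, potE_eq, potE_eq, potE_eq]
  have : ∫ y, rhoF (gl f g μ) y * ‖x - y‖⁻¹ = (1 - μ) * (∫ y, rhoF f y * ‖x - y‖⁻¹) +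
      μ * ∫ y, rhoF g y * ‖x - y‖⁻¹ := by
    rw [← integral_const_mul, ← integral_const_mul, ← integral_add ((hf.rd.subint x).const_mul _)
      ((hg.rd.subint x).const_mul _)]
    refine integral_congr_ae ?_
    filter_upwards [rho_gl hf hg μ] with y hy
    rw [hy]; ring
  rw [this]; ring

lemma uP_gl (hf : ME f) (hg : ME g) (μ : ℝ) :
    uP (rhoF (gl f g μ)) = ul (uP (rhoF f)) (uP (rhoF g)) μ := by
  ext q
  unfold ul
  rw [uP_eq, uP_eq, uP_eq]
  have : ∫ y, rhoF (gl f g μ) y * min q ‖y‖⁻¹ = (1 - μ) * (∫ y, rhoF f y * min q ‖y‖⁻¹) +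
      μ * ∫ y, rhoF g y * min q ‖y‖⁻¹ := by
    rw [← integral_const_mul, ← integral_const_mul, ← integral_add ((hf.rd.minint q).const_mul _)
      ((hg.rd.minint q).const_mul _)]
    refine integral_congr_ae ?_
    filter_upwards [rho_gl hf hg μ] with y hy
    rw [hy]; ring
  rw [this]; ring

lemma mP_gl (hf : ME f) (hg : ME g) (μ q : ℝ) :
    mP (rhoF (gl f g μ)) q = (1 - μ) * mP (rhoF f) q + μ * mP (rhoF g) q := by
  unfold mP
  rw [← integral_const_mul, ← integral_const_mul, ← integral_add ((hf.rd.mint q).const_mul _)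
    ((hg.rd.mint q).const_mul _)]
  refine integral_congr_ae ?_
  filter_upwards [rho_gl hf hg μ] with y hy
  rw [hy]; split_ifs <;> ring

lemma phi_gl_ne (hf : ME f) (hg : ME g) (hf0 : phiF f ≠ 0) (hg0 : phiF g ≠ 0) {μ : ℝ} (hμ : μ ∈ Icc (0:ℝ) 1) :
    phiF (gl f g μ) ≠ 0 := by
  intro h
  rcases eq_or_lt_of_le hμ.2 with h1 | h1
  · apply hg0
    ext x
    have := congrFun h x
    rw [phi_gl hf hg, h1] at this
    simpa using this
  · apply hf0
    ext x
    have := congrFun h x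
    rw [phi_gl hf hg] at this
    have a := hf.rd.potE_nonpos x
    have b := hg.rd.potE_nonpos x
    rw [← phiF_pot] at a b
    simp only [Pi.zero_apply] at this ⊢
    have h0 := hμ.1
    have h2 : 0 < 1 - μ := by linarith
    by_contra hne
    have : phiF f x < 0 := lt_of_le_of_ne a hne
    nlinarith

lemma Ik_gl (hf : ME f) (hg : ME g) (μ : ℝ) :
    ∫ x, Ik (rhoF (gl f g μ)) (rhoF (gl f g μ)) x = (1 - μ) ^ 2 * (∫ x, Ik (rhoF f) (rhoF f) x) +
      2 * μ * (1 - μ) * (∫ x, Ik (rhoF f) (rhoF g) x) + μ ^ 2 * ∫ x, Ik (rhoF g) (rhoF g) x := by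
  have i1 := (hf.rd.I_int hf.rd).const_mul ((1 - μ) ^ 2)
  have i2 := (hf.rd.I_int hg.rd).const_mul (2 * μ * (1 - μ))
  have i3 := (hg.rd.I_int hg.rd).const_mul (μ ^ 2)
  have i4 : Integrable (fun x => (1 - μ) ^ 2 * Ik (rhoF f) (rhoF f) x +
    2 * μ * (1 - μ) * Ik (rhoF f) (rhoF g) x) := i1.add i2
  rw [← integral_const_mul, ← integral_const_mul, ← integral_const_mul, ← integral_add i1 i2,
    ← integral_add i4 i3]
  congr 1; ext x
  unfold Ik
  rw [mP_gl hf hg]; ring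

lemma phiRad_eq (hf : ME f) {r : ℝ} (hr : 0 < r) : phiRad f r = uP (rhoF f) r⁻¹ := by
  unfold phiRad
  have e : ‖r • (EuclideanSpace.single (0 : Fin 3) (1:ℝ))‖ = r := by
    rw [norm_smul]; simp [abs_of_pos hr]
  rw [phiF_pot, hf.rd.newton (by rw [← norm_pos_iff, e]; exact hr), e]

lemma aPot_eq (hf : ME f) (hne : phiF f ≠ 0) {e ℓ : ℝ} (he : e < 0) (hℓ : 0 < ℓ) :
    aPot (phiRad f) e ℓ = 8 * π ^ 2 * √2 * Af ℓ e (uP (rhoF f)) kap := by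
  unfold aPot Af
  congr 1
  rw [int_inv, ← integral_indicator measurableSet_Ioi]
  congr 1; ext q
  by_cases hq : 0 < q
  · rw [indicator_of_mem (show q ∈ Ioi (0:ℝ) from hq)]
    unfold psiPot xF
    rw [phiRad_eq hf (inv_pos.2 hq), inv_inv]
    congr 1
    have : e - (uP (rhoF f) q + ℓ / (2 * q⁻¹ ^ 2)) = e - uP (rhoF f) q - ℓ * q ^ 2 / 2 := by
      field_simp
      ring
    rw [this]
    rcases le_total 0 (e - uP (rhoF f) q - ℓ * q ^ 2 / 2) with h | h
    · rw [max_eq_left h]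
    · rw [max_eq_right h, Real.sqrt_zero, Real.sqrt_eq_zero_of_nonpos h]
  · rw [indicator_of_notMem (show q ∉ Ioi (0:ℝ) from hq)]
    have : xF ℓ e (uP (rhoF f)) q ≤ 0 := by
      by_contra h
      exact hq ((hf.rd.pot hne).xpos hℓ he (not_le.1 h)).1
    rw [Real.sqrt_eq_zero_of_nonpos this, mul_zero]

end

end

noncomputable section
open MeasureTheory Real Filter Set Topology
open scoped ENNReal NNReal

section
variable {Q g : Phase → ℝ}

lemma mu_meas (hQ : Measurable Q) : Measurable (fun p : ℝ × ℝ => muDist Q p.1 p.2) := by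
  have hrad : Measurable (fun p : (ℝ × ℝ) × (ℝ × ℝ) => radPoint p.2.1 p.2.2 p.1.2) := by
    have := sign_meas
    unfold radPoint
    fun_prop
  have hS : MeasurableSet {p : (ℝ × ℝ) × (ℝ × ℝ) | p.1.1 < Q (radPoint p.2.1 p.2.2 p.1.2)} :=
    measurableSet_lt (by fun_prop) (hQ.comp hrad)
  have hN : Measurable (fun p : (ℝ × ℝ) × (ℝ × ℝ) => nuDens p.1.2 p.2) := by
    unfold nuDens
    refine Measurable.ite ?_ (by fun_prop) (by fun_prop)
    have h1 : MeasurableSet {p : (ℝ × ℝ) × (ℝ × ℝ) | 0 < p.2.1} := measurableSet_lt (by fun_prop) (by fun_prop)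
    have h2 : MeasurableSet {p : (ℝ × ℝ) × (ℝ × ℝ) | p.1.2 < p.2.1 ^ 2 * p.2.2 ^ 2} :=
      measurableSet_lt (by fun_prop) (by fun_prop)
    exact h1.inter h2
  have hJ := (hN.indicator hS).lintegral_prod_right' (ν := (volume : Measure (ℝ × ℝ)))
  convert hJ using 1
  ext p
  unfold muDist nuMeas
  have hS' : MeasurableSet {q : ℝ × ℝ | p.1 < Q (radPoint q.1 q.2 p.2)} :=
    measurableSet_lt measurable_const (hQ.comp (radPoint_meas p.2))
  rw [withDensity_apply _ hS', ← lintegral_indicator hS']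
  refine lintegral_congr fun q => ?_
  simp only [indicator, mem_ofPred_eq]

lemma mu_anti {s s' ℓ : ℝ} (h : s ≤ s') : muDist Q s' ℓ ≤ muDist Q s ℓ :=
  measure_mono fun _ hp => lt_of_le_of_lt h hp

lemma mu_rc {s ℓ : ℝ} {c : ℝ≥0∞} (h : c < muDist Q s ℓ) : ∃ s', s < s' ∧ c < muDist Q s' ℓ := by
  by_contra hcon
  push Not at hcon
  have hU : {p : ℝ × ℝ | s < Q (radPoint p.1 p.2 ℓ)} =
      ⋃ n : ℕ, {p : ℝ × ℝ | s + 1 / ((n:ℝ) + 1) < Q (radPoint p.1 p.2 ℓ)} := by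
    ext p
    simp only [mem_iUnion, mem_ofPred_eq]
    constructor
    · intro hp
      obtain ⟨n, hn⟩ := exists_nat_one_div_lt (sub_pos.2 hp)
      exact ⟨n, by linarith⟩
    · rintro ⟨n, hn⟩
      have : 0 < 1 / ((n:ℝ) + 1) := by positivity
      linarith
  have hmono : Monotone fun n : ℕ => {p : ℝ × ℝ | s + 1 / ((n:ℝ) + 1) < Q (radPoint p.1 p.2 ℓ)} := by
    intro a b hab p hp
    have hp' : s + 1 / ((a:ℝ) + 1) < Q (radPoint p.1 p.2 ℓ) := hp
    have : 1 / ((b:ℝ) + 1) ≤ 1 / ((a:ℝ) + 1) := by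
      have : (a:ℝ) ≤ b := by exact_mod_cast hab
      gcongr
    show s + 1 / ((b:ℝ) + 1) < Q (radPoint p.1 p.2 ℓ)
    linarith
  have hle : muDist Q s ℓ ≤ c := by
    unfold muDist
    rw [hU, hmono.measure_iUnion]
    refine iSup_le fun n => hcon _ ?_
    have : 0 < 1 / ((n:ℝ) + 1) := by positivity
    linarith
  exact absurd h (not_lt.2 hle)

lemma mu_top {M s ℓ : ℝ} (hb : ∀ z, Q z ≤ M) (hs : M ≤ s) : muDist Q s ℓ = 0 := by
  unfold muDist
  convert measure_empty (μ := nuMeas ℓ)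
  ext p
  simp only [mem_ofPred_eq, mem_empty_iff_false, iff_false, not_lt]
  exact (hb _).trans hs

lemma schwarz_nn (t ℓ : ℝ) : 0 ≤ schwarz Q t ℓ := by
  unfold schwarz
  split_ifs
  · exact Real.sSup_nonneg fun s hs => hs.1
  · exact le_rfl

lemma schwarz_bdd {M t ℓ : ℝ} (hb : ∀ z, Q z ≤ M) :
    M ∈ upperBounds {s : ℝ | 0 ≤ s ∧ ENNReal.ofReal t < muDist Q s ℓ} := by
  rintro s ⟨-, hs⟩
  by_contra hcon
  rw [mu_top hb (not_le.1 hcon).le] at hs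
  exact not_lt_zero hs

lemma schwarz_lt {M s t ℓ : ℝ} (hb : ∀ z, Q z ≤ M) (hs : 0 ≤ s) :
    s < schwarz Q t ℓ ↔ ENNReal.ofReal t < muDist Q s ℓ := by
  unfold schwarz
  constructor
  · intro h
    split_ifs at h with h1
    · obtain ⟨s', hs', h2⟩ := exists_lt_of_lt_csSup (s := {s : ℝ | 0 ≤ s ∧ ENNReal.ofReal t < muDist Q s ℓ})
        ⟨0, le_rfl, h1⟩ h
      exact lt_of_lt_of_le hs'.2 (mu_anti h2.le)
    · linarith
  · intro h
    rw [if_pos (lt_of_lt_of_le h (mu_anti hs))]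
    obtain ⟨s', h1, h2⟩ := mu_rc h
    exact lt_of_lt_of_le h1 (le_csSup ⟨M, schwarz_bdd hb⟩ ⟨hs.trans h1.le, h2⟩)

lemma schwarz_le {M t ℓ : ℝ} (hb : ∀ z, Q z ≤ M) (hM : 0 ≤ M) : schwarz Q t ℓ ≤ M := by
  by_contra h
  have := (schwarz_lt hb hM).1 (not_le.1 h)
  rw [mu_top hb le_rfl] at this
  exact not_lt_zero this

lemma rearr_nn (z : Phase) : 0 ≤ rearr Q g z := by
  unfold rearr; split_ifs
  · exact schwarz_nn _ _
  · exact le_rfl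

lemma rearr_le {M : ℝ} (hb : ∀ z, Q z ≤ M) (hM : 0 ≤ M) (z : Phase) : rearr Q g z ≤ M := by
  unfold rearr; split_ifs
  · exact schwarz_le hb hM
  · exact hM

lemma rearr_lt {M s : ℝ} (hb : ∀ z, Q z ≤ M) (hs : 0 ≤ s) (z : Phase) : s < rearr Q g z ↔
    microE g z < 0 ∧ ENNReal.ofReal (aPot (phiRad g) (microE g z) (ellOf z)) < muDist Q s (ellOf z) := by
  unfold rearr
  split_ifs with h
  · rw [schwarz_lt hb hs]; simp [h]
  · simp [h, hs]

lemma microE_meas (hg : ME g) (hne : phiF g ≠ 0) : Measurable (microE g) := by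
  have := hg.rd.potE_meas hne
  rw [← phiF_pot] at this
  unfold microE; fun_prop

lemma ellOf_meas : Measurable ellOf := by unfold ellOf; fun_prop

lemma rearr_meas {M : ℝ} (hQ : Measurable Q) (hb : ∀ z, Q z ≤ M) (hg : ME g) (hne : phiF g ≠ 0) :
    Measurable (rearr Q g) := by
  have hphi := hg.rd.potE_meas hne
  rw [← phiF_pot] at hphi
  have hrad : Measurable (phiRad g) := by unfold phiRad; fun_prop
  have hE := microE_meas hg hne
  have hl := ellOf_meas
  have hA : Measurable (fun p : ℝ × ℝ => aPot (phiRad g) p.1 p.2) := by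
    unfold aPot psiPot
    refine Measurable.const_mul ?_ _
    have : Measurable (fun p : (ℝ × ℝ) × ℝ => √(max (p.1.1 - (phiRad g p.2 + p.1.2 / (2 * p.2 ^ 2))) 0)) := by
      fun_prop
    exact (this.stronglyMeasurable.integral_prod_right' (ν := volume.restrict (Ioi (0:ℝ)))).measurable
  have hmu := mu_meas hQ
  refine measurable_of_Ioi fun s => ?_
  have a1 : Measurable (fun z => aPot (phiRad g) (microE g z) (ellOf z)) := by
    clear hmu
    generalize aPot (phiRad g) = A at hA ⊢
    exact hA.comp (hE.prodMk hl)
  have a2 : Measurable (fun z => muDist Q s (ellOf z)) := by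
    generalize muDist Q = A at hmu ⊢
    exact hmu.comp (measurable_const.prodMk hl)
  by_cases hs : 0 ≤ s
  · have e : rearr Q g ⁻¹' Ioi s = {z | microE g z < 0} ∩
        {z | ENNReal.ofReal (aPot (phiRad g) (microE g z) (ellOf z)) < muDist Q s (ellOf z)} := by
      ext z
      exact rearr_lt hb hs z
    rw [e]
    refine (measurableSet_lt hE measurable_const).inter (measurableSet_lt a1.ennreal_ofReal a2)
  · convert MeasurableSet.univ
    ext z
    simp only [mem_preimage, mem_Ioi, mem_univ, iff_true]
    exact lt_of_lt_of_le (not_le.1 hs) (rearr_nn z)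

lemma rearr_sph (hg : ME g) : SphSym (rearr Q g) := by
  intro R hR z
  have h1 : ellOf (R z.1, R z.2) = ellOf z := by
    unfold ellOf; simp [R.inner_map_map]
  have h2 : microE g (R z.1, R z.2) = microE g z := by
    unfold microE
    simp only [R.norm_map]
    congr 1
    rw [phiF_pot]
    by_cases hx : z.1 = 0
    · rw [hx]; simp
    · rw [hg.rd.newton hx, hg.rd.newton (by simpa using hx), R.norm_map]
  unfold rearr
  rw [h1, h2]

lemma ae_mu3 : ∀ᵐ p ∂mu3, 0 < p.1 ∧ 0 < p.2.2 := by
  have e : mu3 = ((volume : Measure ℝ).prod ((volume : Measure ℝ).prod volume)).restrict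
      (Ioi (0:ℝ) ×ˢ (univ ×ˢ Ioi (0:ℝ))) := by
    rw [← Measure.prod_restrict, ← Measure.prod_restrict, Measure.restrict_univ]; rfl
  rw [e]
  filter_upwards [ae_restrict_mem (measurableSet_Ioi.prod (MeasurableSet.univ.prod measurableSet_Ioi))] with p hp
  exact ⟨hp.1, hp.2.2⟩

lemma ae_good : ∀ᵐ z : Phase, 0 < ‖z.1‖ ∧ 0 < ellOf z := by
  have : ∀ᵐ p ∂(Measure.map Pi3 volume), 0 < p.1 ∧ 0 < p.2.2 := by
    rw [Pi3_map]
    exact Measure.ae_smul_measure ae_mu3 _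
  exact ae_of_ae_map Pi3_meas.aemeasurable this

/-- normalized distribution function -/
def Nq (Q : Phase → ℝ) (s ℓ : ℝ) : ℝ := (muDist Q s ℓ).toReal / (8 * π ^ 2 * √2)

structure QD (Q : Phase → ℝ) (M L T : ℝ) : Prop where
  m : Measurable Q
  hM : 0 < M
  hL : 0 < L
  hT : 0 ≤ T
  bd : ∀ z, Q z ≤ M
  zero : ∀ s ℓ, 0 ≤ s → L < ℓ → muDist Q s ℓ = 0
  le : ∀ s ℓ, 0 ≤ s → 0 < ℓ → muDist Q s ℓ ≤ ENNReal.ofReal (8 * π ^ 2 * √2 * T)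

variable {M L T : ℝ}

lemma Nq_nn (s ℓ : ℝ) : 0 ≤ Nq Q s ℓ := by unfold Nq; positivity

lemma QD.Nq_le (h : QD Q M L T) {s ℓ : ℝ} (hs : 0 ≤ s) (hℓ : 0 < ℓ) : Nq Q s ℓ ≤ T := by
  unfold Nq
  rw [div_le_iff₀ (by positivity)]
  have := ENNReal.toReal_mono ENNReal.ofReal_ne_top (h.le s ℓ hs hℓ)
  rw [ENNReal.toReal_ofReal (by have := h.hT; positivity)] at this
  linarith

lemma QD.Nq_zero (h : QD Q M L T) {s ℓ : ℝ} (hs : 0 ≤ s) (hℓ : L < ℓ) : Nq Q s ℓ = 0 := by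
  unfold Nq; rw [h.zero s ℓ hs hℓ]; simp

lemma QD.rearr_iff (h : QD Q M L T) (hg : ME g) (hne : phiF g ≠ 0) {s : ℝ} (hs : 0 ≤ s) {z : Phase}
    (hℓ : 0 < ellOf z) : s < rearr Q g z ↔ microE g z < 0 ∧
      Af (ellOf z) (microE g z) (uP (rhoF g)) kap < Nq Q s (ellOf z) := by
  rw [rearr_lt h.bd hs]
  refine and_congr_right fun he => ?_
  have hfin : muDist Q s (ellOf z) ≠ ⊤ := ne_top_of_le_ne_top ENNReal.ofReal_ne_top (h.le s _ hs hℓ)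
  rw [aPot_eq hg hne he hℓ]
  have hA : 0 ≤ Af (ellOf z) (microE g z) (uP (rhoF g)) kap :=
    integral_nonneg fun q => mul_nonneg (by unfold kap; positivity) (Real.sqrt_nonneg _)
  rw [ENNReal.ofReal_lt_iff_lt_toReal (by positivity) hfin]
  unfold Nq
  rw [lt_div_iff₀ (by positivity), mul_comm]

lemma QD.supp (h : QD Q M L T) {C c δ : ℝ} (hδ0 : 0 < δ)
    (hδ : ∀ u, Pot C c u → ∀ ℓ, 0 < ℓ → ℓ ≤ L → T < Af ℓ (-δ) u kap) (hg : ME g) (hne : phiF g ≠ 0)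
    (hp : Pot C c (uP (rhoF g))) {z : Phase} (hℓ : 0 < ellOf z) (hz : 0 < rearr Q g z) :
    microE g z < -δ := by
  obtain ⟨he, h1⟩ := (h.rearr_iff hg hne le_rfl hℓ).1 hz
  have hA : 0 ≤ Af (ellOf z) (microE g z) (uP (rhoF g)) kap :=
    integral_nonneg fun q => mul_nonneg (by unfold kap; positivity) (Real.sqrt_nonneg _)
  by_cases hL : ellOf z ≤ L
  · by_contra hcon
    have a := hp.Amono hℓ (not_lt.1 hcon) he
    have b := hδ _ hp _ hℓ hL
    have := h.Nq_le le_rfl hℓ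
    linarith
  · rw [h.Nq_zero le_rfl (not_le.1 hL)] at h1; linarith

lemma micro_bd {C c δ : ℝ} (hδ0 : 0 < δ) (hg : ME g)
    (hp : Pot C c (uP (rhoF g))) {z : Phase} (hx : 0 < ‖z.1‖) (hz : microE g z < -δ) :
    ‖z.1‖ < C / δ ∧ ‖z.2‖ ^ 2 < 2 * C ∧ -C ≤ microE g z := by
  unfold microE at hz ⊢
  rw [phiF_pot, hg.rd.newton (norm_pos_iff.1 hx)] at hz ⊢
  have a := hp.lb ‖z.1‖⁻¹
  have b := hp.lbq ‖z.1‖⁻¹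
  rw [abs_of_pos (by positivity)] at b
  have hv : 0 ≤ ‖z.2‖ ^ 2 := by positivity
  refine ⟨?_, by linarith, by linarith⟩
  rw [lt_div_iff₀ hδ0]
  have h1 : δ < C * ‖z.1‖⁻¹ := by linarith
  have h2 : δ * ‖z.1‖ < C * ‖z.1‖⁻¹ * ‖z.1‖ := by gcongr
  rw [mul_assoc, inv_mul_cancel₀ hx.ne', mul_one] at h2
  linarith

def Bx (R V : ℝ) : Set Phase := Metric.closedBall (0:E3) R ×ˢ Metric.closedBall (0:E3) V

lemma Bx_meas (R V : ℝ) : MeasurableSet (Bx R V) :=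
  (Metric.isClosed_closedBall.measurableSet).prod (Metric.isClosed_closedBall.measurableSet)

lemma Bx_int (R V K : ℝ) : Integrable (indicator (Bx R V) (fun _ => K)) := by
  refine (integrable_indicator_iff (Bx_meas R V)).2 (integrableOn_const ?_)
  have : IsCompact (Bx R V) := (isCompact_closedBall _ _).prod (isCompact_closedBall _ _)
  exact this.measure_lt_top.ne

lemma QD.supp_Bx (h : QD Q M L T) {C c δ : ℝ} (hδ0 : 0 < δ)
    (hδ : ∀ u, Pot C c u → ∀ ℓ, 0 < ℓ → ℓ ≤ L → T < Af ℓ (-δ) u kap) (hg : ME g) (hne : phiF g ≠ 0)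
    (hp : Pot C c (uP (rhoF g))) : ∀ᵐ z, 0 < rearr Q g z → z ∈ Bx (C / δ) (√(2 * C)) := by
  filter_upwards [ae_good] with z hz h0
  obtain ⟨a, b, -⟩ := micro_bd hδ0 hg hp hz.1 (h.supp hδ0 hδ hg hne hp hz.2 h0)
  refine ⟨by simpa using a.le, ?_⟩
  rw [mem_closedBall_zero_iff]
  exact Real.le_sqrt_of_sq_le b.le

lemma QD.rearr_ME (h : QD Q M L T) (hg : ME g) (hne : phiF g ≠ 0) : ME (rearr Q g) := by
  have hp := hg.rd.pot hne
  obtain ⟨δ, hδ0, hδ⟩ := Alarge (C := Cc (rhoF g)) hp.hc h.hT h.hL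
  have hs := h.supp_Bx hδ0 hδ hg hne hp
  have hm := rearr_meas h.m h.bd hg hne
  have hM := h.hM
  have hC := hp.hC
  refine ⟨hm, rearr_nn, ?_, ?_, ⟨M, hM.le, ae_of_all _ (rearr_le h.bd hM.le)⟩, rearr_sph hg⟩
  · refine (Bx_int (Cc (rhoF g) / δ) (√(2 * Cc (rhoF g))) M).mono' hm.aestronglyMeasurable ?_
    filter_upwards [hs] with z hz
    rw [Real.norm_eq_abs, abs_of_nonneg (rearr_nn z)]
    rcases (rearr_nn (Q := Q) (g := g) z).eq_or_lt with h0 | h0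
    · rw [← h0]; exact indicator_nonneg (fun _ _ => hM.le) _
    · rw [indicator_of_mem (hz h0)]; exact rearr_le h.bd hM.le z
  · refine (Bx_int (Cc (rhoF g) / δ) (√(2 * Cc (rhoF g))) (2 * Cc (rhoF g) * M)).mono'
      (by apply Measurable.aestronglyMeasurable; fun_prop) ?_
    filter_upwards [hs] with z hz
    rw [Real.norm_eq_abs, abs_of_nonneg (mul_nonneg (by positivity) (rearr_nn z))]
    rcases (rearr_nn (Q := Q) (g := g) z).eq_or_lt with h0 | h0
    · rw [← h0, mul_zero]; exact indicator_nonneg (fun _ _ => by positivity) _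
    · rw [indicator_of_mem (hz h0)]
      have h1 := (hz h0).2
      rw [mem_closedBall_zero_iff] at h1
      have h2 : ‖z.2‖ ^ 2 ≤ 2 * Cc (rhoF g) := by
        rw [← Real.sq_sqrt (by positivity : 0 ≤ 2 * Cc (rhoF g))]; gcongr
      have := rearr_le (g := g) h.bd hM.le z
      have := rearr_nn (Q := Q) (g := g) z
      gcongr
end

end

noncomputable section
open MeasureTheory Real Filter Set Topology
open scoped ENNReal NNReal

def sM (M : ℝ) : Measure ℝ := volume.restrict (Ioo 0 M)
def kM (M : ℝ) : Measure (ℝ × ℝ) := (volume.restrict (Ioi (0:ℝ))).prod (sM M)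
def tau : Measure (ℝ × ℝ) := (volume.restrict (Ioi (0:ℝ))).prod volume

instance (M : ℝ) : IsFiniteMeasure (sM M) := by
  unfold sM
  exact ⟨by rw [Measure.restrict_apply MeasurableSet.univ, univ_inter]; exact measure_Ioo_lt_top⟩
instance (M : ℝ) : SFinite (kM M) := by unfold kM; infer_instance
instance : SFinite tau := by unfold tau; infer_instance
instance : SFinite mu3 := by unfold mu3; infer_instance

def P4 (q : Phase × ℝ) : (ℝ × ℝ) × (ℝ × ℝ) := ((ellOf q.1, q.2), (‖q.1.1‖, inner ℝ q.1.1 q.1.2 / ‖q.1.1‖))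

lemma P4_meas : Measurable P4 := by unfold P4 ellOf; fun_prop

def th4 (p : (ℝ × ℝ × ℝ) × ℝ) : (ℝ × ℝ) × (ℝ × ℝ) := ((p.1.2.2, p.2), (p.1.1, p.1.2.1))

lemma th4_mp (M : ℝ) : MeasurePreserving th4 (mu3.prod (sM M)) ((kM M).prod tau) := by
  have h1 : MeasurePreserving (MeasurableEquiv.prodAssoc (α := ℝ) (β := ℝ) (γ := ℝ)).symm mu3
      (tau.prod (volume.restrict (Ioi (0:ℝ)))) :=
    (measurePreserving_prodAssoc (volume.restrict (Ioi (0:ℝ))) (volume : Measure ℝ)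
      (volume.restrict (Ioi (0:ℝ)))).symm
  have h2 := h1.prod (MeasurePreserving.id (sM M))
  have h3 := measurePreserving_prodAssoc tau (volume.restrict (Ioi (0:ℝ))) (sM M)
  have h4 := Measure.measurePreserving_swap (μ := tau) (ν := kM M)
  exact (h4.comp h3).comp h2

lemma P4_map (M : ℝ) : Measure.map P4 ((volume : Measure Phase).prod (sM M)) =
    ENNReal.ofReal (4 * π ^ 2) • ((kM M).prod tau) := by
  have e : P4 = th4 ∘ Prod.map Pi3 id := rfl
  have ht : Measurable th4 := (th4_mp M).measurable
  rw [e, ← Measure.map_map ht (Pi3_meas.prodMap measurable_id),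
    ← Measure.map_prod_map _ _ Pi3_meas measurable_id, Pi3_map, Measure.map_id,
    Measure.prod_smul_left, Measure.map_smul, (th4_mp M).map_eq]

lemma layer {M : ℝ} {k : Phase → ℝ} (hk : Measurable k) (hk0 : ∀ z, 0 ≤ k z) (hkM : ∀ z, k z ≤ M)
    {A : Set ((ℝ × ℝ) × (ℝ × ℝ))} (hA : MeasurableSet A)
    (hAk : ∀ᵐ z, ∀ s, 0 < s → (P4 (z, s) ∈ A ↔ s < k z)) {b : ℝ × ℝ × ℝ → ℝ} (hb : Measurable b)
    (hint : Integrable (fun z => b (Pi3 z) * k z)) :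
    Integrable (A.indicator (fun p => b (p.2.1, p.2.2, p.1.1))) ((kM M).prod tau) ∧
    ∫ z, b (Pi3 z) * k z =
      4 * π ^ 2 * ∫ y, (∫ x, A.indicator (fun p => b (p.2.1, p.2.2, p.1.1)) (y, x) ∂tau) ∂(kM M) := by
  set H : (ℝ × ℝ) × (ℝ × ℝ) → ℝ := A.indicator (fun p => b (p.2.1, p.2.2, p.1.1)) with hH
  have hHm : Measurable H := by
    refine Measurable.indicator ?_ hA
    fun_prop
  have hsec : ∀ᵐ z, (fun s => H (P4 (z, s))) =ᵐ[sM M] (Iio (k z)).indicator (fun _ => b (Pi3 z)) := by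
    filter_upwards [hAk] with z hz
    unfold sM
    filter_upwards [ae_restrict_mem measurableSet_Ioo] with s hs
    by_cases h : s < k z
    · rw [indicator_of_mem (show s ∈ Iio (k z) from h), hH, indicator_of_mem ((hz s hs.1).2 h)]; rfl
    · rw [indicator_of_notMem (show s ∉ Iio (k z) from h), hH,
        indicator_of_notMem (fun h' => h ((hz s hs.1).1 h'))]
  have hreal : ∀ z, (sM M).real (Iio (k z)) = k z := by
    intro z
    unfold sM
    rw [measureReal_def, Measure.restrict_apply measurableSet_Iio]
    have : Iio (k z) ∩ Ioo 0 M = Ioo 0 (k z) := by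
      ext s; simp only [mem_inter_iff, mem_Iio, mem_Ioo]
      constructor
      · rintro ⟨a, b, -⟩; exact ⟨b, a⟩
      · rintro ⟨a, b⟩; exact ⟨b, a, b.trans_le (hkM z)⟩
    rw [this, Real.volume_Ioo, sub_zero, ENNReal.toReal_ofReal (hk0 z)]
  have I0 : Integrable (fun q => H (P4 q)) ((volume : Measure Phase).prod (sM M)) := by
    have hc : Measurable (fun q => H (P4 q)) := hHm.comp P4_meas
    rw [integrable_prod_iff hc.aestronglyMeasurable]
    constructor
    · filter_upwards [hsec] with z hz
      refine Integrable.congr ?_ hz.symm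
      exact (integrable_const _).indicator measurableSet_Iio
    · refine hint.norm.congr ?_
      filter_upwards [hsec] with z hz
      have e : (fun s => ‖H (P4 (z, s))‖) =ᵐ[sM M] (Iio (k z)).indicator (fun _ => ‖b (Pi3 z)‖) := by
        filter_upwards [hz] with s hs
        rw [hs, norm_indicator_eq_indicator_norm]
      rw [integral_congr_ae e, integral_indicator_const _ measurableSet_Iio, hreal, norm_mul, smul_eq_mul,
        Real.norm_of_nonneg (hk0 z), mul_comm]
  have hpos : ENNReal.ofReal (4 * π ^ 2) ≠ 0 := (ENNReal.ofReal_pos.2 (by positivity)).ne'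
  have I1 : Integrable H ((kM M).prod tau) := by
    have := (integrable_map_measure (μ := (volume : Measure Phase).prod (sM M)) (f := P4) (g := H)
      hHm.aestronglyMeasurable P4_meas.aemeasurable).2 I0
    rw [P4_map, integrable_smul_measure hpos ENNReal.ofReal_ne_top] at this
    exact this
  refine ⟨I1, ?_⟩
  have e1 : ∫ z, b (Pi3 z) * k z = ∫ q, H (P4 q) ∂((volume : Measure Phase).prod (sM M)) := by
    rw [integral_prod _ I0]
    refine integral_congr_ae ?_
    filter_upwards [hsec] with z hz
    rw [integral_congr_ae hz, integral_indicator_const _ measurableSet_Iio, hreal, smul_eq_mul, mul_comm]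
  rw [e1, ← integral_prod _ I1, ← integral_map (φ := P4) P4_meas.aemeasurable hHm.aestronglyMeasurable, P4_map,
    integral_smul_measure, ENNReal.toReal_ofReal (by positivity), smul_eq_mul]

/-- energy in reduced variables -/
def en (u : ℝ → ℝ) (p : ℝ × ℝ × ℝ) : ℝ := p.2.1 ^ 2 / 2 + u p.1⁻¹ + p.2.2 / (2 * p.1 ^ 2)

lemma micro_en {g : Phase → ℝ} (hg : ME g) {z : Phase} (hz : 0 < ‖z.1‖) :
    microE g z = en (uP (rhoF g)) (Pi3 z) := by
  unfold microE en Pi3 ellOf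
  rw [phiF_pot, hg.rd.newton (norm_pos_iff.1 hz)]
  simp only
  field_simp
  ring

def ASet (Q : Phase → ℝ) (u : ℝ → ℝ) : Set ((ℝ × ℝ) × (ℝ × ℝ)) :=
  {p | en u (p.2.1, p.2.2, p.1.1) < 0 ∧ Af p.1.1 (en u (p.2.1, p.2.2, p.1.1)) u kap < Nq Q p.1.2 p.1.1}

lemma en_meas {u : ℝ → ℝ} (hu : Measurable u) : Measurable (en u) := by unfold en; fun_prop

lemma Nq_meas {Q : Phase → ℝ} (hQ : Measurable Q) : Measurable (fun p : ℝ × ℝ => Nq Q p.1 p.2) := by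
  have := (mu_meas hQ).ennreal_toReal
  unfold Nq; exact this.div_const _

lemma ASet_meas {Q : Phase → ℝ} (hQ : Measurable Q) {u : ℝ → ℝ} (hu : Measurable u) :
    MeasurableSet (ASet Q u) := by
  have he : Measurable (fun p : (ℝ × ℝ) × (ℝ × ℝ) => en u (p.2.1, p.2.2, p.1.1)) :=
    (en_meas hu).comp (by fun_prop)
  have hA : Measurable (fun p : ℝ × ℝ => Af p.1 p.2 u kap) := by
    unfold Af
    have : Measurable (fun p : (ℝ × ℝ) × ℝ => kap p.2 * √(xF p.1.1 p.1.2 u p.2)) := by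
      unfold kap xF; fun_prop
    exact (this.stronglyMeasurable.integral_prod_right' (ν := volume)).measurable
  have hN := Nq_meas hQ
  have a1 : Measurable (fun p : (ℝ × ℝ) × (ℝ × ℝ) => Af p.1.1 (en u (p.2.1, p.2.2, p.1.1)) u kap) := by
    clear hN
    generalize (fun a b => Af a b u kap) = X at hA
    exact hA.comp ((measurable_fst.comp measurable_fst).prodMk he)
  have a2 : Measurable (fun p : (ℝ × ℝ) × (ℝ × ℝ) => Nq Q p.1.2 p.1.1) := by
    generalize Nq Q = X at hN ⊢
    exact hN.comp (show Measurable (fun p : (ℝ × ℝ) × (ℝ × ℝ) => (p.1.2, p.1.1)) by fun_prop)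
  exact (measurableSet_lt he measurable_const).inter (measurableSet_lt a1 a2)

lemma ASet_iff {Q g : Phase → ℝ} {M L T : ℝ} (h : QD Q M L T) (hg : ME g) (hne : phiF g ≠ 0) :
    ∀ᵐ z, ∀ s, 0 < s → (P4 (z, s) ∈ ASet Q (uP (rhoF g)) ↔ s < rearr Q g z) := by
  filter_upwards [ae_good] with z hz s hs
  rw [h.rearr_iff hg hne hs.le hz.2, micro_en hg hz.1]
  rfl

lemma layerQ {Q g : Phase → ℝ} {M L T : ℝ} (h : QD Q M L T) (hg : ME g) (hne : phiF g ≠ 0)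
    {b : ℝ × ℝ × ℝ → ℝ} (hb : Measurable b) (hint : Integrable (fun z => b (Pi3 z) * rearr Q g z)) :
    Integrable ((ASet Q (uP (rhoF g))).indicator (fun p => b (p.2.1, p.2.2, p.1.1))) ((kM M).prod tau) ∧
    ∫ z, b (Pi3 z) * rearr Q g z = 4 * π ^ 2 * ∫ y, (∫ x, (ASet Q (uP (rhoF g))).indicator
      (fun p => b (p.2.1, p.2.2, p.1.1)) (y, x) ∂tau) ∂(kM M) :=
  layer (rearr_meas h.m h.bd hg hne) rearr_nn (rearr_le h.bd h.hM.le)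
    (ASet_meas h.m (hg.rd.pot hne).cont.measurable) (ASet_iff h hg hne) hb hint

end

noncomputable section
open MeasureTheory Real Filter Set Topology
open scoped ENNReal NNReal

/-- energy well in `(r, w)` -/
def Wl (u : ℝ → ℝ) (ℓ E : ℝ) : Set (ℝ × ℝ) := {x | en u (x.1, x.2, ℓ) < E}

lemma Wl_meas {u : ℝ → ℝ} (hu : Measurable u) (ℓ E : ℝ) : MeasurableSet (Wl u ℓ E) :=
  measurableSet_lt ((en_meas hu).comp (by fun_prop)) measurable_const

lemma Wl_box {C c : ℝ} {u : ℝ → ℝ} (h : Pot C c u) {ℓ E : ℝ} (hℓ : 0 < ℓ) (hE : E < 0) :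
    Wl u ℓ E ∩ (Ioi 0 ×ˢ univ) ⊆ Ioc 0 (C / -E) ×ˢ Icc (-√(2 * C)) (√(2 * C)) := by
  rintro ⟨r, w⟩ ⟨hx, hr, -⟩
  have hr : 0 < r := hr
  have hx : w ^ 2 / 2 + u r⁻¹ + ℓ / (2 * r ^ 2) < E := hx
  have h1 : 0 < ℓ / (2 * r ^ 2) := by positivity
  have h2 := h.lbq r⁻¹
  have h3 := h.lb r⁻¹
  rw [abs_of_pos (by positivity)] at h2
  have h4 := sq_nonneg w
  refine ⟨⟨hr, ?_⟩, ?_⟩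
  · rw [le_div_iff₀ (by linarith)]
    have : -E ≤ C * r⁻¹ := by linarith
    rwa [← div_eq_mul_inv, le_div_iff₀ hr, mul_comm] at this
  · rw [mem_Icc, ← abs_le]
    exact Real.abs_le_sqrt (by linarith)

lemma tau_inter (S : Set (ℝ × ℝ)) (hS : MeasurableSet S) : tau (S ∩ (Ioi 0 ×ˢ univ)) = tau S := by
  have : tau = tau.restrict (Ioi 0 ×ˢ univ) := by
    unfold tau
    rw [← Measure.prod_restrict, Measure.restrict_univ, Measure.restrict_restrict measurableSet_Ioi, inter_self]
  conv_rhs => rw [this]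
  rw [Measure.restrict_apply hS]

lemma tau_Wl {C c : ℝ} {u : ℝ → ℝ} (h : Pot C c u) {ℓ E : ℝ} (hℓ : 0 < ℓ) (hE : E < 0) :
    tau (Wl u ℓ E) ≤ ENNReal.ofReal (C / -E * (2 * √(2 * C))) := by
  rw [← tau_inter _ (Wl_meas h.cont.measurable _ _)]
  refine (measure_mono (Wl_box h hℓ hE)).trans ?_
  unfold tau
  have hC := h.hC
  rw [Measure.prod_prod, Real.volume_Icc, ENNReal.ofReal_mul (div_nonneg hC.le (by linarith))]
  refine mul_le_mul' ((Measure.restrict_apply_le _ _).trans ?_) (ENNReal.ofReal_le_ofReal (by linarith))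
  rw [Real.volume_Ioc, sub_zero]

lemma tau_int {C c K : ℝ} {u k : ℝ → ℝ} (h : Pot C c u) (hkm : Measurable k)
    (hk : ∀ q, 0 < q → |k q| ≤ K) {ℓ E : ℝ} (hℓ : 0 < ℓ) (hE : E < 0) :
    Integrable ((Wl u ℓ E).indicator (fun x => k x.1⁻¹)) tau ∧
    ∫ x, (Wl u ℓ E).indicator (fun x => k x.1⁻¹) x ∂tau =
      2 * √2 * Af ℓ E u (fun q => k q * kap q) := by
  have hW := Wl_meas h.cont.measurable ℓ E
  have hI : Integrable ((Wl u ℓ E).indicator (fun x => k x.1⁻¹)) tau := by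
    rw [integrable_indicator_iff hW]
    refine IntegrableOn.of_bound ((tau_Wl h hℓ hE).trans_lt ENNReal.ofReal_lt_top)
      (hkm.comp (by fun_prop : Measurable fun x : ℝ × ℝ => x.1⁻¹)).aestronglyMeasurable K ?_
    refine ae_restrict_of_ae ?_
    have : ∀ᵐ x ∂tau, 0 < x.1 := by
      unfold tau
      exact (Measure.quasiMeasurePreserving_fst (μ := volume.restrict (Ioi (0:ℝ)))
        (ν := (volume : Measure ℝ))).ae (ae_restrict_mem measurableSet_Ioi)
    filter_upwards [this] with x hx
    exact hk _ (by positivity)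
  refine ⟨hI, ?_⟩
  unfold tau at hI ⊢
  rw [integral_prod _ hI]
  have e1 : ∀ r ∈ Ioi (0:ℝ), (∫ w, (Wl u ℓ E).indicator (fun x => k x.1⁻¹) (r, w)) =
      k r⁻¹ * (2 * √2 * √(xF ℓ E u r⁻¹)) := by
    intro r hr
    have hr : 0 < r := hr
    have e2 : (fun w => (Wl u ℓ E).indicator (fun x => k x.1⁻¹) (r, w)) =
        {w | w ^ 2 / 2 < xF ℓ E u r⁻¹}.indicator (fun _ => k r⁻¹) := by
      ext w
      have : (r, w) ∈ Wl u ℓ E ↔ w ∈ {w | w ^ 2 / 2 < xF ℓ E u r⁻¹} := by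
        have : ℓ / (2 * r ^ 2) = ℓ * r⁻¹ ^ 2 / 2 := by field_simp
        simp only [Wl, en, xF, mem_ofPred_eq, this]
        constructor <;> intro h <;> linarith
      by_cases hm : (r, w) ∈ Wl u ℓ E
      · rw [indicator_of_mem hm, indicator_of_mem (this.1 hm)]
      · rw [indicator_of_notMem hm, indicator_of_notMem (fun h' => hm (this.2 h'))]
    rw [e2, integral_indicator_const _ (measurableSet_lt (by fun_prop) measurable_const), measureReal_def,
      vol_w, ENNReal.toReal_ofReal (by positivity), smul_eq_mul, mul_comm]
  rw [setIntegral_congr_fun measurableSet_Ioi e1, int_inv, Af, ← integral_const_mul,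
    ← integral_indicator measurableSet_Ioi]
  congr 1; ext q
  by_cases hq : 0 < q
  · rw [indicator_of_mem (show q ∈ Ioi (0:ℝ) from hq), inv_inv]; ring
  · rw [indicator_of_notMem (show q ∉ Ioi (0:ℝ) from hq)]
    have : xF ℓ E u q ≤ 0 := by
      by_contra hc
      exact hq (h.xpos hℓ hE (not_le.1 hc)).1
    rw [Real.sqrt_eq_zero_of_nonpos this]; ring

lemma tau_Wl_eq {C c : ℝ} {u : ℝ → ℝ} (h : Pot C c u) {ℓ E : ℝ} (hℓ : 0 < ℓ) (hE : E < 0) :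
    (tau (Wl u ℓ E)).toReal = 2 * √2 * Af ℓ E u kap := by
  have := (tau_int (k := fun _ => 1) (K := 1) h measurable_const (by simp) hℓ hE).2
  rw [integral_indicator_const _ (Wl_meas h.cont.measurable _ _)] at this
  simpa [measureReal_def] using this

lemma AssumptionA.me {Q F e₀} (hQ : AssumptionA Q F e₀) : ME Q := by
  refine ⟨hQ.contQ.measurable, hQ.nonneg, hQ.contQ.integrable_of_hasCompactSupport hQ.cpt, ?_, ?_, hQ.sph⟩
  · exact (show Continuous (fun z : Phase => ‖z.2‖ ^ 2 * Q z) by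
      have := hQ.contQ; fun_prop).integrable_of_hasCompactSupport hQ.cpt.mul_left
  · obtain ⟨M, hM⟩ := hQ.cpt.exists_bound_of_continuous hQ.contQ
    exact ⟨M, (norm_nonneg _).trans (hM 0), ae_of_all _ fun z => (le_abs_self _).trans (hM z)⟩

lemma AssumptionA.phi_ne {Q F e₀} (hQ : AssumptionA Q F e₀) : phiF Q ≠ 0 := by
  intro h0
  have h := hQ.me
  have h1 : potE (rhoF Q) 0 = 0 := by rw [← phiF_pot, h0]; rfl
  rw [potE_eq] at h1
  have h2 : ∫ y, rhoF Q y * ‖y‖⁻¹ = 0 := by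
    have : (∫ y, rhoF Q y * ‖(0:E3) - y‖⁻¹) = 0 := by
      have hp := Real.pi_pos
      have h3 := neg_eq_zero.1 h1
      rcases div_eq_zero_iff.1 h3 with h | h
      · exact h
      · linarith
    simpa using this
  rw [integral_eq_zero_iff_of_nonneg (fun y => mul_nonneg (h.rd.nn y) (by positivity)) h.rd.inv] at h2
  have h3 : ∫ y, rhoF Q y = 0 := by
    refine integral_eq_zero_of_ae ?_
    have : ∀ᵐ y : E3, y ≠ 0 := by simp [ae_iff]
    filter_upwards [h2, this] with y hy hy0
    exact (mul_eq_zero.1 hy).resolve_right (by simpa using hy0)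
  have h4 : ∫ z, Q z = 0 := by
    rw [← h3, Measure.volume_eq_prod, integral_prod _ (by rw [← Measure.volume_eq_prod]; exact h.int)]; rfl
  rw [integral_eq_zero_iff_of_nonneg h.nn h.int] at h4
  exact hQ.nonzero ((hQ.contQ.ae_eq_iff_eq volume continuous_zero).1 h4)

lemma AssumptionA.Fc {Q F e₀} (hQ : AssumptionA Q F e₀) {ℓ : ℝ} (hℓ : 0 ≤ ℓ) :
    Continuous (fun e => F e ℓ) :=
  hQ.Fcont.comp_continuous (f := fun e : ℝ => (e, ℓ)) (by fun_prop) (fun _ => hℓ)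

lemma AssumptionA.Fanti {Q F e₀} (hQ : AssumptionA Q F e₀) {ℓ : ℝ} (hℓ : 0 ≤ ℓ) :
    Antitone (fun e => F e ℓ) := by
  intro a b hab
  by_contra hc
  have hc : F a ℓ < F b ℓ := not_le.1 hc
  obtain ⟨x, hx, hmax⟩ := isCompact_Icc.exists_isMaxOn (nonempty_Icc.2 hab) (hQ.Fc hℓ).continuousOn
  have hb : F b ℓ ≤ F x ℓ := hmax (right_mem_Icc.2 hab)
  have h0 : 0 < F x ℓ := lt_of_le_of_lt (hQ.Fnonneg a ℓ hℓ) (hc.trans_le hb)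
  have hd := hQ.FeNeg x ℓ hℓ h0
  have hax : a < x := lt_of_le_of_ne hx.1 (fun e => by rw [e] at hc; linarith)
  have hD : HasDerivAt (fun e => F e ℓ) (deriv (fun e => F e ℓ) x) x :=
    (differentiableAt_of_deriv_ne_zero hd.ne).hasDerivAt
  have hs := hasDerivAt_iff_tendsto_slope.1 hD
  have hs2 := (hs.mono_left (nhdsWithin_mono x (show Iio x ⊆ {x}ᶜ from fun y hy => ne_of_lt hy))).eventually
    (Iio_mem_nhds hd)
  obtain ⟨y, hy1, hy2⟩ := (hs2.and (Ioo_mem_nhdsLT hax)).exists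
  have hy3 : F y ℓ ≤ F x ℓ := hmax ⟨hy2.1.le, hy2.2.le.trans hx.2⟩
  rw [slope_def_field] at hy1
  have : 0 ≤ (F y ℓ - F x ℓ) / (y - x) := div_nonneg_of_nonpos (by linarith) (by linarith [hy2.2])
  linarith [show (F y ℓ - F x ℓ) / (y - x) < 0 from hy1]

lemma AssumptionA.mu {Q F e₀} (hQ : AssumptionA Q F e₀) {ℓ : ℝ} (hℓ : 0 < ℓ) (s : ℝ) :
    muDist Q s ℓ = ENNReal.ofReal (4 * π ^ 2) * tau {x | s < F (en (uP (rhoF Q)) (x.1, x.2, ℓ)) ℓ} := by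
  have h := hQ.me
  have hu : Measurable (uP (rhoF Q)) := (h.rd.pot (by rw [← phiF_pot]; exact hQ.phi_ne)).cont.measurable
  have hF := (hQ.Fc hℓ.le).measurable
  rw [muDist_eq h.m hℓ (fun p => F (p.2 / 2 + uP (rhoF Q) p.1⁻¹) ℓ) (hF.comp (by fun_prop)) ?_]
  · have hS : MeasurableSet {x : ℝ × ℝ | s < F (en (uP (rhoF Q)) (x.1, x.2, ℓ)) ℓ} :=
      measurableSet_lt measurable_const (hF.comp ((en_meas hu).comp (by fun_prop)))
    unfold tau
    rw [Measure.prod_apply hS]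
    congr 1
    refine setLIntegral_congr_fun measurableSet_Ioi fun r hr => ?_
    have hS2 : MeasurableSet (Prod.mk r ⁻¹' {x : ℝ × ℝ | s < F (en (uP (rhoF Q)) (x.1, x.2, ℓ)) ℓ}) :=
      measurable_prodMk_left hS
    rw [← lintegral_indicator_one hS2]
    congr 1; ext w
    have : (w ^ 2 + ℓ / r ^ 2) / 2 + uP (rhoF Q) r⁻¹ = en (uP (rhoF Q)) (r, w, ℓ) := by
      unfold en
      have hr : 0 < r := hr
      field_simp; ring
    simp only [this]
    by_cases hm : s < F (en (uP (rhoF Q)) (r, w, ℓ)) ℓ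
    · rw [if_pos hm, indicator_of_mem (by exact hm)]; rfl
    · rw [if_neg hm, indicator_of_notMem (by exact hm)]
  · intro r v hr hv
    obtain ⟨h1, h2, h3⟩ := radPoint_facts hr hℓ hv
    rw [hQ.eqF, h3, microE, h2, phiF_pot, h.rd.newton (by rw [← norm_pos_iff, h1]; exact hr), h1]

lemma AssumptionA.qd {Q F e₀} (hQ : AssumptionA Q F e₀) : ∃ M L T, QD Q M L T := by
  have h := hQ.me
  have hp := h.rd.pot (by rw [← phiF_pot]; exact hQ.phi_ne)
  obtain ⟨M, hM⟩ := hQ.cpt.exists_bound_of_continuous hQ.contQ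
  have hcl : Continuous ellOf := by unfold ellOf; fun_prop
  obtain ⟨L, hL⟩ := (hQ.cpt.isCompact).exists_bound_of_continuousOn hcl.continuousOn
  set B := Cc (rhoF Q) / -e₀ * (2 * √(2 * Cc (rhoF Q))) with hB
  have hB0 : 0 ≤ B := mul_nonneg (div_nonneg hp.hC.le (by linarith [hQ.e₀neg])) (by positivity)
  refine ⟨max M 1, max L 1, B, hQ.contQ.measurable, by positivity, by positivity, hB0,
    fun z => (le_abs_self _).trans ((hM z).trans (le_max_left _ _)), ?_, ?_⟩
  · intro s ℓ hs hℓ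
    have hℓ0 : 0 < ℓ := lt_trans (by positivity) hℓ
    rw [muDist_eq h.m hℓ0 (fun _ => 0) measurable_const]
    · simp [not_lt.2 hs]
    · intro r v hr hv
      by_contra hc
      have h1 := hL _ (subset_tsupport _ hc)
      rw [(radPoint_facts hr hℓ0 hv).2.2] at h1
      have := (le_abs_self _).trans h1
      linarith [le_max_left L 1]
  · intro s ℓ hs hℓ
    rw [hQ.mu hℓ]
    have h1 : tau {x | s < F (en (uP (rhoF Q)) (x.1, x.2, ℓ)) ℓ} ≤ ENNReal.ofReal B := by
      refine (measure_mono ?_).trans (tau_Wl hp hℓ hQ.e₀neg)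
      intro x hx
      exact hQ.Fsupp _ ℓ hℓ.le (lt_of_le_of_lt hs hx)
    calc _ ≤ ENNReal.ofReal (4 * π ^ 2) * ENNReal.ofReal B := by gcongr
      _ = ENNReal.ofReal (4 * π ^ 2 * B) := (ENNReal.ofReal_mul (by positivity)).symm
      _ ≤ _ := by
        refine ENNReal.ofReal_le_ofReal ?_
        have : (1:ℝ) ≤ √2 := by rw [Real.one_le_sqrt]; norm_num
        have h3 : 0 ≤ 4 * π ^ 2 * B := by positivity
        nlinarith

lemma AssumptionA.fix {Q F e₀} (hQ : AssumptionA Q F e₀) : rearr Q Q =ᵐ[volume] Q := by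
  obtain ⟨M, L, T, hD⟩ := hQ.qd
  have h := hQ.me
  have hp := h.rd.pot (by rw [← phiF_pot]; exact hQ.phi_ne)
  filter_upwards [ae_good] with z hz
  set u := uP (rhoF Q) with hu
  set ℓ := ellOf z with hl
  have hℓ : 0 < ℓ := hz.2
  have key : ∀ s, 0 ≤ s → (s < rearr Q Q z ↔ s < Q z) := by
    intro s hs
    rw [hD.rearr_iff h hQ.phi_ne hs hz.2, hQ.eqF z, ← hl, ← hu]
    set S : Set (ℝ × ℝ) := {x | s < F (en u (x.1, x.2, ℓ)) ℓ} with hS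
    have hSf : tau S ≠ ⊤ := by
      refine ne_top_of_le_ne_top ?_ (measure_mono (show S ⊆ Wl u ℓ e₀ from fun x hx =>
        hQ.Fsupp _ ℓ hℓ.le (lt_of_le_of_lt hs hx)))
      exact ((tau_Wl hp hℓ hQ.e₀neg).trans_lt ENNReal.ofReal_lt_top).ne
    have h2 : (0:ℝ) < √2 := by positivity
    have hN : Nq Q s ℓ * (2 * √2) = (tau S).toReal := by
      unfold Nq
      rw [hQ.mu hℓ, ENNReal.toReal_mul, ENNReal.toReal_ofReal (by positivity)]
      have := Real.pi_pos
      field_simp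
      ring
    constructor
    · rintro ⟨he, hA⟩
      by_contra hc
      have hsub : S ⊆ Wl u ℓ (microE Q z) := by
        intro x hx
        by_contra hx2
        have := hQ.Fanti hℓ.le (not_lt.1 hx2)
        exact hc (lt_of_lt_of_le hx this)
      have h3 := ENNReal.toReal_mono ((tau_Wl hp hℓ he).trans_lt ENNReal.ofReal_lt_top).ne (measure_mono hsub)
      rw [tau_Wl_eq hp hℓ he, ← hN] at h3
      nlinarith
    · intro hF
      have he := hQ.Fsupp _ ℓ hℓ.le (lt_of_le_of_lt hs hF)
      refine ⟨he.trans hQ.e₀neg, ?_⟩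
      have hev := ((hQ.Fc hℓ.le).tendsto (microE Q z)).eventually (Ioi_mem_nhds hF)
      obtain ⟨e', he1, he2⟩ := ((hev.filter_mono nhdsWithin_le_nhds).and (Ioo_mem_nhdsGT he)).exists
      have he0 : e' < 0 := he2.2.trans hQ.e₀neg
      have hsub : Wl u ℓ e' ⊆ S := by
        intro x hx
        have := hQ.Fanti hℓ.le (show en u (x.1, x.2, ℓ) ≤ e' from le_of_lt hx)
        exact lt_of_lt_of_le he1 this
      have h3 := ENNReal.toReal_mono hSf (measure_mono hsub)
      rw [tau_Wl_eq hp hℓ he0, ← hN] at h3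
      have h4 : Af ℓ (microE Q z) u kap < Af ℓ e' u kap := by
        refine hp.Asmono hℓ he2.1 he0 ⟨‖z.1‖⁻¹, ?_⟩
        have h5 := micro_en h hz.1
        unfold en Pi3 at h5
        simp only at h5
        rw [← hu, ← hl] at h5
        have h6 := he2.1
        rw [h5] at h6
        have : ℓ / (2 * ‖z.1‖ ^ 2) = ℓ * ‖z.1‖⁻¹ ^ 2 / 2 := by
          have := hz.1
          field_simp
        have h7 := sq_nonneg (inner ℝ z.1 z.2 / ‖z.1‖)
        unfold xF
        linarith
      nlinarith
  have h1 := rearr_nn (Q := Q) (g := Q) z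
  have h2 := h.nn z
  refine le_antisymm (not_lt.1 fun hc => ?_) (not_lt.1 fun hc => ?_)
  · exact lt_irrefl _ ((key _ h2).1 hc)
  · exact lt_irrefl _ ((key _ h1).2 hc)

end

noncomputable section
open MeasureTheory Real Filter Set Topology
open scoped ENNReal NNReal

lemma diff_within {α : Type*} [MeasurableSpace α] {μ : Measure α} {G : ℝ → α → ℝ} {K : α → ℝ} {a : ℝ}
    (hint : ∀ b ∈ Icc (0:ℝ) 1, Integrable (G b) μ) (hK : Integrable K μ) (ha : a ∈ Icc (0:ℝ) 1)
    (hlip : ∀ᵐ y ∂μ, ∀ b ∈ Icc (0:ℝ) 1, |G b y - G a y| ≤ K y * |b - a|)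
    (hd : ∀ᵐ y ∂μ, ∃ D, HasDerivWithinAt (fun b => G b y) D (Icc 0 1) a) :
    ∃ D, HasDerivWithinAt (fun b => ∫ y, G b y ∂μ) D (Icc 0 1) a := by
  refine ⟨∫ y, derivWithin (fun b => G b y) (Icc 0 1) a ∂μ, ?_⟩
  rw [hasDerivWithinAt_iff_tendsto_slope]
  have hmem : ∀ᶠ b in 𝓝[Icc (0:ℝ) 1 \ {a}] a, b ∈ Icc (0:ℝ) 1 \ {a} := self_mem_nhdsWithin
  have key : Tendsto (fun b => ∫ y, slope (fun b => G b y) a b ∂μ) (𝓝[Icc (0:ℝ) 1 \ {a}] a)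
      (𝓝 (∫ y, derivWithin (fun b => G b y) (Icc 0 1) a ∂μ)) := by
    refine tendsto_integral_filter_of_dominated_convergence K ?_ ?_ hK ?_
    · filter_upwards [hmem] with b hb
      simp only [slope_def_field]
      exact (((hint b hb.1).sub (hint a ha)).div_const _).aestronglyMeasurable
    · filter_upwards [hmem] with b hb
      filter_upwards [hlip] with y hy
      have hne : 0 < |b - a| := abs_pos.2 (sub_ne_zero.2 hb.2)
      rw [slope_def_field, Real.norm_eq_abs, abs_div, div_le_iff₀ hne]
      exact hy b hb.1
    · filter_upwards [hd] with y hy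
      obtain ⟨D, hD⟩ := hy
      exact hasDerivWithinAt_iff_tendsto_slope.1 hD.differentiableWithinAt.hasDerivWithinAt
  refine key.congr' ?_
  filter_upwards [hmem] with b hb
  simp only [slope_def_field]
  rw [integral_div, integral_sub (hint b hb.1) (hint a ha)]

lemma deriv_squeeze {J B : ℝ → ℝ} {a : ℝ} (ha : a ∈ Icc (0:ℝ) 1)
    (h : ∀ x ∈ Icc (0:ℝ) 1, ∀ y ∈ Icc (0:ℝ) 1, J y - J x ≤ (y - x) * B x)
    (hB : ContinuousWithinAt B (Icc 0 1) a) : HasDerivWithinAt J (B a) (Icc 0 1) a := by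
  rw [hasDerivWithinAt_iff_tendsto_slope, tendsto_iff_norm_sub_tendsto_zero]
  have hmem : ∀ᶠ b in 𝓝[Icc (0:ℝ) 1 \ {a}] a, b ∈ Icc (0:ℝ) 1 \ {a} := self_mem_nhdsWithin
  have h1 : Tendsto (fun b => ‖B b - B a‖) (𝓝[Icc (0:ℝ) 1 \ {a}] a) (𝓝 0) :=
    tendsto_iff_norm_sub_tendsto_zero.1 (hB.mono_left (nhdsWithin_mono _ sdiff_subset))
  refine squeeze_zero' (Eventually.of_forall fun _ => norm_nonneg _) ?_ h1
  filter_upwards [hmem] with b hb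
  have hne : 0 < |b - a| := abs_pos.2 (sub_ne_zero.2 hb.2)
  have hne2 : b - a ≠ 0 := sub_ne_zero.2 hb.2
  have e : slope J a b - B a = (J b - J a - (b - a) * B a) / (b - a) := by
    rw [slope_def_field]; field_simp
  rw [e, norm_div, Real.norm_eq_abs, Real.norm_eq_abs, Real.norm_eq_abs, div_le_iff₀ hne, ← abs_mul]
  have a1 := h a ha b hb.1
  have a2 := h b hb.1 a ha
  rw [abs_of_nonpos (by linarith)]
  refine le_trans ?_ (neg_le_abs _)
  nlinarith

section
variable {Q : Phase → ℝ} {M L T C c δ : ℝ} {u0 u1 u : ℝ → ℝ}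

lemma lev_ex (h : QD Q M L T) (hδ0 : 0 < δ)
    (hδ : ∀ u, Pot C c u → ∀ ℓ, 0 < ℓ → ℓ ≤ L → T < Af ℓ (-δ) u kap) (hu : Pot C c u) {ℓ s : ℝ}
    (hℓ : 0 < ℓ) (hs : 0 ≤ s) (hN : 0 < Nq Q s ℓ) : ℓ ≤ L ∧ ∃ E, Lev ℓ u (Nq Q s ℓ) E := by
  have hL : ℓ ≤ L := by
    by_contra hc
    rw [h.Nq_zero hs (not_le.1 hc)] at hN
    exact lt_irrefl _ hN
  obtain ⟨E, hE, -⟩ := hu.lev_exists hℓ hN (neg_lt_zero.2 hδ0)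
    (lt_of_le_of_lt (h.Nq_le hs hℓ) (hδ u hu ℓ hℓ hL))
  exact ⟨hL, E, hE⟩

lemma sec_pos (hu : Pot C c u) {ℓ s E : ℝ} (hℓ : 0 < ℓ) (hN : 0 < Nq Q s ℓ)
    (hE : Lev ℓ u (Nq Q s ℓ) E) (b : (ℝ × ℝ) × (ℝ × ℝ) → ℝ) (x : ℝ × ℝ) :
    (ASet Q u).indicator b ((ℓ, s), x) = (Wl u ℓ E).indicator (fun x => b ((ℓ, s), x)) x := by
  have hi : ((ℓ, s), x) ∈ ASet Q u ↔ x ∈ Wl u ℓ E := hE.lt_iff hu hℓ hN _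
  by_cases hm : x ∈ Wl u ℓ E
  · rw [indicator_of_mem hm, indicator_of_mem (hi.2 hm)]
  · rw [indicator_of_notMem hm, indicator_of_notMem (fun h' => hm (hi.1 h'))]

lemma sec_zero {ℓ s : ℝ} (hN : ¬ 0 < Nq Q s ℓ) (b : (ℝ × ℝ) × (ℝ × ℝ) → ℝ) (x : ℝ × ℝ) :
    (ASet Q u).indicator b ((ℓ, s), x) = 0 := by
  refine indicator_of_notMem (fun hm => hN (lt_of_le_of_lt ?_ hm.2)) _
  unfold Af
  exact integral_nonneg fun q => mul_nonneg (by unfold kap; positivity) (Real.sqrt_nonneg _)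

/-- the sectional derivative term -/
def Bs (Q : Phase → ℝ) (u0 u1 : ℝ → ℝ) (b : ℝ) (y : ℝ × ℝ) : ℝ :=
  ∫ x, (ASet Q (ul u0 u1 b)).indicator (fun p => hd u0 u1 p.2.1⁻¹) (y, x) ∂tau

lemma Bs_zero {ℓ s b : ℝ} (hN : ¬ 0 < Nq Q s ℓ) : Bs Q u0 u1 b (ℓ, s) = 0 := by
  unfold Bs
  simp only [sec_zero hN, integral_zero]

lemma Bs_pos (h0 : Pot C c u0) (h1 : Pot C c u1) {ℓ s b E : ℝ} (hb : b ∈ Icc (0:ℝ) 1) (hℓ : 0 < ℓ)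
    (hN : 0 < Nq Q s ℓ) (hE : Lev ℓ (ul u0 u1 b) (Nq Q s ℓ) E) :
    Bs Q u0 u1 b (ℓ, s) = 2 * √2 * Af ℓ E (ul u0 u1 b) (fun q => hd u0 u1 q * kap q) := by
  unfold Bs
  have hp := h0.seg h1 hb
  simp only [sec_pos hp hℓ hN hE]
  have hm : Measurable (hd u0 u1) := by
    unfold hd; exact h1.cont.measurable.sub h0.cont.measurable
  exact (tau_int hp hm (fun q hq => (hd_bd h0 h1 hq).1) hℓ hE.neg).2

def Kb (C L : ℝ) (ℓ : ℝ) : ℝ :=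
  (Ioc 0 L).indicator (fun ℓ => 2 * √2 * (2 * C ^ 2 * ((√(ℓ / 2))⁻¹ * ∫ τ, Wt τ))) ℓ

lemma Kb_int (C L M : ℝ) : Integrable (fun y : ℝ × ℝ => Kb C L y.1) (kM M) := by
  unfold kM
  refine Integrable.comp_fst (f := Kb C L) ?_ _
  refine Integrable.restrict ?_
  unfold Kb
  rw [integrable_indicator_iff measurableSet_Ioc]
  by_cases hL : 0 ≤ L
  · have h1 := (intervalIntegrable_iff_integrableOn_Ioc_of_le hL).1
      (intervalIntegral.intervalIntegrable_rpow' (a := 0) (b := L) (r := -(1/2)) (by norm_num))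
    have h2 := h1.const_mul (2 * √2 * (2 * C ^ 2 * (√2 * ∫ τ, Wt τ)))
    refine h2.congr ?_
    refine (ae_restrict_mem measurableSet_Ioc).mono fun ℓ hℓ => ?_
    have hl : 0 < ℓ := hℓ.1
    simp only
    rw [Real.rpow_neg hl.le, ← Real.sqrt_eq_rpow, Real.sqrt_div hl.le]
    have : 0 < √ℓ := Real.sqrt_pos.2 hl
    field_simp
  · rw [Ioc_eq_empty (by linarith)]; exact integrableOn_empty

lemma Bs_lip (h : QD Q M L T) (hδ0 : 0 < δ)
    (hδ : ∀ u, Pot C c u → ∀ ℓ, 0 < ℓ → ℓ ≤ L → T < Af ℓ (-δ) u kap) (h0 : Pot C c u0)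
    (h1 : Pot C c u1) {ℓ s a b : ℝ} (hℓ : 0 < ℓ) (hs : 0 ≤ s) (ha : a ∈ Icc (0:ℝ) 1)
    (hb : b ∈ Icc (0:ℝ) 1) :
    |Bs Q u0 u1 b (ℓ, s) - Bs Q u0 u1 a (ℓ, s)| ≤ Kb C L ℓ * |b - a| := by
  by_cases hN : 0 < Nq Q s ℓ
  · obtain ⟨hL, Ea, hEa⟩ := lev_ex h hδ0 hδ (h0.seg h1 ha) hℓ hs hN
    obtain ⟨-, Eb, hEb⟩ := lev_ex h hδ0 hδ (h0.seg h1 hb) hℓ hs hN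
    rw [Bs_pos h0 h1 ha hℓ hN hEa, Bs_pos h0 h1 hb hℓ hN hEb, ← mul_sub, abs_mul,
      abs_of_nonneg (by positivity), Kb, indicator_of_mem (show ℓ ∈ Ioc 0 L from ⟨hℓ, hL⟩), mul_assoc (2 * √2)]
    exact mul_le_mul_of_nonneg_left (B_lip h0 h1 hℓ hN ha hb hEa hEb) (by positivity)
  · rw [Bs_zero hN, Bs_zero hN, sub_zero, abs_zero]
    refine mul_nonneg (indicator_nonneg (fun ℓ _ => ?_) _) (abs_nonneg _)
    have : 0 ≤ ∫ τ, Wt τ := integral_nonneg Wt_nonneg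
    positivity

lemma Bs_deriv (h : QD Q M L T) (hδ0 : 0 < δ)
    (hδ : ∀ u, Pot C c u → ∀ ℓ, 0 < ℓ → ℓ ≤ L → T < Af ℓ (-δ) u kap) (h0 : Pot C c u0)
    (h1 : Pot C c u1) {ℓ s a : ℝ} (hℓ : 0 < ℓ) (hs : 0 ≤ s) (ha : a ∈ Icc (0:ℝ) 1) :
    ∃ D, HasDerivWithinAt (fun b => Bs Q u0 u1 b (ℓ, s)) D (Icc 0 1) a := by
  by_cases hN : 0 < Nq Q s ℓ
  · have hex : ∀ b, ∃ E, b ∈ Icc (0:ℝ) 1 → Lev ℓ (ul u0 u1 b) (Nq Q s ℓ) E := by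
      intro b
      by_cases hb : b ∈ Icc (0:ℝ) 1
      · obtain ⟨-, E, hE⟩ := lev_ex h hδ0 hδ (h0.seg h1 hb) hℓ hs hN
        exact ⟨E, fun _ => hE⟩
      · exact ⟨0, fun h' => (hb h').elim⟩
    choose En hEn using hex
    obtain ⟨D, hD⟩ := B_deriv h0 h1 hℓ hN hEn ha
    refine ⟨2 * √2 * D, (hD.const_mul (2 * √2)).congr (fun b hb => ?_) ?_⟩
    · exact Bs_pos h0 h1 hb hℓ hN (hEn b hb)
    · exact Bs_pos h0 h1 ha hℓ hN (hEn a ha)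
  · refine ⟨0, ?_⟩
    simp only [Bs_zero hN]
    exact hasDerivWithinAt_const _ _ _

lemma bathtub (h : QD Q M L T) (hδ0 : 0 < δ)
    (hδ : ∀ u, Pot C c u → ∀ ℓ, 0 < ℓ → ℓ ≤ L → T < Af ℓ (-δ) u kap) (h0 : Pot C c u0)
    (h1 : Pot C c u1) {ℓ s : ℝ} (hℓ : 0 < ℓ) (hs : 0 ≤ s)
    (i0 : Integrable (fun x => (ASet Q u0).indicator (fun p => en u1 (p.2.1, p.2.2, p.1.1)) ((ℓ, s), x)) tau)
    (i1 : Integrable (fun x => (ASet Q u1).indicator (fun p => en u1 (p.2.1, p.2.2, p.1.1)) ((ℓ, s), x)) tau) :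
    ∫ x, (ASet Q u1).indicator (fun p => en u1 (p.2.1, p.2.2, p.1.1)) ((ℓ, s), x) ∂tau ≤
    ∫ x, (ASet Q u0).indicator (fun p => en u1 (p.2.1, p.2.2, p.1.1)) ((ℓ, s), x) ∂tau := by
  by_cases hN : 0 < Nq Q s ℓ
  · obtain ⟨hL, E0, hE0⟩ := lev_ex h hδ0 hδ h0 hℓ hs hN
    obtain ⟨-, E1, hE1⟩ := lev_ex h hδ0 hδ h1 hℓ hs hN
    simp only [sec_pos h0 hℓ hN hE0] at i0 ⊢
    simp only [sec_pos h1 hℓ hN hE1] at i1 ⊢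
    obtain ⟨j0, k0⟩ := tau_int (k := fun _ => E1) (K := |E1|) h0 measurable_const (fun _ _ => le_rfl) hℓ hE0.neg
    obtain ⟨j1, k1⟩ := tau_int (k := fun _ => E1) (K := |E1|) h1 measurable_const (fun _ _ => le_rfl) hℓ hE1.neg
    have e : ∀ (u : ℝ → ℝ) (E : ℝ), Lev ℓ u (Nq Q s ℓ) E → Af ℓ E u (fun q => E1 * kap q) = E1 * Nq Q s ℓ := by
      intro u E hE
      rw [← hE.eq]; unfold Af
      rw [← integral_const_mul]; simp only [mul_assoc]
    rw [e _ _ hE0] at k0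
    rw [e _ _ hE1] at k1
    have hm : ∫ x, ((Wl u1 ℓ E1).indicator (fun x => en u1 (x.1, x.2, ℓ)) x -
        (Wl u1 ℓ E1).indicator (fun _ => E1) x) ∂tau ≤
        ∫ x, ((Wl u0 ℓ E0).indicator (fun x => en u1 (x.1, x.2, ℓ)) x -
        (Wl u0 ℓ E0).indicator (fun _ => E1) x) ∂tau := by
      refine integral_mono (i1.sub j1) (i0.sub j0) fun x => ?_
      simp only
      by_cases hx1 : x ∈ Wl u1 ℓ E1
      · have : en u1 (x.1, x.2, ℓ) < E1 := hx1
        simp only [indicator_of_mem hx1]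
        by_cases hx0 : x ∈ Wl u0 ℓ E0
        · simp only [indicator_of_mem hx0]; exact le_rfl
        · simp only [indicator_of_notMem hx0]; linarith
      · have : ¬ en u1 (x.1, x.2, ℓ) < E1 := hx1
        simp only [indicator_of_notMem hx1]
        by_cases hx0 : x ∈ Wl u0 ℓ E0
        · simp only [indicator_of_mem hx0]; linarith
        · simp only [indicator_of_notMem hx0]; exact le_rfl
    rw [integral_sub i1 j1, integral_sub i0 j0, k0, k1] at hm
    linarith
  · simp only [sec_zero hN]; exact le_rfl
end

end

noncomputable section
open MeasureTheory Real Filter Set Topology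
open scoped ENNReal NNReal

section
variable {Q f g : Phase → ℝ} {M L T : ℝ}

def Bb (Q f g : Phase → ℝ) (b : ℝ) : ℝ := ∫ z, (phiF g z.1 - phiF f z.1) * rearr Q (gl f g b) z

lemma ne_pot (h : phiF f ≠ 0) : potE (rhoF f) ≠ 0 := by rw [← phiF_pot]; exact h

lemma Bb_int (h : QD Q M L T) (hf : ME f) (hg : ME g) (hf0 : phiF f ≠ 0) (hg0 : phiF g ≠ 0) {b : ℝ}
    (hb : b ∈ Icc (0:ℝ) 1) : Integrable (fun z => (phiF g z.1 - phiF f z.1) * rearr Q (gl f g b) z) := by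
  have hr := h.rearr_ME (gl_ME hf hg hb) (phi_gl_ne hf hg hf0 hg0 hb)
  have := (int_phi_int hg.rd (ne_pot hg0) hr).sub (int_phi_int hf.rd (ne_pot hf0) hr)
  rw [← phiF_pot, ← phiF_pot] at this
  refine this.congr (ae_of_all _ fun z => ?_)
  simp only [Pi.sub_apply]; ring

lemma common (hf : ME f) (hg : ME g) (hf0 : phiF f ≠ 0) (hg0 : phiF g ≠ 0) :
    ∃ C c, Pot C c (uP (rhoF f)) ∧ Pot C c (uP (rhoF g)) := by
  have p0 := hf.rd.pot (ne_pot hf0)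
  have p1 := hg.rd.pot (ne_pot hg0)
  have hc := lt_min p0.hc p1.hc
  exact ⟨_, _, p0.weaken (le_max_left _ _) hc (min_le_left _ _),
    p1.weaken (le_max_right _ _) hc (min_le_right _ _)⟩

lemma kM_ae (M : ℝ) : ∀ᵐ y ∂(kM M), 0 < y.1 ∧ 0 < y.2 := by
  unfold kM
  have h1 := (Measure.quasiMeasurePreserving_fst (μ := volume.restrict (Ioi (0:ℝ)))
    (ν := sM M)).ae (ae_restrict_mem measurableSet_Ioi)
  have h2 : ∀ᵐ s ∂(sM M), 0 < s := by
    unfold sM; exact (ae_restrict_mem measurableSet_Ioo).mono fun s hs => hs.1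
  have h3 := (Measure.quasiMeasurePreserving_snd (μ := volume.restrict (Ioi (0:ℝ)))
    (ν := sM M)).ae h2
  filter_upwards [h1, h3] with y a b using ⟨a, b⟩

lemma Bb_eq (h : QD Q M L T) (hf : ME f) (hg : ME g) (hf0 : phiF f ≠ 0) (hg0 : phiF g ≠ 0) {b : ℝ}
    (hb : b ∈ Icc (0:ℝ) 1) : Integrable (Bs Q (uP (rhoF f)) (uP (rhoF g)) b) (kM M) ∧
    Bb Q f g b = 4 * π ^ 2 * ∫ y, Bs Q (uP (rhoF f)) (uP (rhoF g)) b y ∂(kM M) := by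
  obtain ⟨C, c, p0, p1⟩ := common hf hg hf0 hg0
  have e : (fun z => (phiF g z.1 - phiF f z.1) * rearr Q (gl f g b) z) =ᵐ[volume]
      fun z => (fun p : ℝ × ℝ × ℝ => hd (uP (rhoF f)) (uP (rhoF g)) p.1⁻¹) (Pi3 z) * rearr Q (gl f g b) z := by
    filter_upwards [ae_good] with z hz
    have hz1 : z.1 ≠ 0 := norm_pos_iff.1 hz.1
    simp only [hd, Pi3]
    rw [phiF_pot, phiF_pot, hg.rd.newton hz1, hf.rd.newton hz1]
  have hm : Measurable (hd (uP (rhoF f)) (uP (rhoF g))) := by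
    unfold hd; exact p1.cont.measurable.sub p0.cont.measurable
  have hl := layerQ h (gl_ME hf hg hb) (phi_gl_ne hf hg hf0 hg0 hb)
    (b := fun p : ℝ × ℝ × ℝ => hd (uP (rhoF f)) (uP (rhoF g)) p.1⁻¹)
    (hm.comp (by fun_prop)) ((Bb_int h hf hg hf0 hg0 hb).congr e)
  rw [uP_gl hf hg] at hl
  refine ⟨hl.1.integral_prod_left, ?_⟩
  unfold Bb
  rw [integral_congr_ae e]
  exact hl.2

lemma Bb_diff (h : QD Q M L T) (hf : ME f) (hg : ME g) (hf0 : phiF f ≠ 0) (hg0 : phiF g ≠ 0) {a : ℝ}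
    (ha : a ∈ Icc (0:ℝ) 1) : ∃ D, HasDerivWithinAt (Bb Q f g) D (Icc 0 1) a := by
  obtain ⟨C, c, p0, p1⟩ := common hf hg hf0 hg0
  obtain ⟨δ, hδ0, hδ⟩ := Alarge (C := C) p0.hc h.hT h.hL
  obtain ⟨D, hD⟩ := diff_within (a := a) (fun b hb => (Bb_eq h hf hg hf0 hg0 hb).1) (Kb_int C L M) ha
    (by
      filter_upwards [kM_ae M] with y hy b hb
      exact Bs_lip h hδ0 hδ p0 p1 hy.1 hy.2.le ha hb)
    (by
      filter_upwards [kM_ae M] with y hy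
      exact Bs_deriv h hδ0 hδ p0 p1 hy.1 hy.2.le ha)
  exact ⟨4 * π ^ 2 * D, (hD.const_mul (4 * π ^ 2)).congr (fun b hb => (Bb_eq h hf hg hf0 hg0 hb).2)
    (Bb_eq h hf hg hf0 hg0 ha).2⟩

lemma X_le (h : QD Q M L T) (hf : ME f) (hg : ME g) (hf0 : phiF f ≠ 0) (hg0 : phiF g ≠ 0) :
    ∫ z, microE g z * rearr Q g z ≤ ∫ z, microE g z * rearr Q f z := by
  obtain ⟨C, c, p0, p1⟩ := common hf hg hf0 hg0
  obtain ⟨δ, hδ0, hδ⟩ := Alarge (C := C) p0.hc h.hT h.hL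
  have e : ∀ k : Phase → ℝ, (fun z => microE g z * k z) =ᵐ[volume]
      fun z => en (uP (rhoF g)) (Pi3 z) * k z := by
    intro k
    filter_upwards [ae_good] with z hz
    rw [micro_en hg hz.1]
  have hm := en_meas p1.cont.measurable
  have l0 := layerQ h hf hf0 hm ((microE_int hg hg0 (h.rearr_ME hf hf0)).congr (e _))
  have l1 := layerQ h hg hg0 hm ((microE_int hg hg0 (h.rearr_ME hg hg0)).congr (e _))
  rw [integral_congr_ae (e _), integral_congr_ae (e (rearr Q f)), l0.2, l1.2]
  refine mul_le_mul_of_nonneg_left ?_ (by positivity)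
  refine integral_mono_ae l1.1.integral_prod_left l0.1.integral_prod_left ?_
  filter_upwards [kM_ae M, l0.1.prod_right_ae, l1.1.prod_right_ae] with y hy i0 i1
  exact bathtub h hδ0 hδ p0 p1 hy.1 hy.2.le i0 i1

lemma J0_le (h : QD Q M L T) (hf : ME f) (hg : ME g) (hf0 : phiF f ≠ 0) (hg0 : phiF g ≠ 0) {x y : ℝ}
    (hx : x ∈ Icc (0:ℝ) 1) (hy : y ∈ Icc (0:ℝ) 1) :
    (∫ z, microE (gl f g y) z * rearr Q (gl f g y) z) - (∫ z, microE (gl f g x) z * rearr Q (gl f g x) z) ≤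
      (y - x) * Bb Q f g x := by
  have gx := gl_ME hf hg hx
  have gy := gl_ME hf hg hy
  have nx := phi_gl_ne hf hg hf0 hg0 hx
  have ny := phi_gl_ne hf hg hf0 hg0 hy
  have hr := h.rearr_ME gx nx
  have h1 := X_le h gx gy nx ny
  have h2 : (∫ z, microE (gl f g y) z * rearr Q (gl f g x) z) -
      (∫ z, microE (gl f g x) z * rearr Q (gl f g x) z) = (y - x) * Bb Q f g x := by
    rw [← integral_sub (microE_int gy ny hr) (microE_int gx nx hr), Bb, ← integral_const_mul]
    congr 1; ext z
    unfold microE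
    rw [phi_gl hf hg, phi_gl hf hg]; ring
  linarith

def Idr (f g : Phase → ℝ) (a : ℝ) : ℝ :=
  (-(2 * (1 - a)) * (∫ x, Ik (rhoF f) (rhoF f) x) + (2 * (1 - a) - 2 * a) * (∫ x, Ik (rhoF f) (rhoF g) x) +
    2 * a * ∫ x, Ik (rhoF g) (rhoF g) x) / 2

lemma J_deriv (h : QD Q M L T) (hf : ME f) (hg : ME g) (hf0 : phiF f ≠ 0) (hg0 : phiF g ≠ 0) {a : ℝ}
    (ha : a ∈ Icc (0:ℝ) 1) :
    HasDerivWithinAt (fun μ => Jred Q (gl f g μ)) (Bb Q f g a + Idr f g a) (Icc 0 1) a := by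
  obtain ⟨D, hD⟩ := Bb_diff h hf hg hf0 hg0 ha
  have h1 := deriv_squeeze (J := fun b => ∫ z, microE (gl f g b) z * rearr Q (gl f g b) z) ha
    (fun x hx y hy => J0_le h hf hg hf0 hg0 hx hy) hD.continuousWithinAt
  set A := ∫ x, Ik (rhoF f) (rhoF f) x with hA
  set B := ∫ x, Ik (rhoF f) (rhoF g) x with hB
  set G := ∫ x, Ik (rhoF g) (rhoF g) x with hG
  have h2 : HasDerivAt (fun μ : ℝ => ((1 - μ) ^ 2 * A + 2 * μ * (1 - μ) * B + μ ^ 2 * G) / 2) (Idr f g a) a := by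
    have i1 : HasDerivAt (fun μ : ℝ => 1 - μ) (-1) a := (hasDerivAt_id a).const_sub 1
    have i2 : HasDerivAt (fun μ : ℝ => μ) 1 a := hasDerivAt_id a
    have := (((i1.pow 2).mul_const A).add (((i2.const_mul 2).mul i1).mul_const B)).add ((i2.pow 2).mul_const G)
    have h3 := this.div_const 2
    refine HasDerivAt.congr_deriv h3 ?_
    unfold Idr
    rw [← hA, ← hB, ← hG]
    push_cast; ring
  refine (h1.add h2.hasDerivWithinAt).congr ?_ ?_
  · intro b hb
    rw [Jred_eq (gl_ME hf hg hb) (phi_gl_ne hf hg hf0 hg0 hb)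
      (h.rearr_ME (gl_ME hf hg hb) (phi_gl_ne hf hg hf0 hg0 hb)), Ik_gl hf hg]
    rfl
  · rw [Jred_eq (gl_ME hf hg ha) (phi_gl_ne hf hg hf0 hg0 ha)
      (h.rearr_ME (gl_ME hf hg ha) (phi_gl_ne hf hg hf0 hg0 ha)), Ik_gl hf hg]
    rfl

lemma Idr_diff (f g : Phase → ℝ) (a : ℝ) : DifferentiableAt ℝ (Idr f g) a := by
  unfold Idr; fun_prop
end
end

/-- Differentiability of the reduced functional `J` along segments of `Φ_rad`, and
criticality of `φ_Q`. -/
theorem stmt19 (Q : Phase → ℝ) (F : ℝ → ℝ → ℝ) (e₀ : ℝ) (hQ : AssumptionA Q F e₀) :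
    (∀ f g : Phase → ℝ, memErad f → memErad g → phiF f ≠ 0 → phiF g ≠ 0 →
      ∃ D1 D2 : ℝ → ℝ,
        (∀ lam ∈ Icc (0:ℝ) 1,
          HasDerivWithinAt (fun μ : ℝ => Jred Q (fun z => (1 - μ) * f z + μ * g z))
            (D1 lam) (Icc 0 1) lam) ∧
        (∀ lam ∈ Icc (0:ℝ) 1, HasDerivWithinAt D1 (D2 lam) (Icc 0 1) lam)) ∧
    (∀ f : Phase → ℝ, memErad f → phiF f ≠ 0 →
      HasDerivWithinAt (fun μ : ℝ => Jred Q (fun z => (1 - μ) * Q z + μ * f z))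
        0 (Icc 0 1) 0) := by
  obtain ⟨M, L, T, h⟩ := hQ.qd
  constructor
  · intro f g hf hg hf0 hg0
    rw [memErad_iff] at hf hg
    refine ⟨fun a => Bb Q f g a + Idr f g a,
      derivWithin (fun a => Bb Q f g a + Idr f g a) (Icc 0 1), fun a ha => J_deriv h hf hg hf0 hg0 ha,
      fun a ha => ?_⟩
    obtain ⟨D, hD⟩ := Bb_diff h hf hg hf0 hg0 ha
    exact (hD.differentiableWithinAt.add (Idr_diff f g a).differentiableWithinAt).hasDerivWithinAt
  · intro f hf hf0
    rw [memErad_iff] at hf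
    have hq := hQ.me
    have hq0 := hQ.phi_ne
    have h0 := J_deriv h hq hf hq0 hf0 (left_mem_Icc.2 zero_le_one)
    have e : gl Q f 0 = Q := by ext z; simp [gl]
    have hz : Bb Q Q f 0 + Idr Q f 0 = 0 := by
      have h1 : Bb Q Q f 0 = (∫ z, potE (rhoF f) z.1 * Q z) - ∫ z, potE (rhoF Q) z.1 * Q z := by
        unfold Bb
        rw [← integral_sub (int_phi_int hf.rd (ne_pot hf0) hq) (int_phi_int hq.rd (ne_pot hq0) hq), e]
        refine integral_congr_ae ?_
        filter_upwards [hQ.fix] with z hz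
        rw [hz, phiF_pot, phiF_pot]; ring
      have h2 := I_phase hf.rd (ne_pot hf0) hq
      have h3 := I_phase hq.rd (ne_pot hq0) hq
      have h4 : ∫ x, Ik (rhoF f) (rhoF Q) x = ∫ x, Ik (rhoF Q) (rhoF f) x := by
        congr 1; ext x; unfold Ik; rw [mul_comm (mP (rhoF f) _)]
      rw [h4] at h2
      unfold Idr
      rw [h1, h2, h3]; ring
    rw [hz] at h0
    exact h0
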